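/- Let u be a smooth solution of (−Δ)^{3/2}u = 2e^{3u} with finite volume. Then the following are equivalent: (i) u is a spherical solution, i.e. there exist λ > 0 and x₀ ∈ ℝ³ with u(x) = log(2λ/(1+λ²|x−x₀|²)) for all x; (ii) the function p := u − v is constant on ℝ³; (iii) Δu(x) → 0 as |x| → ∞; (iv) u(x)/|x|² → 0 as |x| → ∞. -/

import Mathlib

open MeasureTheory Real Filter

noncomputable section

abbrev E3 := EuclideanSpace ℝ (Fin 3)

/-- The Laplacian of `f : ℝ³ → ℝ` as the sum of second partial derivatives. -/
def lap (f : E3 → ℝ) (x : E3) : ℝ :=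
  ∑ i, fderiv ℝ (fun y => fderiv ℝ f y (EuclideanSpace.single i 1)) x (EuclideanSpace.single i 1)

/-- The half Laplacian `(-Δ)^{1/2} φ` of a Schwartz function on ℝ³, defined as a
principal value: `(1/π²) lim_{ε→0⁺} ∫_{|x−y|>ε} (φ(x)−φ(y))/|x−y|⁴ dy`. -/
def halfLap (φ : SchwartzMap E3 ℝ) (x : E3) : ℝ :=
  limUnder (nhdsWithin (0:ℝ) (Set.Ioi 0)) fun ε =>
    (1 / π ^ 2) * ∫ y in {y : E3 | ε < ‖x - y‖}, (φ x - φ y) / ‖x - y‖ ^ 4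

/-- `w ∈ L_{1/2}(ℝ³)`. -/
def MemL12 (w : E3 → ℝ) : Prop :=
  LocallyIntegrable w volume ∧ Integrable (fun x => |w x| / (1 + ‖x‖ ^ 4)) volume

/-- `u` is a smooth solution of `(-Δ)^{3/2} u = 2 e^{3u}` in ℝ³ with finite volume. -/
def IsSolution (u : E3 → ℝ) : Prop :=
  ContDiff ℝ (⊤ : ℕ∞) u ∧ MemL12 (lap u) ∧ Integrable (fun x => exp (3 * u x)) volume ∧
    ∀ φ : SchwartzMap E3 ℝ,
      ∫ x, (-(lap u x)) * halfLap φ x = 2 * ∫ x, exp (3 * u x) * φ x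

/-- `u` is a spherical solution. -/
def IsSpherical (u : E3 → ℝ) : Prop :=
  ∃ lam : ℝ, 0 < lam ∧ ∃ x₀ : E3, ∀ x, u x = log (2 * lam / (1 + lam ^ 2 * ‖x - x₀‖ ^ 2))

/-- `α = (1/π²) ∫ e^{3u}`. -/
def solAlpha (u : E3 → ℝ) : ℝ := (1 / π ^ 2) * ∫ y, exp (3 * u y)

/-- `v(x) = (1/π²) ∫ log(|y|/|x−y|) e^{3u(y)} dy`. -/
def solV (u : E3 → ℝ) (x : E3) : ℝ :=
  (1 / π ^ 2) * ∫ y, log (‖y‖ / ‖x - y‖) * exp (3 * u y)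

end

open scoped Topology

lemma E3.finrank_eq : Module.finrank ℝ E3 = 3 := by simp

lemma E3.volume_real_unitBall : (volume : Measure E3).real (Metric.ball 0 1) = 4 * π / 3 := by
  rw [Measure.real, EuclideanSpace.volume_ball_fin_three]
  rw [ENNReal.ofReal_one, one_pow, one_mul, ENNReal.toReal_ofReal (by positivity)]
  ring

lemma integrable_radial_iff {g : ℝ → ℝ} :
    Integrable (fun x : E3 => g ‖x‖) ↔ IntegrableOn (fun r : ℝ => r ^ 2 * g r) (Set.Ioi 0) := by
  have := integrable_fun_norm_addHaar (E := E3) (volume : Measure E3) (f := g)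
  simpa [E3.finrank_eq] using this

lemma integral_radial (g : ℝ → ℝ) :
    ∫ x : E3, g ‖x‖ = 4 * π * ∫ r in Set.Ioi (0:ℝ), r ^ 2 * g r := by
  have := integral_fun_norm_addHaar (E := E3) (volume : Measure E3) g
  rw [this, E3.volume_real_unitBall, E3.finrank_eq]
  simp only [nsmul_eq_mul, smul_eq_mul]
  push_cast
  ring

/-- Inversion in the sphere of radius `a` about the origin. -/
noncomputable def kelvin (a : ℝ) (z : E3) : E3 := (a ^ 2 / ‖z‖ ^ 2) • z

lemma norm_kelvin {a : ℝ} (z : E3) : ‖kelvin a z‖ = a ^ 2 / ‖z‖ := by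
  rcases eq_or_ne z 0 with rfl | hz
  · simp [kelvin]
  · have : ‖z‖ ≠ 0 := norm_ne_zero_iff.2 hz
    rw [kelvin, norm_smul, Real.norm_of_nonneg (by positivity)]
    field_simp

lemma kelvin_ne_zero {a : ℝ} (ha : a ≠ 0) {z : E3} (hz : z ≠ 0) : kelvin a z ≠ 0 := by
  have : ‖z‖ ≠ 0 := norm_ne_zero_iff.2 hz
  rw [← norm_ne_zero_iff, norm_kelvin]
  positivity

lemma kelvin_kelvin {a : ℝ} (ha : a ≠ 0) {z : E3} (hz : z ≠ 0) : kelvin a (kelvin a z) = z := by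
  have : ‖z‖ ≠ 0 := norm_ne_zero_iff.2 hz
  conv_lhs => rw [kelvin, norm_kelvin]
  rw [kelvin, smul_smul]
  have : a ^ 2 / (a ^ 2 / ‖z‖) ^ 2 * (a ^ 2 / ‖z‖ ^ 2) = 1 := by field_simp
  rw [this, one_smul]

lemma kelvin_eq_inversion (a : ℝ) : kelvin a = EuclideanGeometry.inversion (0 : E3) a := by
  ext1 z
  simp [kelvin, EuclideanGeometry.inversion, div_pow]

lemma E3.abs_det_smul_reflection (c : ℝ) (K : Submodule ℝ E3) :
    |(c • (K.reflection : E3 →L[ℝ] E3)).det| = |c| ^ 3 := by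
  have h1 : (c • (K.reflection : E3 →L[ℝ] E3)).det
      = c ^ 3 * LinearMap.det (K.reflection.toLinearEquiv : E3 →ₗ[ℝ] E3) := by
    rw [ContinuousLinearMap.det]
    have : ((c • (K.reflection : E3 →L[ℝ] E3) : E3 →L[ℝ] E3) : E3 →ₗ[ℝ] E3)
      = c • (K.reflection.toLinearEquiv : E3 →ₗ[ℝ] E3) := by
      ext x; simp
    rw [this, LinearMap.det_smul, E3.finrank_eq]
  rw [h1, abs_mul, abs_pow]
  have h2 : |LinearMap.det (K.reflection.toLinearEquiv : E3 →ₗ[ℝ] E3)| = 1 := by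
    have h3 : LinearMap.det (K.reflection.toLinearEquiv : E3 →ₗ[ℝ] E3)
      * LinearMap.det (K.reflection.toLinearEquiv : E3 →ₗ[ℝ] E3) = 1 := by
      rw [← LinearMap.det_comp]
      have : (K.reflection.toLinearEquiv : E3 →ₗ[ℝ] E3) ∘ₗ (K.reflection.toLinearEquiv : E3 →ₗ[ℝ] E3)
        = LinearMap.id := by
        ext1 x; simp
      rw [this, LinearMap.det_id]
    have h4 := congrArg abs h3
    rw [abs_mul, abs_one] at h4
    nlinarith [abs_nonneg (LinearMap.det (K.reflection.toLinearEquiv : E3 →ₗ[ℝ] E3))]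
  rw [h2, mul_one]

section ChangeOfVariables

variable {a : ℝ}

lemma kelvin_hasFDerivWithinAt (s : Set E3) (hs : s ⊆ {0}ᶜ) (x : E3) (hx : x ∈ s) :
    HasFDerivWithinAt (kelvin a) ((a / ‖x‖) ^ 2 • ((ℝ ∙ x)ᗮ.reflection : E3 →L[ℝ] E3)) s x := by
  have := EuclideanGeometry.hasFDerivAt_inversion (c := (0:E3)) (x := x) (R := a) (hs hx)
  rw [kelvin_eq_inversion]
  simpa using this.hasFDerivWithinAt

lemma kelvin_injOn (ha : a ≠ 0) (s : Set E3) (hs : s ⊆ {0}ᶜ) : Set.InjOn (kelvin a) s := by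
  intro x hx y hy h
  rw [← kelvin_kelvin ha (hs hx), h, kelvin_kelvin ha (hs hy)]

lemma kelvin_image_compl (ha : a ≠ 0) : kelvin a '' {0}ᶜ = {0}ᶜ := by
  ext x
  constructor
  · rintro ⟨y, hy, rfl⟩
    exact kelvin_ne_zero ha hy
  · intro hx
    exact ⟨kelvin a x, kelvin_ne_zero ha hx, kelvin_kelvin ha hx⟩

lemma abs_det_kelvin (x : E3) :
    |((a / ‖x‖) ^ 2 • ((ℝ ∙ x)ᗮ.reflection : E3 →L[ℝ] E3)).det| = (a / ‖x‖) ^ 6 := by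
  rw [E3.abs_det_smul_reflection, abs_of_nonneg (by positivity)]
  ring

lemma integral_kelvin_set (ha : a ≠ 0) {s : Set E3} (hs : s ⊆ {0}ᶜ) (hm : MeasurableSet s)
    (g : E3 → ℝ) :
    ∫ x in kelvin a '' s, g x = ∫ x in s, (a / ‖x‖) ^ 6 * g (kelvin a x) := by
  rw [integral_image_eq_integral_abs_det_fderiv_smul volume hm
    (kelvin_hasFDerivWithinAt s hs) (kelvin_injOn ha s hs)]
  simp only [abs_det_kelvin, smul_eq_mul]

lemma integrableOn_kelvin_set (ha : a ≠ 0) {s : Set E3} (hs : s ⊆ {0}ᶜ) (hm : MeasurableSet s)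
    (g : E3 → ℝ) :
    IntegrableOn g (kelvin a '' s) ↔ IntegrableOn (fun x => (a / ‖x‖) ^ 6 * g (kelvin a x)) s := by
  rw [integrableOn_image_iff_integrableOn_abs_det_fderiv_smul volume hm
    (kelvin_hasFDerivWithinAt s hs) (kelvin_injOn ha s hs)]
  simp only [abs_det_kelvin, smul_eq_mul]

lemma integral_kelvin (ha : a ≠ 0) (g : E3 → ℝ) :
    ∫ x, g x = ∫ x, (a / ‖x‖) ^ 6 * g (kelvin a x) := by
  have h : ∀ g : E3 → ℝ, ∫ x in ({0}ᶜ : Set E3), g x = ∫ x, g x := fun g => by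
    rw [restrict_compl_singleton]
  rw [← h, ← h (fun x => (a / ‖x‖) ^ 6 * g (kelvin a x)),
    ← integral_kelvin_set ha subset_rfl (measurableSet_singleton 0).compl, kelvin_image_compl ha]

lemma integrable_kelvin (ha : a ≠ 0) (g : E3 → ℝ) :
    Integrable g ↔ Integrable (fun x => (a / ‖x‖) ^ 6 * g (kelvin a x)) := by
  have h : ∀ g : E3 → ℝ, IntegrableOn g ({0}ᶜ : Set E3) ↔ Integrable g := fun g => by
    rw [IntegrableOn, restrict_compl_singleton]
  rw [← h, ← h (fun x => (a / ‖x‖) ^ 6 * g (kelvin a x)),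
    ← integrableOn_kelvin_set ha subset_rfl (measurableSet_singleton 0).compl, kelvin_image_compl ha]

end ChangeOfVariables

lemma integrableOn_radial_iff {S : Set ℝ} (hS : MeasurableSet S) {g : ℝ → ℝ} :
    IntegrableOn (fun x : E3 => g ‖x‖) {x | ‖x‖ ∈ S} ↔
      IntegrableOn (fun r : ℝ => r ^ 2 * g r) (S ∩ Set.Ioi 0) := by
  have hm : MeasurableSet {x : E3 | ‖x‖ ∈ S} := measurable_norm hS
  rw [← integrable_indicator_iff hm]
  have h1 : (Set.indicator {x : E3 | ‖x‖ ∈ S} fun x : E3 => g ‖x‖)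
      = fun x : E3 => (S.indicator g) ‖x‖ := by
    ext x; simp [Set.indicator]
  rw [h1, integrable_radial_iff]
  have h2 : (fun r : ℝ => r ^ 2 * S.indicator g r) = S.indicator fun r => r ^ 2 * g r := by
    ext r; by_cases h : r ∈ S <;> simp [h]
  rw [h2, IntegrableOn, integrable_indicator_iff hS, IntegrableOn, Measure.restrict_restrict hS]
  rfl

lemma setIntegral_radial {S : Set ℝ} (hS : MeasurableSet S) (g : ℝ → ℝ) :
    ∫ x : E3 in {x | ‖x‖ ∈ S}, g ‖x‖ = 4 * π * ∫ r in S ∩ Set.Ioi 0, r ^ 2 * g r := by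
  have hm : MeasurableSet {x : E3 | ‖x‖ ∈ S} := measurable_norm hS
  rw [← integral_indicator hm]
  have h1 : (Set.indicator {x : E3 | ‖x‖ ∈ S} fun x : E3 => g ‖x‖)
      = fun x : E3 => (S.indicator g) ‖x‖ := by
    ext x; simp [Set.indicator]
  rw [h1, integral_radial]
  have h2 : (fun r : ℝ => r ^ 2 * S.indicator g r) = S.indicator fun r => r ^ 2 * g r := by
    ext r; by_cases h : r ∈ S <;> simp [h]
  rw [h2, integral_indicator hS, Measure.restrict_restrict hS]

lemma ball_zero_eq_norm_preimage (δ : ℝ) : Metric.ball (0 : E3) δ = {x | ‖x‖ ∈ Set.Iio δ} := by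
  ext; simp

/-- The function `‖z‖⁻¹` is integrable near the origin. -/
lemma integrableOn_inv_norm_ball (δ : ℝ) :
    IntegrableOn (fun z : E3 => 1 / ‖z‖) (Metric.ball 0 δ) := by
  rw [ball_zero_eq_norm_preimage, integrableOn_radial_iff (g := fun r => 1 / r) measurableSet_Iio]
  rw [Set.inter_comm, Set.Ioi_inter_Iio]
  have : IntegrableOn (fun r : ℝ => r) (Set.Ioo 0 δ) :=
    (continuous_id.integrableOn_Icc).mono_set Set.Ioo_subset_Icc_self
  refine this.congr_fun (fun r hr => ?_) measurableSet_Ioo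
  have : r ≠ 0 := hr.1.ne'
  field_simp

lemma integral_inv_norm_ball {δ : ℝ} (hδ : 0 ≤ δ) :
    ∫ z : E3 in Metric.ball 0 δ, 1 / ‖z‖ = 2 * π * δ ^ 2 := by
  rw [ball_zero_eq_norm_preimage, setIntegral_radial measurableSet_Iio (fun r => 1 / r)]
  rw [Set.inter_comm, Set.Ioi_inter_Iio]
  have : ∫ r in Set.Ioo 0 δ, r ^ 2 * (1 / r) = ∫ r in Set.Ioo 0 δ, r := by
    refine setIntegral_congr_fun measurableSet_Ioo (fun r hr => ?_)
    have : r ≠ 0 := hr.1.ne'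
    field_simp
  rw [this, ← integral_Ioc_eq_integral_Ioo, ← intervalIntegral.integral_of_le hδ, integral_id]
  ring

lemma integrableOn_inv_norm_sq_ball (δ : ℝ) :
    IntegrableOn (fun z : E3 => 1 / ‖z‖ ^ 2) (Metric.ball 0 δ) := by
  rw [ball_zero_eq_norm_preimage,
    integrableOn_radial_iff (g := fun r => 1 / r ^ 2) measurableSet_Iio]
  rw [Set.inter_comm, Set.Ioi_inter_Iio]
  have : IntegrableOn (fun r : ℝ => (1:ℝ)) (Set.Ioo 0 δ) :=
    (continuous_const.integrableOn_Icc).mono_set Set.Ioo_subset_Icc_self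
  refine this.congr_fun (fun r hr => ?_) measurableSet_Ioo
  have : r ≠ 0 := hr.1.ne'
  field_simp

lemma tendsto_arctan_div_atTop {t : ℝ} (ht : 0 < t) :
    Tendsto (fun r : ℝ => arctan (r / t)) atTop (𝓝 (π / 2)) :=
  (tendsto_nhds_of_tendsto_nhdsWithin tendsto_arctan_atTop).comp
    (tendsto_id.atTop_div_const ht)

lemma hasDerivAt_arctan_div {t : ℝ} (ht : 0 < t) (r : ℝ) :
    HasDerivAt (fun r : ℝ => arctan (r / t)) (t / (t ^ 2 + r ^ 2)) r := by
  have h := ((hasDerivAt_id' r).div_const t).arctan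
  convert h using 1
  have : t ^ 2 + r ^ 2 ≠ 0 := by positivity
  have : 1 + (r / t) ^ 2 ≠ 0 := by positivity
  field_simp

/-- Fundamental theorem of calculus on `(0, ∞)` for radial integrals. -/
lemma radial_ftc {g F : ℝ → ℝ} {L : ℝ} (hc : ContinuousOn F (Set.Ici 0)) (h0 : F 0 = 0)
    (hd : ∀ r ∈ Set.Ioi (0:ℝ), HasDerivAt F (r ^ 2 * g r) r) (hg : ∀ r ∈ Set.Ioi (0:ℝ), 0 ≤ g r)
    (hL : Tendsto F atTop (𝓝 L)) :
    Integrable (fun x : E3 => g ‖x‖) ∧ ∫ x : E3, g ‖x‖ = 4 * π * L := by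
  have hn : ∀ r ∈ Set.Ioi (0:ℝ), 0 ≤ r ^ 2 * g r := fun r hr => mul_nonneg (sq_nonneg _) (hg r hr)
  refine ⟨?_, ?_⟩
  · rw [integrable_radial_iff]
    exact integrableOn_Ioi_deriv_of_nonneg (hc.continuousWithinAt (by simp)) hd hn hL
  · rw [integral_radial,
      integral_Ioi_of_hasDerivAt_of_nonneg (hc.continuousWithinAt (by simp)) hd hn hL, h0, sub_zero]

lemma radial_one_div_sq_mul {t : ℝ} (ht : 0 < t) :
    Integrable (fun z : E3 => 1 / (‖z‖ ^ 2 * (t ^ 2 + ‖z‖ ^ 2))) ∧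
      ∫ z : E3, 1 / (‖z‖ ^ 2 * (t ^ 2 + ‖z‖ ^ 2)) = 2 * π ^ 2 / t := by
  have h := radial_ftc (g := fun r => 1 / (r ^ 2 * (t ^ 2 + r ^ 2)))
    (F := fun r => arctan (r / t) / t) (L := π / 2 / t) (by fun_prop) (by simp)
    (fun r hr => by
      refine ((hasDerivAt_arctan_div ht r).div_const t).congr_deriv ?_
      have : r ≠ 0 := (Set.mem_Ioi.1 hr).ne'
      have : t ^ 2 + r ^ 2 ≠ 0 := by positivity
      field_simp)
    (fun r _ => by positivity) ((tendsto_arctan_div_atTop ht).div_const t)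
  refine ⟨h.1, h.2.trans ?_⟩
  ring

lemma tendsto_self_div_atTop (t : ℝ) :
    Tendsto (fun r : ℝ => r / (t ^ 2 + r ^ 2)) atTop (𝓝 0) := by
  refine squeeze_zero' (g := fun r : ℝ => r⁻¹) ?_ ?_ tendsto_inv_atTop_zero
  · filter_upwards [eventually_gt_atTop 0] with r hr
    positivity
  · filter_upwards [eventually_gt_atTop 0] with r hr
    rw [div_le_iff₀ (by positivity), inv_mul_eq_div, le_div_iff₀ hr]
    nlinarith [sq_nonneg t]

lemma radial_inv_sq {t : ℝ} (ht : 0 < t) :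
    Integrable (fun z : E3 => 1 / (t ^ 2 + ‖z‖ ^ 2) ^ 2) ∧
      ∫ z : E3, 1 / (t ^ 2 + ‖z‖ ^ 2) ^ 2 = π ^ 2 / t := by
  have h := radial_ftc (g := fun r => 1 / (t ^ 2 + r ^ 2) ^ 2)
    (F := fun r => (arctan (r / t) / t - r / (t ^ 2 + r ^ 2)) / 2) (L := (π / 2 / t - 0) / 2)
    (Continuous.continuousOn (by
      have : ∀ r : ℝ, t ^ 2 + r ^ 2 ≠ 0 := fun r => by positivity
      fun_prop (disch := assumption))) (by simp)
    (fun r _ => by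
      have h0 : t ^ 2 + r ^ 2 ≠ 0 := by positivity
      have h1 : HasDerivAt (fun r : ℝ => t ^ 2 + r ^ 2) (2 * r) r := by
        simpa using (hasDerivAt_pow 2 r).const_add (t ^ 2)
      refine ((((hasDerivAt_arctan_div ht r).div_const t).sub
        ((hasDerivAt_id' r).div h1 h0)).div_const 2).congr_deriv ?_
      field_simp
      ring)
    (fun r _ => by positivity)
    ((((tendsto_arctan_div_atTop ht).div_const t).sub (tendsto_self_div_atTop t)).div_const 2)
  refine ⟨h.1, h.2.trans ?_⟩
  ring

lemma radial_inv_cube {t : ℝ} (ht : 0 < t) :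
    Integrable (fun z : E3 => 1 / (t ^ 2 + ‖z‖ ^ 2) ^ 3) ∧
      ∫ z : E3, 1 / (t ^ 2 + ‖z‖ ^ 2) ^ 3 = π ^ 2 / (4 * t ^ 3) := by
  have hlim : Tendsto (fun r : ℝ => (r / (t ^ 2 + r ^ 2)) * ((r ^ 2 - t ^ 2) / (t ^ 2 + r ^ 2)))
      atTop (𝓝 0) := by
    refine (tendsto_self_div_atTop t).zero_mul_isBoundedUnder_le ?_
    refine isBoundedUnder_of ⟨1, fun r => ?_⟩
    simp only [Function.comp, Real.norm_eq_abs]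
    rw [abs_div, abs_of_pos (show 0 < t ^ 2 + r ^ 2 by positivity), div_le_one (by positivity),
      abs_le]
    constructor <;> nlinarith [sq_nonneg t, sq_nonneg r]
  have h := radial_ftc (g := fun r => 1 / (t ^ 2 + r ^ 2) ^ 3)
    (F := fun r => arctan (r / t) / (8 * t ^ 3) +
      ((r / (t ^ 2 + r ^ 2)) * ((r ^ 2 - t ^ 2) / (t ^ 2 + r ^ 2))) / (8 * t ^ 2))
    (L := π / 2 / (8 * t ^ 3) + 0 / (8 * t ^ 2))
    (Continuous.continuousOn (by
      have : ∀ r : ℝ, t ^ 2 + r ^ 2 ≠ 0 := fun r => by positivity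
      fun_prop (disch := assumption))) (by simp)
    (fun r _ => by
      have h0 : t ^ 2 + r ^ 2 ≠ 0 := by positivity
      have h1 : HasDerivAt (fun r : ℝ => t ^ 2 + r ^ 2) (2 * r) r := by
        simpa using (hasDerivAt_pow 2 r).const_add (t ^ 2)
      have h2 : HasDerivAt (fun r : ℝ => r ^ 2 - t ^ 2) (2 * r) r := by
        simpa using (hasDerivAt_pow 2 r).sub_const (t ^ 2)
      refine (((hasDerivAt_arctan_div ht r).div_const (8 * t ^ 3)).add
        ((((hasDerivAt_id' r).div h1 h0).mul (h2.div h1 h0)).div_const (8 * t ^ 2))).congr_deriv ?_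
      simp only [Pi.div_apply]
      field_simp
      ring)
    (fun r _ => by positivity)
    (((tendsto_arctan_div_atTop ht).div_const _).add (hlim.div_const _))
  refine ⟨h.1, h.2.trans ?_⟩
  field_simp
  ring

lemma radial_tail {a : ℝ} (ha : 0 < a) :
    IntegrableOn (fun z : E3 => 1 / ‖z‖ ^ 4) {z | a < ‖z‖} := by
  have := integrableOn_radial_iff (S := Set.Ioi a) measurableSet_Ioi (g := fun r => 1 / r ^ 4)
  refine this.2 ?_
  have h1 : Set.Ioi a ∩ Set.Ioi 0 = Set.Ioi a := by
    rw [Set.inter_eq_left]; exact Set.Ioi_subset_Ioi ha.le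
  rw [h1]
  refine (integrableOn_Ioi_rpow_of_lt (a := -2) (by norm_num) ha).congr_fun (fun r hr => ?_)
    measurableSet_Ioi
  have : 0 < r := ha.trans hr
  simp only
  rw [rpow_neg this.le]
  norm_num
  field_simp

lemma integral_radial_tail {a : ℝ} (ha : 0 < a) :
    ∫ z : E3 in {z | a < ‖z‖}, 1 / ‖z‖ ^ 4 = 4 * π / a := by
  have := setIntegral_radial (S := Set.Ioi a) measurableSet_Ioi (fun r => 1 / r ^ 4)
  refine this.trans ?_
  have h1 : Set.Ioi a ∩ Set.Ioi 0 = Set.Ioi a := by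
    rw [Set.inter_eq_left]; exact Set.Ioi_subset_Ioi ha.le
  rw [h1]
  have h2 : ∫ r in Set.Ioi a, r ^ 2 * (1 / r ^ 4) = ∫ r in Set.Ioi a, r ^ (-2 : ℝ) := by
    refine setIntegral_congr_fun measurableSet_Ioi fun r hr => ?_
    have : 0 < r := ha.trans hr
    rw [rpow_neg this.le]
    norm_num
    field_simp
  rw [h2, integral_Ioi_rpow_of_lt (by norm_num) ha]
  have : (-2 : ℝ) + 1 = -1 := by norm_num
  rw [this, rpow_neg_one]
  field_simp

/-- A function bounded below by a multiple of `‖x‖⁻³` at infinity is not integrable on `ℝ³`. -/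
lemma not_integrable_of_inv_cube_le {g : E3 → ℝ} {c : ℝ} (hc : 0 < c)
    (h : ∀ x, 1 ≤ ‖x‖ → c * (1 / ‖x‖ ^ 3) ≤ g x) : ¬ Integrable g := by
  intro hg
  have h1 : IntegrableOn (fun x : E3 => 1 / ‖x‖ ^ 3) {x | ‖x‖ ∈ Set.Ioi (1:ℝ)} := by
    refine Integrable.mono' ((hg.integrableOn (s := {x | ‖x‖ ∈ Set.Ioi (1:ℝ)})).const_mul c⁻¹)
      (Measurable.aestronglyMeasurable (by fun_prop)) ?_
    refine (ae_restrict_iff' (measurable_norm measurableSet_Ioi)).2 (ae_of_all _ fun x hx => ?_)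
    have hx' : 1 < ‖x‖ := hx
    rw [Real.norm_of_nonneg (by positivity)]
    have := mul_le_mul_of_nonneg_left (h x hx'.le) (inv_nonneg.2 hc.le)
    rwa [← mul_assoc, inv_mul_cancel₀ hc.ne', one_mul] at this
  rw [integrableOn_radial_iff (g := fun r => 1 / r ^ 3) measurableSet_Ioi] at h1
  have h2 : Set.Ioi (1:ℝ) ∩ Set.Ioi 0 = Set.Ioi 1 := by
    rw [Set.inter_eq_left]; exact Set.Ioi_subset_Ioi zero_le_one
  rw [h2] at h1
  refine not_integrableOn_Ioi_inv (a := 1) (h1.congr_fun (fun r hr => ?_) measurableSet_Ioi)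
  have : 0 < r := one_pos.trans hr
  field_simp

lemma abs_log_div_le {a b : ℝ} (ha : 0 < a) (hb : 0 < b) :
    |log (a / b)| ≤ |a - b| * (1 / a + 1 / b) := by
  have h1 : log (a / b) ≤ a / b - 1 := log_le_sub_one_of_pos (by positivity)
  have h2 : log (b / a) ≤ b / a - 1 := log_le_sub_one_of_pos (by positivity)
  have h3 : log (b / a) = -log (a / b) := by rw [← log_inv, inv_div]
  have e1 : a / b - 1 = (a - b) * (1 / b) := by field_simp
  have e2 : b / a - 1 = -(a - b) * (1 / a) := by field_simp; ring
  have k1 : (a - b) * (1 / b) ≤ |a - b| * (1 / b) :=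
    mul_le_mul_of_nonneg_right (le_abs_self _) (by positivity)
  have k2 : -(a - b) * (1 / a) ≤ |a - b| * (1 / a) :=
    mul_le_mul_of_nonneg_right (neg_le_abs _) (by positivity)
  have k3 : 0 ≤ |a - b| * (1 / a) := by positivity
  have k4 : 0 ≤ |a - b| * (1 / b) := by positivity
  rw [abs_le, mul_add]
  constructor <;> linarith

lemma E3.ae_ne (a : E3) : ∀ᵐ y : E3, y ≠ a := by
  simp [ae_iff]

lemma E3.ae_norm_sub_pos (a : E3) : ∀ᵐ y : E3, 0 < ‖a - y‖ := by
  filter_upwards [E3.ae_ne a] with y hy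
  exact norm_pos_iff.2 (sub_ne_zero.2 (Ne.symm hy))

/-- Convolution bound for a kernel that is integrable near the origin and bounded elsewhere. -/
lemma integrable_kernel_mul {K f : E3 → ℝ} {C δ : ℝ} (hKm : Measurable K)
    (hK : IntegrableOn K (Metric.ball 0 δ)) (hC : ∀ z, δ ≤ ‖z‖ → |K z| ≤ C)
    (hf : Continuous f) (hfi : Integrable f) (x : E3) :
    Integrable (fun y => K (x - y) * f y) := by
  obtain ⟨A, hA⟩ := (isCompact_closedBall x δ).exists_bound_of_continuousOn hf.continuousOn
  have hg : Integrable (fun y => (Metric.ball (0:E3) δ).indicator K (x - y)) :=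
    ((integrable_indicator_iff Metric.isOpen_ball.measurableSet).2 hK).comp_sub_left x
  refine Integrable.mono' ((hg.norm.const_mul A).add (hfi.norm.const_mul C))
    ((hKm.comp (measurable_const.sub measurable_id)).aestronglyMeasurable.mul
      hf.aestronglyMeasurable) (ae_of_all _ fun y => ?_)
  rw [norm_mul, Real.norm_eq_abs]
  simp only [Pi.add_apply]
  by_cases h : x - y ∈ Metric.ball (0:E3) δ
  · have hy : ‖f y‖ ≤ A := hA y (by
      rw [Metric.mem_closedBall, dist_comm, dist_eq_norm]; exact (mem_ball_zero_iff.1 h).le)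
    rw [Set.indicator_of_mem h, Real.norm_eq_abs (K _)]
    have : 0 ≤ C * ‖f y‖ := by
      by_cases hδ : ∃ z : E3, δ ≤ ‖z‖
      · obtain ⟨z, hz⟩ := hδ
        exact mul_nonneg ((abs_nonneg _).trans (hC z hz)) (norm_nonneg _)
      · exfalso
        refine hδ ⟨EuclideanSpace.single 0 δ, ?_⟩
        simpa using le_abs_self δ
    nlinarith [abs_nonneg (K (x - y))]
  · rw [Set.indicator_of_notMem h, norm_zero, mul_zero, zero_add]
    exact mul_le_mul_of_nonneg_right (hC _ (by simpa using h)) (norm_nonneg _)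

lemma integrableOn_inv_norm_sub (x : E3) (δ : ℝ) :
    IntegrableOn (fun y : E3 => 1 / ‖x - y‖) (Metric.ball x δ) := by
  have h := ((integrable_indicator_iff Metric.isOpen_ball.measurableSet).2
    (integrableOn_inv_norm_ball δ)).comp_sub_left x
  rw [← integrable_indicator_iff Metric.isOpen_ball.measurableSet]
  refine h.congr (ae_of_all _ fun y => ?_)
  simp [Set.indicator, dist_eq_norm, norm_sub_rev]

lemma integral_inv_norm_sub (x : E3) {δ : ℝ} (hδ : 0 ≤ δ) :
    ∫ y : E3 in Metric.ball x δ, 1 / ‖x - y‖ = 2 * π * δ ^ 2 := by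
  rw [← integral_inv_norm_ball hδ, ← integral_indicator Metric.isOpen_ball.measurableSet,
    ← integral_indicator Metric.isOpen_ball.measurableSet,
    ← integral_sub_left_eq_self _ volume x]
  congr 1
  ext y
  simp [Set.indicator, dist_eq_norm]

section Potentials

variable {f : E3 → ℝ} (hf : Continuous f) (hfi : Integrable f)

include hf hfi

lemma integrable_newton (x : E3) : Integrable (fun y => 1 / ‖x - y‖ * f y) := by
  refine integrable_kernel_mul (K := fun z => 1 / ‖z‖) (C := 1) (δ := 1) (by fun_prop)
    (integrableOn_inv_norm_ball 1) (fun z hz => ?_) hf hfi x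
  rw [abs_of_nonneg (by positivity), div_le_one (by linarith)]
  exact hz

lemma integrable_riesz (x : E3) : Integrable (fun y => 1 / ‖x - y‖ ^ 2 * f y) := by
  refine integrable_kernel_mul (K := fun z => 1 / ‖z‖ ^ 2) (C := 1) (δ := 1) (by fun_prop)
    (integrableOn_inv_norm_sq_ball 1) (fun z hz => ?_) hf hfi x
  rw [abs_of_nonneg (by positivity), div_le_one (by positivity)]
  nlinarith

lemma integrable_log_kernel (a x : E3) :
    Integrable (fun y => log (‖a - y‖ / ‖x - y‖) * f y) := by
  refine Integrable.mono' (((integrable_newton hf hfi a).norm.add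
    (integrable_newton hf hfi x).norm).const_mul ‖a - x‖)
    (Measurable.aestronglyMeasurable (by fun_prop) |>.mul hf.aestronglyMeasurable) ?_
  filter_upwards [E3.ae_norm_sub_pos a, E3.ae_norm_sub_pos x] with y h1 h2
  rw [norm_mul, Real.norm_eq_abs]
  simp only [Pi.add_apply, norm_mul]
  rw [← add_mul, ← mul_assoc, Real.norm_of_nonneg (by positivity : 0 ≤ 1 / ‖a - y‖),
    Real.norm_of_nonneg (by positivity : 0 ≤ 1 / ‖x - y‖)]
  refine mul_le_mul_of_nonneg_right ((abs_log_div_le h1 h2).trans ?_) (norm_nonneg _)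
  refine mul_le_mul_of_nonneg_right ?_ (by positivity)
  refine (abs_norm_sub_norm_le _ _).trans (le_of_eq ?_)
  congr 1
  abel

lemma le_log_potential (hf0 : ∀ y, 0 ≤ f y) (x : E3) :
    -log (1 + ‖x‖) * (∫ y, f y) - ∫ y, 1 / ‖0 - y‖ * f y ≤
      ∫ y, log (‖0 - y‖ / ‖x - y‖) * f y := by
  rw [← integral_const_mul, ← integral_sub (hfi.const_mul _) (integrable_newton hf hfi 0)]
  refine integral_mono_ae ((hfi.const_mul _).sub (integrable_newton hf hfi 0))
    (integrable_log_kernel hf hfi 0 x) ?_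
  filter_upwards [E3.ae_norm_sub_pos 0, E3.ae_norm_sub_pos x] with y h1 h2
  rw [← sub_mul]
  refine mul_le_mul_of_nonneg_right ?_ (hf0 y)
  have k1 : ‖x - y‖ ≤ (1 + ‖x‖) * (1 + 1 / ‖0 - y‖) * ‖0 - y‖ := by
    have : (1 + ‖x‖) * (1 + 1 / ‖0 - y‖) * ‖0 - y‖ = (1 + ‖x‖) * (‖0 - y‖ + 1) := by
      field_simp
    rw [this]
    have := norm_sub_le x y
    rw [zero_sub, norm_neg]
    nlinarith [norm_nonneg x, norm_nonneg y]
  have k2 : log ‖x - y‖ ≤ log (1 + ‖x‖) + log (1 + 1 / ‖0 - y‖) + log ‖0 - y‖ := by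
    rw [← log_mul (by positivity) (by positivity), ← log_mul (by positivity) (by positivity)]
    exact log_le_log h2 k1
  have k3 : log (1 + 1 / ‖0 - y‖) ≤ 1 / ‖0 - y‖ := by
    have := log_le_sub_one_of_pos (show 0 < 1 + 1 / ‖0 - y‖ by positivity)
    linarith
  rw [log_div h1.ne' h2.ne']
  linarith

/-- The Newtonian potential of `f ≥ 0` is controlled by the local supremum and the mass. -/
lemma newton_le (hf0 : ∀ y, 0 ≤ f y) {x : E3} {δ A : ℝ} (hδ : 0 < δ)
    (hA : ∀ y ∈ Metric.ball x δ, f y ≤ A) :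
    ∫ y, 1 / ‖x - y‖ * f y ≤ 2 * π * δ ^ 2 * A + (∫ y, f y) / δ := by
  have h1 : ∫ y, 1 / ‖x - y‖ * f y ≤ ∫ y, ((Metric.ball x δ).indicator
      (fun y => 1 / ‖x - y‖ * A) y + f y / δ) := by
    refine integral_mono (integrable_newton hf hfi x) (((integrable_indicator_iff
      Metric.isOpen_ball.measurableSet).2 ((integrableOn_inv_norm_sub x δ).mul_const A)).add
        (hfi.div_const δ)) fun y => ?_
    by_cases h : y ∈ Metric.ball x δ
    · simp only [Set.indicator_of_mem h]
      have := mul_le_mul_of_nonneg_left (hA y h) (by positivity : 0 ≤ 1 / ‖x - y‖)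
      have := div_nonneg (hf0 y) hδ.le
      linarith
    · simp only [Set.indicator_of_notMem h, zero_add]
      rw [Metric.mem_ball, not_lt, dist_comm, dist_eq_norm] at h
      rw [one_div_mul_eq_div]
      gcongr
      exact hf0 y
  refine h1.trans (le_of_eq ?_)
  rw [integral_add ((integrable_indicator_iff Metric.isOpen_ball.measurableSet).2
    ((integrableOn_inv_norm_sub x δ).mul_const A)) (hfi.div_const δ),
    integral_indicator Metric.isOpen_ball.measurableSet, integral_mul_const,
    integral_inv_norm_sub x hδ.le, integral_div]

end Potentials

/-- The normalised integral equation satisfied by a solution with constant `u - v`. -/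
structure IntEq (u : E3 → ℝ) : Prop where
  contDiff : ContDiff ℝ (⊤ : ℕ∞) u
  integrable : Integrable (fun x => exp (3 * u x))
  sub_eq : ∀ a x, u x - u a = (1 / π ^ 2) * ∫ y, log (‖a - y‖ / ‖x - y‖) * exp (3 * u y)

lemma log_diff_ae (a x : E3) : ∀ᵐ y : E3,
    log (‖a - y‖ / ‖x - y‖) = log (‖y‖ / ‖x - y‖) - log (‖y‖ / ‖a - y‖) := by
  filter_upwards [E3.ae_norm_sub_pos a, E3.ae_norm_sub_pos x, E3.ae_ne 0] with y h1 h2 h3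
  have h3 := norm_pos_iff.2 h3
  rw [log_div h1.ne' h2.ne', log_div h3.ne' h2.ne', log_div h3.ne' h1.ne']
  ring

lemma intEq_of_sub_solV_const {u : E3 → ℝ} (hu : ContDiff ℝ (⊤ : ℕ∞) u)
    (hi : Integrable (fun x => exp (3 * u x))) {c : ℝ} (h : ∀ x, u x - solV u x = c) :
    IntEq u := by
  refine ⟨hu, hi, fun a x => ?_⟩
  have hc : Continuous (fun x => exp (3 * u x)) := by have := hu.continuous; fun_prop
  have e : u x - u a = solV u x - solV u a := by linarith [h x, h a]
  rw [e, solV, solV, ← mul_sub, ← integral_sub]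
  · congr 1
    refine integral_congr_ae ?_
    filter_upwards [log_diff_ae a x] with y hy
    rw [hy]; ring
  · simpa using integrable_log_kernel hc hi 0 x
  · simpa using integrable_log_kernel hc hi 0 a

namespace IntEq

variable {u : E3 → ℝ}

lemma continuous_u (h : IntEq u) : Continuous u := h.contDiff.continuous

lemma continuous_f (h : IntEq u) : Continuous (fun x => exp (3 * u x)) := by
  have := h.continuous_u; fun_prop

lemma translate (h : IntEq u) (x₀ : E3) : IntEq (fun x => u (x₀ + x)) := by
  refine ⟨h.contDiff.comp (by fun_prop), h.integrable.comp_add_left x₀, fun a x => ?_⟩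
  rw [h.sub_eq, ← integral_add_left_eq_self _ x₀]
  simp only [add_sub_add_left_eq_sub]

lemma mass_pos (h : IntEq u) : 0 < ∫ y, exp (3 * u y) := by
  refine (integral_pos_iff_support_of_nonneg (fun y => (exp_pos _).le) h.integrable).2 ?_
  have : Function.support (fun x => exp (3 * u x)) = Set.univ := by
    ext x; simp [(exp_pos _).ne']
  rw [this]
  exact isOpen_univ.measure_pos volume Set.univ_nonempty

/-- Lower bound at infinity. -/
lemma lower_bound (h : IntEq u) : ∃ C, ∀ x,
    C - solAlpha u * log (1 + ‖x‖) ≤ u x := by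
  refine ⟨u 0 - (1 / π ^ 2) * ∫ y, 1 / ‖0 - y‖ * exp (3 * u y), fun x => ?_⟩
  have h1 := h.sub_eq 0 x
  have h2 := le_log_potential h.continuous_f h.integrable (fun y => (exp_pos _).le) x
  have h3 := mul_le_mul_of_nonneg_left h2 (by positivity : 0 ≤ 1 / π ^ 2)
  rw [← h1] at h3
  rw [solAlpha]
  linarith

lemma one_lt_alpha (h : IntEq u) : 1 < solAlpha u := by
  by_contra! hα
  obtain ⟨C, hC⟩ := h.lower_bound
  refine not_integrable_of_inv_cube_le (c := exp (3 * C) / 8) (by positivity) (fun x hx => ?_)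
    h.integrable
  have h1 : C - log (2 * ‖x‖) ≤ u x := by
    have h0 : 0 ≤ log (1 + ‖x‖) := log_nonneg (by linarith)
    have : log (1 + ‖x‖) ≤ log (2 * ‖x‖) := log_le_log (by positivity) (by linarith)
    nlinarith [hC x]
  have h2 : exp (3 * C) / 8 * (1 / ‖x‖ ^ 3) = exp (3 * (C - log (2 * ‖x‖))) := by
    have hx' : 0 < ‖x‖ := by linarith
    have e : exp (3 * log (2 * ‖x‖)) = (2 * ‖x‖) ^ 3 := by
      rw [← exp_log (show 0 < (2 * ‖x‖) by positivity), ← exp_nat_mul, log_exp]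
      norm_num
    rw [mul_sub, exp_sub, e]
    field_simp
    ring
  rw [h2]
  exact exp_le_exp.2 (by linarith)

end IntEq

lemma exists_tail_le {f : E3 → ℝ} (hfi : Integrable f) {ε : ℝ} (hε : 0 < ε) :
    ∃ ρ : ℝ, 1 ≤ ρ ∧ ∫ y in {y | ρ < ‖y‖}, f y ≤ ε := by
  have h := tendsto_setIntegral_of_antitone (μ := volume) (f := f)
    (s := fun n : ℕ => {y : E3 | (n:ℝ) < ‖y‖})
    (fun n => measurableSet_lt measurable_const measurable_norm)
    (fun m n hmn y (hy : (n:ℝ) < ‖y‖) => lt_of_le_of_lt (by exact_mod_cast hmn) hy)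
    ⟨0, hfi.integrableOn⟩
  have e : (⋂ n : ℕ, {y : E3 | (n:ℝ) < ‖y‖}) = ∅ := by
    ext y
    simp only [Set.mem_iInter, Set.mem_ofPred_eq, Set.mem_empty_iff_false, iff_false, not_forall,
      not_lt]
    exact exists_nat_ge ‖y‖
  rw [e, setIntegral_empty] at h
  obtain ⟨n, hn1, hn2⟩ := ((h.eventually (gt_mem_nhds hε)).and (eventually_ge_atTop 1)).exists
  exact ⟨n, by exact_mod_cast hn2, hn1.le⟩

namespace IntEq

variable {u : E3 → ℝ}

lemma upper_aux (h : IntEq u) : ∃ ρ C ε : ℝ, 1 ≤ ρ ∧ 0 < ε ∧ ε ≤ 1 / 3 ∧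
    ∀ x : E3, 2 * ρ ≤ ‖x‖ → ∀ δ A : ℝ, 0 < δ → δ ≤ 1 →
      (∀ y ∈ Metric.ball x δ, exp (3 * u y) ≤ A) →
      u x ≤ C - log ‖x‖ + 2 / π * δ ^ 2 * A + ε * log (1 / δ) := by
  have hα := h.one_lt_alpha
  obtain ⟨ε, hε, hε3, hεα⟩ : ∃ ε : ℝ, 0 < ε ∧ ε ≤ 1 / 3 ∧ ε ≤ (solAlpha u - 1) / 2 :=
    ⟨min (1 / 3) ((solAlpha u - 1) / 2), lt_min (by norm_num) (by linarith), min_le_left _ _,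
      min_le_right _ _⟩
  obtain ⟨ρ, hρ, htail⟩ := exists_tail_le h.integrable (show 0 < π ^ 2 * ε by positivity)
  refine ⟨ρ, u 0 + (1 + ε) * log (2 * ρ) + ε * log 2, ε, hρ, hε, hε3,
    fun x hx δ A hδ hδ1 hA => ?_⟩
  set f : E3 → ℝ := fun y => exp (3 * u y) with hf
  have hf0 : ∀ y, 0 < f y := fun y => exp_pos _
  have hA0 : 0 < A := (hf0 x).trans_le (hA x (Metric.mem_ball_self hδ))
  set S : Set E3 := {y | ρ < ‖y‖} with hS
  have hSm : MeasurableSet S := measurableSet_lt measurable_const measurable_norm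
  have hx1 : 1 ≤ ‖x‖ := by linarith
  set L := log (‖x‖ / (2 * ρ)) with hL
  have hL0 : 0 ≤ L := log_nonneg (by rw [le_div_iff₀ (by positivity)]; linarith)
  have hLx : L = log ‖x‖ - log (2 * ρ) := log_div (by positivity) (by positivity)
  have hlδ : 0 ≤ log (1 / δ) := log_nonneg (by rw [le_div_iff₀ hδ]; linarith)
  have hlx : 0 ≤ log (1 + ‖x‖) := log_nonneg (by linarith)
  have i1 : Integrable (fun y => Sᶜ.indicator (fun y => -L * f y) y) :=
    (h.integrable.const_mul _).indicator hSm.compl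
  have i2 : Integrable (fun y => S.indicator (fun y => (log (1 + ‖x‖) + log (1 / δ)) * f y) y) :=
    (h.integrable.const_mul _).indicator hSm
  have i3 : Integrable (fun y => (Metric.ball x δ).indicator (fun y => 1 / ‖x - y‖ * A) y) :=
    (integrable_indicator_iff Metric.isOpen_ball.measurableSet).2
      ((integrableOn_inv_norm_sub x δ).mul_const A)
  have key : ∫ y, log (‖0 - y‖ / ‖x - y‖) * f y ≤ ∫ y, (Sᶜ.indicator (fun y => -L * f y) y +
      S.indicator (fun y => (log (1 + ‖x‖) + log (1 / δ)) * f y) y +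
      (Metric.ball x δ).indicator (fun y => 1 / ‖x - y‖ * A) y) := by
    refine integral_mono_ae (integrable_log_kernel h.continuous_f h.integrable 0 x)
      ((i1.add i2).add i3) ?_
    filter_upwards [E3.ae_norm_sub_pos 0, E3.ae_norm_sub_pos x] with y h1 h2
    simp only [zero_sub, norm_neg] at h1 ⊢
    have hind : 0 ≤ (Metric.ball x δ).indicator (fun y => 1 / ‖x - y‖ * A) y :=
      Set.indicator_nonneg (fun y _ => by positivity) y
    by_cases hy : y ∈ S
    · rw [Set.indicator_of_mem hy, Set.indicator_of_notMem (by simpa using hy), zero_add]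
      have hxy : ‖y‖ ≤ ‖x‖ + ‖x - y‖ := by
        have := norm_sub_le x (x - y); rwa [sub_sub_cancel] at this
      by_cases hb : y ∈ Metric.ball x δ
      · rw [Set.indicator_of_mem hb]
        have hb' : ‖x - y‖ < δ := by rwa [Metric.mem_ball, dist_comm, dist_eq_norm] at hb
        have k1 : log (‖y‖ / ‖x - y‖) ≤ log (1 + ‖x‖) + 1 / ‖x - y‖ := by
          have : ‖y‖ / ‖x - y‖ ≤ (1 + ‖x‖) * (1 / ‖x - y‖) := by
            rw [mul_one_div]
            gcongr
            linarith
          have h3 := log_le_log (by positivity) this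
          rw [log_mul (by positivity) (by positivity)] at h3
          have h4 := log_le_sub_one_of_pos (show 0 < 1 / ‖x - y‖ by positivity)
          linarith
        have k2 := mul_le_mul_of_nonneg_left (hA y hb) (by positivity : 0 ≤ 1 / ‖x - y‖)
        have k3 := mul_le_mul_of_nonneg_right k1 (hf0 y).le
        have k4 := mul_nonneg hlδ (hf0 y).le
        simp only [hf] at *
        linarith
      · rw [Set.indicator_of_notMem hb, add_zero]
        rw [Metric.mem_ball, not_lt, dist_comm, dist_eq_norm] at hb
        refine mul_le_mul_of_nonneg_right ?_ (hf0 y).le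
        rw [← log_mul (by positivity) (by positivity)]
        refine log_le_log (by positivity) ?_
        rw [div_le_iff₀ h2, mul_assoc, one_div_mul_eq_div]
        have : 1 ≤ ‖x - y‖ / δ := by rwa [le_div_iff₀ hδ, one_mul]
        have : ‖x - y‖ ≤ ‖x - y‖ / δ := by rw [le_div_iff₀ hδ]; nlinarith
        nlinarith [norm_nonneg x]
    · rw [Set.indicator_of_notMem hy, Set.indicator_of_mem (by simpa using hy), add_zero]
      have hy' : ‖y‖ ≤ ρ := not_lt.1 hy
      refine le_add_of_le_of_nonneg (mul_le_mul_of_nonneg_right ?_ (hf0 y).le) hind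
      rw [hL, ← log_inv, inv_div]
      refine log_le_log (by positivity) ?_
      have := norm_sub_norm_le x y
      rw [div_le_div_iff₀ h2 (by positivity)]
      nlinarith
  have i12 : Integrable (fun y => Sᶜ.indicator (fun y => -L * f y) y +
      S.indicator (fun y => (log (1 + ‖x‖) + log (1 / δ)) * f y) y) := i1.add i2
  rw [integral_add i12 i3, integral_add i1 i2, integral_indicator hSm.compl,
    integral_indicator hSm, integral_indicator Metric.isOpen_ball.measurableSet,
    integral_mul_const, integral_const_mul, integral_const_mul,
    integral_inv_norm_sub x hδ.le] at key
  have hsplit := integral_add_compl hSm h.integrable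
  set mo := ∫ y in S, exp (3 * u y) with hmo
  have e1 : ∫ y in Sᶜ, f y = π ^ 2 * solAlpha u - mo := by
    rw [solAlpha, ← mul_assoc, mul_one_div_cancel (by positivity), one_mul, ← hsplit]
    ring
  rw [e1] at key
  have h5 := h.sub_eq 0 x
  have h6 := mul_le_mul_of_nonneg_left key (by positivity : 0 ≤ 1 / π ^ 2)
  rw [← h5] at h6
  have k1 : (1 + ε) * (π ^ 2 * L) ≤ L * (π ^ 2 * solAlpha u - mo) := by
    have : π ^ 2 * (1 + ε) ≤ π ^ 2 * solAlpha u - mo := by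
      nlinarith [sq_nonneg π]
    nlinarith
  have k2 : (log (1 + ‖x‖) + log (1 / δ)) * mo ≤
      (log (1 + ‖x‖) + log (1 / δ)) * (π ^ 2 * ε) := by
    gcongr
  have k3 : log (1 + ‖x‖) ≤ log 2 + log ‖x‖ := by
    rw [← log_mul (by norm_num) (by positivity)]
    exact log_le_log (by positivity) (by linarith)
  have k4 : 1 / π ^ 2 * (-L * (π ^ 2 * solAlpha u - mo) +
      (log (1 + ‖x‖) + log (1 / δ)) * mo + 2 * π * δ ^ 2 * A) ≤
      1 / π ^ 2 * (-((1 + ε) * (π ^ 2 * L)) +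
      (log (1 + ‖x‖) + log (1 / δ)) * (π ^ 2 * ε) + 2 * π * δ ^ 2 * A) := by
    gcongr
    linarith
  have k5 : 1 / π ^ 2 * (-((1 + ε) * (π ^ 2 * L)) +
      (log (1 + ‖x‖) + log (1 / δ)) * (π ^ 2 * ε) + 2 * π * δ ^ 2 * A) =
      -((1 + ε) * L) + (log (1 + ‖x‖) + log (1 / δ)) * ε + 2 / π * δ ^ 2 * A := by
    field_simp
  have k6 := mul_le_mul_of_nonneg_right k3 hε.le
  have k7 := (h6.trans k4).trans_eq k5
  rw [hLx] at k7
  linarith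

lemma f_bounded (h : IntEq u) : ∃ F, 0 < F ∧ ∀ x, exp (3 * u x) ≤ F := by
  obtain ⟨ρ, C, ε, hρ, hε, hε3, hL⟩ := h.upper_aux
  set B := max 0 (2 * (C + 2 / π + ε / 2 * log 4)) with hB
  have far : ∀ x₀ : E3, 2 * ρ + 1 ≤ ‖x₀‖ → exp (3 * u x₀) ≤ max 1 (exp (3 * B)) := by
    intro x₀ hx₀
    have hcont : Continuous (fun x => exp (3 * u x) * (1 - ‖x - x₀‖) ^ 2) := by
      have := h.continuous_f; fun_prop
    obtain ⟨x₁, hx₁, hmax⟩ := (isCompact_closedBall x₀ 1).exists_isMaxOn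
      ⟨x₀, Metric.mem_closedBall_self zero_le_one⟩ hcont.continuousOn
    have h0 : exp (3 * u x₀) ≤ exp (3 * u x₁) * (1 - ‖x₁ - x₀‖) ^ 2 := by
      have := hmax (Metric.mem_closedBall_self zero_le_one)
      simpa using this
    rw [mem_closedBall_iff_norm] at hx₁
    set d := 1 - ‖x₁ - x₀‖ with hd
    have hd0 : 0 ≤ d := by linarith
    have hd1 : d ≤ 1 := by linarith [norm_nonneg (x₁ - x₀)]
    by_cases hc : exp (3 * u x₁) * d ^ 2 ≤ 1
    · exact le_max_of_le_left (h0.trans hc)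
    push Not at hc
    refine le_max_of_le_right ?_
    have hdpos : 0 < d := by
      rcases hd0.eq_or_lt with h' | h'
      · rw [← h'] at hc; norm_num at hc
      · exact h'
    have hu1 : exp (3 * u x₀) ≤ exp (3 * u x₁) := by
      refine h0.trans ?_
      have : d ^ 2 ≤ 1 := pow_le_one₀ hd0 hd1
      nlinarith [exp_pos (3 * u x₁)]
    refine hu1.trans (exp_le_exp.2 ?_)
    have hM : 0 < 4 * exp (3 * u x₁) := by positivity
    set M := 4 * exp (3 * u x₁) with hMdef
    set δ := 1 / √M with hδ
    have hsM : 0 < √M := sqrt_pos.2 hM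
    have hδ0 : 0 < δ := by positivity
    have hδM : δ ^ 2 * M = 1 := by
      rw [hδ, div_pow, sq_sqrt hM.le]; field_simp
    have hδd : δ ≤ d / 2 := by
      by_contra! hlt
      have : (d / 2) ^ 2 * M < δ ^ 2 * M := by gcongr
      rw [hδM, hMdef] at this
      nlinarith
    have hx1n : 2 * ρ ≤ ‖x₁‖ := by
      have := norm_sub_norm_le x₀ x₁
      rw [norm_sub_rev] at this
      linarith
    have hball : ∀ y ∈ Metric.ball x₁ δ, exp (3 * u y) ≤ M := by
      intro y hy
      rw [mem_ball_iff_norm] at hy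
      have hyx : ‖y - x₀‖ ≤ ‖y - x₁‖ + ‖x₁ - x₀‖ := by
        have := norm_add_le (y - x₁) (x₁ - x₀); rwa [sub_add_sub_cancel] at this
      have hyd : d / 2 ≤ 1 - ‖y - x₀‖ := by linarith
      have := hmax (mem_closedBall_iff_norm.2 (show ‖y - x₀‖ ≤ 1 by linarith))
      simp only [Set.mem_ofPred_eq] at this
      rw [← hd] at this
      have h2 : (d / 2) ^ 2 ≤ (1 - ‖y - x₀‖) ^ 2 := by gcongr
      have h3 : exp (3 * u y) * (d / 2) ^ 2 ≤ exp (3 * u x₁) * d ^ 2 :=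
        (mul_le_mul_of_nonneg_left h2 (exp_pos _).le).trans this
      have h4 : exp (3 * u y) * (d / 2) ^ 2 ≤ M * (d / 2) ^ 2 := by rw [hMdef]; linarith
      exact le_of_mul_le_mul_right h4 (by positivity)
    have := hL x₁ hx1n δ M hδ0 (by linarith) hball
    have hlog : log (1 / δ) = (log 4 + 3 * u x₁) / 2 := by
      rw [hδ, one_div_one_div, log_sqrt hM.le, hMdef, log_mul (by norm_num) (exp_pos _).ne', log_exp]
    have hlx : 0 ≤ log ‖x₁‖ := log_nonneg (by linarith)
    rw [mul_assoc, hδM, mul_one, hlog] at this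
    rcases le_or_gt (u x₁) 0 with hneg | hpos
    · have : 0 ≤ B := le_max_left _ _
      linarith
    · have : 2 * (C + 2 / π + ε / 2 * log 4) ≤ B := le_max_right _ _
      nlinarith
  obtain ⟨A, hA⟩ := (isCompact_closedBall (0:E3) (2 * ρ + 1)).exists_bound_of_continuousOn
    h.continuous_f.continuousOn
  refine ⟨max A (max 1 (exp (3 * B))), by positivity, fun x => ?_⟩
  rcases le_total ‖x‖ (2 * ρ + 1) with hx | hx
  · refine le_max_of_le_left ((le_abs_self _).trans (hA x (by simpa using hx)))
  · exact le_max_of_le_right (far x hx)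

/-- Decay of a solution of the integral equation. -/
lemma decay (h : IntEq u) : ∃ C, ∀ x, u x ≤ C - log (1 + ‖x‖) := by
  obtain ⟨ρ, C, ε, hρ, hε, hε3, hL⟩ := h.upper_aux
  obtain ⟨F, hF0, hF⟩ := h.f_bounded
  obtain ⟨A, hA⟩ := (isCompact_closedBall (0:E3) (2 * ρ)).exists_bound_of_continuousOn
    h.continuous_u.continuousOn
  refine ⟨max (A + log (1 + 2 * ρ)) (C + 2 / π * F + log 2), fun x => ?_⟩
  rcases le_total ‖x‖ (2 * ρ) with hx | hx
  · have h1 := (le_abs_self _).trans (hA x (by simpa using hx))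
    have h2 : log (1 + ‖x‖) ≤ log (1 + 2 * ρ) := log_le_log (by positivity) (by linarith)
    have h3 := le_max_left (A + log (1 + 2 * ρ)) (C + 2 / π * F + log 2)
    linarith
  · have h1 := hL x hx 1 F one_pos le_rfl (fun y _ => hF y)
    have h2 : log (1 + ‖x‖) ≤ log 2 + log ‖x‖ := by
      rw [← log_mul (by norm_num) (by linarith)]
      exact log_le_log (by positivity) (by linarith)
    have h3 := le_max_right (A + log (1 + 2 * ρ)) (C + 2 / π * F + log 2)
    norm_num at h1
    linarith

end IntEq

lemma abs_log_kernel_le (a x y : E3) :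
    |log (‖a - y‖ / ‖x - y‖)| ≤ ‖a - x‖ * (1 / ‖a - y‖ + 1 / ‖x - y‖) := by
  rcases eq_or_ne y a with rfl | h1
  · simp; positivity
  rcases eq_or_ne y x with rfl | h2
  · simp; positivity
  refine (abs_log_div_le (norm_pos_iff.2 (sub_ne_zero.2 h1.symm))
    (norm_pos_iff.2 (sub_ne_zero.2 h2.symm))).trans ?_
  refine mul_le_mul_of_nonneg_right ((abs_norm_sub_norm_le _ _).trans (le_of_eq ?_))
    (by positivity)
  congr 1
  abel

namespace IntEq

variable {u : E3 → ℝ}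

lemma decay_f (h : IntEq u) : ∃ C, 0 < C ∧ ∀ x, exp (3 * u x) ≤ C / (1 + ‖x‖) ^ 3 := by
  obtain ⟨C, hC⟩ := h.decay
  refine ⟨exp (3 * C), exp_pos _, fun x => ?_⟩
  have e : exp (3 * log (1 + ‖x‖)) = (1 + ‖x‖) ^ 3 := by
    rw [← exp_log (show 0 < 1 + ‖x‖ by positivity), ← exp_nat_mul, log_exp]
    norm_num
  rw [← e, ← exp_sub]
  exact exp_le_exp.2 (by linarith [hC x])

lemma newton_decay (h : IntEq u) :
    ∃ C, 0 ≤ C ∧ ∀ x, ‖x‖ * ∫ y, 1 / ‖x - y‖ * exp (3 * u y) ≤ C := by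
  obtain ⟨C, hC0, hC⟩ := h.decay_f
  have hm := h.mass_pos
  refine ⟨4 * π * C + 2 * ∫ y, exp (3 * u y), by positivity, fun x => ?_⟩
  rcases eq_or_ne x 0 with rfl | hx
  · rw [norm_zero, zero_mul]; positivity
  have hx0 : 0 < ‖x‖ := norm_pos_iff.2 hx
  have := newton_le h.continuous_f h.integrable (fun y => (exp_pos _).le) (x := x) (δ := ‖x‖ / 2)
    (A := 8 * C / ‖x‖ ^ 3) (by positivity) (fun y hy => by
      refine (hC y).trans ?_
      rw [mem_ball_iff_norm] at hy
      have h1 := norm_sub_norm_le x y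
      rw [norm_sub_rev] at h1
      have h2 : ‖x‖ / 2 ≤ 1 + ‖y‖ := by linarith
      calc C / (1 + ‖y‖) ^ 3 ≤ C / (‖x‖ / 2) ^ 3 := by gcongr
        _ = 8 * C / ‖x‖ ^ 3 := by field_simp; norm_num)
  refine (mul_le_mul_of_nonneg_left this hx0.le).trans (le_of_eq ?_)
  field_simp
  ring

lemma abs_sub_le (h : IntEq u) (a x : E3) : |u x - u a| ≤ (1 / π ^ 2) * (‖a - x‖ *
    ((∫ y, 1 / ‖a - y‖ * exp (3 * u y)) + ∫ y, 1 / ‖x - y‖ * exp (3 * u y))) := by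
  rw [h.sub_eq a x, abs_mul, abs_of_pos (by positivity : 0 < 1 / π ^ 2)]
  refine mul_le_mul_of_nonneg_left ?_ (by positivity)
  rw [← integral_add (integrable_newton h.continuous_f h.integrable a)
    (integrable_newton h.continuous_f h.integrable x), ← integral_const_mul]
  rw [← Real.norm_eq_abs]
  refine norm_integral_le_of_norm_le (((integrable_newton h.continuous_f h.integrable a).add
    (integrable_newton h.continuous_f h.integrable x)).const_mul _) (ae_of_all _ fun y => ?_)
  rw [norm_mul, Real.norm_eq_abs, Real.norm_of_nonneg (exp_pos _).le, ← add_mul, ← mul_assoc]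
  exact mul_le_mul_of_nonneg_right (abs_log_kernel_le a x y) (exp_pos _).le

lemma abs_sub_smul_le (h : IntEq u) : ∃ C, 0 ≤ C ∧ ∀ s t : ℝ, 1 / 2 ≤ s → 1 / 2 ≤ t → ∀ x,
    |u (s • x) - u (t • x)| ≤ C * |s - t| := by
  obtain ⟨C, hC0, hC⟩ := h.newton_decay
  refine ⟨4 * C / π ^ 2, by positivity, fun s t hs ht x => ?_⟩
  have key : ∀ r : ℝ, 1 / 2 ≤ r →
      ‖x‖ * ∫ y, 1 / ‖r • x - y‖ * exp (3 * u y) ≤ 2 * C := fun r hr => by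
    have h1 := hC (r • x)
    rw [norm_smul, Real.norm_of_nonneg (by linarith), mul_assoc] at h1
    have : 0 ≤ ‖x‖ * ∫ y, 1 / ‖r • x - y‖ * exp (3 * u y) :=
      mul_nonneg (norm_nonneg _) (integral_nonneg fun y => by positivity)
    nlinarith
  refine (h.abs_sub_le (t • x) (s • x)).trans ?_
  rw [← sub_smul, norm_smul, Real.norm_eq_abs, abs_sub_comm t s]
  have h1 := key s hs
  have h2 := key t ht
  have : 1 / π ^ 2 * (|s - t| * ((‖x‖ * ∫ y, 1 / ‖t • x - y‖ * exp (3 * u y)) +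
      ‖x‖ * ∫ y, 1 / ‖s • x - y‖ * exp (3 * u y))) ≤ 1 / π ^ 2 * (|s - t| * (2 * C + 2 * C)) := by
    gcongr
  calc _ = _ := by ring
    _ ≤ _ := this
    _ = _ := by ring

/-- The interaction energy of the dilated solution. -/
noncomputable def dilEnergy (u : E3 → ℝ) (t : ℝ) : ℝ :=
  ∫ x, exp (3 * u x) * (u (t • x) - u x)

lemma integrable_dilEnergy (h : IntEq u) {t : ℝ} (ht : 1 / 2 ≤ t) :
    Integrable (fun x => exp (3 * u x) * (u (t • x) - u x)) := by
  obtain ⟨C, hC0, hC⟩ := h.abs_sub_smul_le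
  have hc := h.continuous_u
  refine Integrable.mono' (h.integrable.mul_const (C * |t - 1|))
    (Continuous.aestronglyMeasurable (by fun_prop)) (ae_of_all _ fun x => ?_)
  rw [norm_mul, Real.norm_of_nonneg (exp_pos _).le]
  have := hC t 1 ht (by norm_num) x
  rw [one_smul] at this
  exact mul_le_mul_of_nonneg_left this (exp_pos _).le

lemma dilEnergy_le (h : IntEq u) {t : ℝ} (ht : 1 / 2 ≤ t) :
    dilEnergy u t ≤ (∫ x, exp (3 * u x)) * ((t⁻¹) ^ 3 - 1) / 3 := by
  have ht0 : t ≠ 0 := by linarith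
  have hI : Integrable (fun x => exp (3 * u (t • x))) := h.integrable.comp_smul ht0
  have h1 : ∫ x, exp (3 * u (t • x)) = (t⁻¹) ^ 3 * ∫ x, exp (3 * u x) := by
    rw [Measure.integral_comp_smul volume (fun x => exp (3 * u x)) t, E3.finrank_eq, smul_eq_mul,
      abs_of_nonneg (by positivity), inv_pow]
  have h2 : dilEnergy u t ≤ ∫ x, (exp (3 * u (t • x)) - exp (3 * u x)) / 3 := by
    refine integral_mono (h.integrable_dilEnergy ht) ((hI.sub h.integrable).div_const 3)
      fun x => ?_
    have h3 := add_one_le_exp (3 * u (t • x) - 3 * u x)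
    have h4 : exp (3 * u (t • x)) = exp (3 * u x) * exp (3 * u (t • x) - 3 * u x) := by
      rw [← exp_add]; ring_nf
    simp only [h4]
    nlinarith [exp_pos (3 * u x)]
  rw [integral_div, integral_sub hI h.integrable, h1] at h2
  linarith

lemma hasDerivAt_dilEnergy (h : IntEq u) : ∃ D, HasDerivAt (dilEnergy u) D 1 := by
  obtain ⟨C, hC0, hC⟩ := h.abs_sub_smul_le
  have hc := h.continuous_u
  have hd : ∀ x, DifferentiableAt ℝ u x := fun x => h.contDiff.differentiable (by simp) x
  have hball : ∀ t ∈ Metric.ball (1:ℝ) (1 / 2), 1 / 2 ≤ t := fun t ht => by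
    rw [Metric.mem_ball, dist_eq_norm, Real.norm_eq_abs, abs_lt] at ht
    linarith
  have := hasDerivAt_integral_of_dominated_loc_of_lip (μ := (volume : Measure E3)) (𝕜 := ℝ)
    (F := fun t x => exp (3 * u x) * (u (t • x) - u x)) (x₀ := (1:ℝ))
    (F' := fun x => exp (3 * u x) * fderiv ℝ u ((1:ℝ) • x) x)
    (bound := fun x => exp (3 * u x) * C) (s := Metric.ball 1 (1 / 2))
    (Metric.ball_mem_nhds _ (by norm_num))
    (Eventually.of_forall fun t => Continuous.aestronglyMeasurable (by fun_prop))
    (by simp) (Continuous.aestronglyMeasurable (by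
      have := h.contDiff.continuous_fderiv (by simp)
      fun_prop))
    (ae_of_all _ fun x => by
      refine LipschitzOnWith.of_dist_le_mul fun t ht s hs => ?_
      rw [dist_eq_norm, dist_eq_norm, ← mul_sub, norm_mul, sub_sub_sub_cancel_right,
        Real.norm_of_nonneg (exp_pos _).le, Real.norm_eq_abs, Real.norm_eq_abs,
        Real.coe_nnabs, abs_of_nonneg (by positivity : 0 ≤ exp (3 * u x) * C), mul_assoc]
      exact mul_le_mul_of_nonneg_left (hC t s (hball t ht) (hball s hs) x) (exp_pos _).le)
    (h.integrable.mul_const C)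
    (ae_of_all _ fun x => by
      have h1 : HasDerivAt (fun t : ℝ => t • x) x 1 := by
        simpa using (hasDerivAt_id (1:ℝ)).smul_const x
      exact (((hd ((1:ℝ) • x)).hasFDerivAt.comp_hasDerivAt 1 h1).sub_const (u x)).const_mul _)
  exact ⟨_, this.2⟩

lemma dilEnergy_inv (h : IntEq u) {t : ℝ} (ht : 1 / 2 ≤ t) :
    dilEnergy u t⁻¹ = dilEnergy u t + (∫ x, exp (3 * u x)) ^ 2 / π ^ 2 * log t := by
  obtain ⟨C, hC0, hC⟩ := h.newton_decay
  have ht0 : 0 < t := by linarith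
  set f : E3 → ℝ := fun x => exp (3 * u x) with hf
  have hfc : Continuous f := h.continuous_f
  have e1 : dilEnergy u t =
      ∫ x, ∫ y, 1 / π ^ 2 * (f x * (log (‖x - y‖ / ‖t • x - y‖) * f y)) := by
    refine integral_congr_ae (ae_of_all _ fun x => ?_)
    simp only
    rw [h.sub_eq x (t • x), integral_const_mul, integral_const_mul]
    ring
  have hprod_int : Integrable (Function.uncurry fun x y : E3 =>
      1 / π ^ 2 * (f x * (log (‖x - y‖ / ‖t • x - y‖) * f y))) (volume.prod volume) := by
    have hm : Measurable (Function.uncurry fun x y : E3 =>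
        1 / π ^ 2 * (f x * (log (‖x - y‖ / ‖t • x - y‖) * f y))) := by
      have := hfc.measurable
      unfold Function.uncurry
      fun_prop
    refine Integrable.const_mul ?_ _
    have hm2 : Measurable (fun p : E3 × E3 =>
        (f p.1 * (log (‖p.1 - p.2‖ / ‖t • p.1 - p.2‖) * f p.2))) := by
      have := hfc.measurable
      fun_prop
    rw [integrable_prod_iff hm2.aestronglyMeasurable]
    have hi : ∀ x, Integrable (fun y => f x * (log (‖x - y‖ / ‖t • x - y‖) * f y)) := fun x =>
      (integrable_log_kernel hfc h.integrable x (t • x)).const_mul _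
    refine ⟨ae_of_all _ hi, ?_⟩
    refine Integrable.mono' (h.integrable.mul_const (|1 - t| * (C + 2 * C)))
      hm2.aestronglyMeasurable.norm.integral_prod_right' (ae_of_all _ fun x => ?_)
    rw [Real.norm_of_nonneg (integral_nonneg fun y => norm_nonneg _)]
    have b1 : ∫ y, ‖f x * (log (‖x - y‖ / ‖t • x - y‖) * f y)‖ ≤ ∫ y, f x * (|1 - t| *
        (‖x‖ * (1 / ‖x - y‖ * f y) + ‖x‖ * (1 / ‖t • x - y‖ * f y))) := by
      refine integral_mono (hi x).norm (((((integrable_newton hfc h.integrable x).const_mul _).add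
        ((integrable_newton hfc h.integrable (t • x)).const_mul _)).const_mul _).const_mul _)
        fun y => ?_
      have hk := abs_log_kernel_le x (t • x) y
      have : ‖x - t • x‖ = |1 - t| * ‖x‖ := by
        rw [← norm_eq_abs, ← norm_smul, sub_smul, one_smul]
      rw [this] at hk
      simp only [norm_mul, Real.norm_of_nonneg (show 0 ≤ f x from (exp_pos _).le),
        Real.norm_of_nonneg (show 0 ≤ f y from (exp_pos _).le), Real.norm_eq_abs]
      refine mul_le_mul_of_nonneg_left ?_ (exp_pos _).le
      refine (mul_le_mul_of_nonneg_right hk (exp_pos _).le).trans (le_of_eq ?_)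
      ring
    refine b1.trans ?_
    rw [integral_const_mul, integral_const_mul, integral_add
      ((integrable_newton hfc h.integrable x).const_mul _)
      ((integrable_newton hfc h.integrable (t • x)).const_mul _), integral_const_mul,
      integral_const_mul]
    refine mul_le_mul_of_nonneg_left ?_ (exp_pos _).le
    refine mul_le_mul_of_nonneg_left ?_ (abs_nonneg _)
    refine add_le_add (hC x) ?_
    have h1 := hC (t • x)
    rw [norm_smul, Real.norm_of_nonneg ht0.le, mul_assoc] at h1
    have : 0 ≤ ‖x‖ * ∫ y, 1 / ‖t • x - y‖ * exp (3 * u y) :=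
      mul_nonneg (norm_nonneg _) (integral_nonneg fun y => by positivity)
    simp only [hf]
    nlinarith
  have e2 := integral_integral_swap hprod_int
  rw [e1, e2]
  have e3 : ∀ y, ∫ x, 1 / π ^ 2 * (f x * (log (‖x - y‖ / ‖t • x - y‖) * f y)) =
      f y * (u (t⁻¹ • y) - u y) - (∫ x, f x) / π ^ 2 * log t * f y := fun y => by
    rw [h.sub_eq y (t⁻¹ • y)]
    have : ∫ x, 1 / π ^ 2 * (f x * (log (‖x - y‖ / ‖t • x - y‖) * f y)) =
        ∫ x, f y / π ^ 2 * (log (‖y - x‖ / ‖t⁻¹ • y - x‖) * f x - log t * f x) := by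
      refine integral_congr_ae ?_
      filter_upwards [E3.ae_norm_sub_pos y, E3.ae_norm_sub_pos (t⁻¹ • y)] with x h1 h2
      have : ‖t • x - y‖ = t * ‖t⁻¹ • y - x‖ := by
        rw [norm_sub_rev, ← Real.norm_of_nonneg ht0.le, ← norm_smul, smul_sub, smul_smul,
          Real.norm_of_nonneg ht0.le, mul_inv_cancel₀ ht0.ne', one_smul]
      rw [this, norm_sub_rev x y, log_div h1.ne' (by positivity), log_div h1.ne' h2.ne',
        log_mul ht0.ne' h2.ne']
      ring
    rw [this, integral_const_mul, integral_sub (integrable_log_kernel hfc h.integrable _ _)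
      (h.integrable.const_mul _), integral_const_mul]
    ring
  simp only [e3]
  have hti : Integrable (fun y => f y * (u (t⁻¹ • y) - u y)) := by
    have h1 := hprod_int.integral_prod_right
    have : (fun y => f y * (u (t⁻¹ • y) - u y)) = fun y => (∫ x, Function.uncurry (fun x y : E3 =>
      1 / π ^ 2 * (f x * (log (‖x - y‖ / ‖t • x - y‖) * f y))) (x, y))
        + (∫ x, f x) / π ^ 2 * log t * f y := by
      ext y
      simp only [Function.uncurry_apply_pair]
      rw [e3]; ring
    rw [this]
    exact h1.add (h.integrable.const_mul _)
  rw [integral_sub hti (h.integrable.const_mul _), integral_const_mul, dilEnergy]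
  ring

/-- Pohozaev identity: the total mass is `2π²`. -/
lemma mass_eq (h : IntEq u) : ∫ x, exp (3 * u x) = 2 * π ^ 2 := by
  set m := ∫ x, exp (3 * u x) with hm
  have hm0 : 0 < m := h.mass_pos
  obtain ⟨D, hD⟩ := h.hasDerivAt_dilEnergy
  have hev : ∀ᶠ t in 𝓝 (1:ℝ), 1 / 2 ≤ t := eventually_ge_nhds (by norm_num)
  have hinv : HasDerivAt (fun t : ℝ => t⁻¹) (-1) 1 := by
    simpa using hasDerivAt_inv (one_ne_zero (α := ℝ))
  have h1 : HasDerivAt (fun t => dilEnergy u t - m * ((t⁻¹) ^ 3 - 1) / 3) (D + m) 1 := by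
    refine (hD.sub ((((hinv.pow 3).sub_const 1).const_mul m).div_const 3)).congr_deriv ?_
    norm_num
    ring
  have h2 : IsLocalMax (fun t => dilEnergy u t - m * ((t⁻¹) ^ 3 - 1) / 3) 1 := by
    filter_upwards [hev] with t ht
    have := h.dilEnergy_le ht
    rw [inv_pow, ← hm] at this
    have e : dilEnergy u 1 = 0 := by simp [dilEnergy]
    simp only [e]
    norm_num
    linarith
  have hDm := h2.hasDerivAt_eq_zero h1
  have h3 : HasDerivAt (fun t => dilEnergy u t⁻¹) (D * -1) 1 := by
    have : HasDerivAt (dilEnergy u) D ((1:ℝ)⁻¹) := by simpa using hD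
    exact this.comp 1 hinv
  have h4 : HasDerivAt (fun t => dilEnergy u t + m ^ 2 / π ^ 2 * log t) (D + m ^ 2 / π ^ 2 * 1) 1 := by
    have := hasDerivAt_log (one_ne_zero (α := ℝ))
    rw [inv_one] at this
    exact hD.add (this.const_mul _)
  have h5 := h3.congr_of_eventuallyEq (f₁ := fun t => dilEnergy u t + m ^ 2 / π ^ 2 * log t) (by
    filter_upwards [hev] with t ht
    exact (h.dilEnergy_inv ht).symm)
  have h6 := h4.unique h5
  have h7 : D = -m := by linarith
  rw [h7] at h6
  field_simp at h6
  nlinarith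

lemma alpha_eq (h : IntEq u) : solAlpha u = 2 := by
  rw [solAlpha, h.mass_eq]; field_simp

end IntEq

lemma norm_mul_kelvin_sub_sq (a : ℝ) {x : E3} (hx : x ≠ 0) (y : E3) :
    (‖x‖ * ‖kelvin a x - y‖) ^ 2 =
      a ^ 2 * ‖x - y‖ ^ 2 + (‖x‖ ^ 2 - a ^ 2) * (‖y‖ ^ 2 - a ^ 2) := by
  have hx0 : ‖x‖ ≠ 0 := norm_ne_zero_iff.2 hx
  rw [mul_pow, norm_sub_sq_real, norm_sub_sq_real, norm_kelvin, kelvin, real_inner_smul_left]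
  field_simp
  ring

lemma norm_mul_kelvin_sub_comm (a : ℝ) {x y : E3} (hx : x ≠ 0) (hy : y ≠ 0) :
    ‖x‖ * ‖kelvin a x - y‖ = ‖y‖ * ‖kelvin a y - x‖ := by
  rw [← sq_eq_sq₀ (by positivity) (by positivity), norm_mul_kelvin_sub_sq a hx,
    norm_mul_kelvin_sub_sq a hy, norm_sub_rev x y]
  ring

lemma norm_kelvin_sub_kelvin (a : ℝ) {x y : E3} (hx : x ≠ 0) (hy : y ≠ 0) :
    ‖kelvin a x - kelvin a y‖ = a ^ 2 / (‖x‖ * ‖y‖) * ‖x - y‖ := by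
  have := EuclideanGeometry.dist_inversion_inversion (c := (0:E3)) (x := x) (y := y) hx hy a
  rw [← kelvin_eq_inversion] at this
  simpa [dist_eq_norm] using this

/-- The Green-type kernel of the exterior of the sphere of radius `a`. -/
noncomputable def sphKernel (a : ℝ) (x y : E3) : ℝ :=
  log (‖x‖ * ‖kelvin a x - y‖ / (a * ‖x - y‖))

lemma sphKernel_kelvin {a : ℝ} (ha : 0 < a) {x y : E3} (hx : x ≠ 0) (hy : y ≠ 0) :
    sphKernel a x (kelvin a y) = -sphKernel a x y := by
  have hx0 : 0 < ‖x‖ := norm_pos_iff.2 hx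
  have hy0 : 0 < ‖y‖ := norm_pos_iff.2 hy
  rw [sphKernel, sphKernel, ← log_inv, norm_kelvin_sub_kelvin a hx hy, norm_sub_rev x (kelvin a y),
    inv_div]
  congr 1
  rcases eq_or_ne (‖kelvin a y - x‖) 0 with h0 | h0
  · have := norm_mul_kelvin_sub_comm a hx hy
    rw [this, h0]; simp
  · rw [norm_mul_kelvin_sub_comm a hx hy]
    field_simp

lemma sphKernel_nonneg {a : ℝ} (ha : 0 < a) {x y : E3} (hx : a < ‖x‖) (hy : a < ‖y‖) :
    0 ≤ sphKernel a x y := by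
  have hx0 : x ≠ 0 := norm_pos_iff.1 (ha.trans hx)
  rcases eq_or_ne x y with rfl | hxy
  · simp [sphKernel]
  have h0 : 0 < ‖x - y‖ := norm_pos_iff.2 (sub_ne_zero.2 hxy)
  refine log_nonneg ?_
  rw [le_div_iff₀ (by positivity), one_mul]
  refine le_of_sq_le_sq ?_ (by positivity)
  rw [norm_mul_kelvin_sub_sq a hx0, mul_pow]
  have : 0 ≤ (‖x‖ ^ 2 - a ^ 2) * (‖y‖ ^ 2 - a ^ 2) :=
    mul_nonneg (by nlinarith) (by nlinarith)
  linarith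

lemma sphKernel_pos {a : ℝ} (ha : 0 < a) {x y : E3} (hx : a < ‖x‖) (hy : a < ‖y‖) (hxy : x ≠ y) :
    0 < sphKernel a x y := by
  have hx0 : x ≠ 0 := norm_pos_iff.1 (ha.trans hx)
  have h0 : 0 < ‖x - y‖ := norm_pos_iff.2 (sub_ne_zero.2 hxy)
  refine log_pos ?_
  rw [lt_div_iff₀ (by positivity), one_mul]
  refine lt_of_pow_lt_pow_left₀ 2 (by positivity) ?_
  rw [norm_mul_kelvin_sub_sq a hx0, mul_pow]
  have : 0 < (‖x‖ ^ 2 - a ^ 2) * (‖y‖ ^ 2 - a ^ 2) :=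
    mul_pos (by nlinarith) (by nlinarith)
  linarith

lemma sphKernel_le {a : ℝ} (ha : 0 < a) {x y : E3} (hx : a < ‖x‖) :
    sphKernel a x y ≤ ‖x‖ / a * (1 + ‖x‖ / ‖x - y‖) := by
  have hx0 : 0 < ‖x‖ := ha.trans hx
  rcases eq_or_ne x y with rfl | hxy
  · simp [sphKernel]; positivity
  have h0 : 0 < ‖x - y‖ := norm_pos_iff.2 (sub_ne_zero.2 hxy)
  have h1 : ‖kelvin a x - y‖ ≤ ‖x‖ + ‖x - y‖ := by
    have e : kelvin a x - x = -((1 - a ^ 2 / ‖x‖ ^ 2) • x) := by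
      rw [kelvin, sub_smul, one_smul]; abel
    have h2 : ‖kelvin a x - x‖ ≤ ‖x‖ := by
      have h3 : a ^ 2 / ‖x‖ ^ 2 ≤ 1 := by
        rw [div_le_one (by positivity)]; nlinarith
      have h4 : 0 ≤ a ^ 2 / ‖x‖ ^ 2 := by positivity
      rw [e, norm_neg, norm_smul, Real.norm_of_nonneg (by linarith)]
      nlinarith
    have := norm_add_le (kelvin a x - x) (x - y)
    rw [sub_add_sub_cancel] at this
    linarith
  refine (log_le_self (by positivity)).trans ?_
  calc ‖x‖ * ‖kelvin a x - y‖ / (a * ‖x - y‖) ≤ ‖x‖ * (‖x‖ + ‖x - y‖) / (a * ‖x - y‖) := by gcongr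
    _ = ‖x‖ / a * (1 + ‖x‖ / ‖x - y‖) := by field_simp; ring

lemma measurable_kelvin (a : ℝ) : Measurable (kelvin a) := by
  unfold kelvin; fun_prop

lemma measurable_sphKernel (a : ℝ) : Measurable (fun p : E3 × E3 => sphKernel a p.1 p.2) := by
  have := measurable_kelvin a
  unfold sphKernel
  fun_prop

/-- The reflection of `u` in the sphere of radius `a`. -/
noncomputable def kelvinTransform (u : E3 → ℝ) (a : ℝ) (x : E3) : ℝ :=
  u (kelvin a x) + 2 * log (a / ‖x‖)

lemma exp_kelvinTransform (u : E3 → ℝ) {a : ℝ} (ha : 0 < a) {x : E3} (hx : x ≠ 0) :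
    exp (3 * kelvinTransform u a x) = (a / ‖x‖) ^ 6 * exp (3 * u (kelvin a x)) := by
  have hx0 : 0 < ‖x‖ := norm_pos_iff.2 hx
  have : 0 < a / ‖x‖ := by positivity
  rw [kelvinTransform, mul_add, exp_add, mul_comm]
  congr 1
  have e : (a / ‖x‖) ^ 6 = exp (log (a / ‖x‖)) ^ 6 := by rw [exp_log this]
  rw [e, ← exp_nat_mul]
  congr 1; push_cast; ring

lemma kelvin_image_ball {a : ℝ} (ha : 0 < a) :
    kelvin a '' {x | a < ‖x‖} = {x | ‖x‖ < a} \ {0} := by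
  ext x
  simp only [Set.mem_image, Set.mem_ofPred_eq, Set.mem_sdiff, Set.mem_singleton_iff]
  constructor
  · rintro ⟨y, hy, rfl⟩
    have hy0 : 0 < ‖y‖ := ha.trans hy
    refine ⟨?_, kelvin_ne_zero ha.ne' (norm_pos_iff.1 hy0)⟩
    rw [norm_kelvin, div_lt_iff₀ hy0]
    nlinarith
  · rintro ⟨hx, hx0⟩
    have hx1 : 0 < ‖x‖ := norm_pos_iff.2 hx0
    refine ⟨kelvin a x, ?_, kelvin_kelvin ha.ne' hx0⟩
    rw [norm_kelvin, lt_div_iff₀ hx1]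
    nlinarith

lemma measurableSet_exterior (a : ℝ) : MeasurableSet {x : E3 | a < ‖x‖} :=
  measurableSet_lt measurable_const measurable_norm

namespace IntEq

variable {u : E3 → ℝ}

lemma integrable_sphKernel (h : IntEq u) {a : ℝ} (ha : 0 < a) {x : E3} (hx : x ≠ 0) :
    Integrable (fun y => sphKernel a x y * exp (3 * u y)) ∧
    u x - kelvinTransform u a x = (1 / π ^ 2) * ∫ y, sphKernel a x y * exp (3 * u y) := by
  have hx0 : 0 < ‖x‖ := norm_pos_iff.2 hx
  have h1 := integrable_log_kernel h.continuous_f h.integrable (kelvin a x) x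
  have h2 := h.integrable.const_mul (log (‖x‖ / a))
  have e : (fun y => sphKernel a x y * exp (3 * u y)) =ᵐ[volume] fun y =>
      log (‖kelvin a x - y‖ / ‖x - y‖) * exp (3 * u y) + log (‖x‖ / a) * exp (3 * u y) := by
    filter_upwards [E3.ae_norm_sub_pos (kelvin a x), E3.ae_norm_sub_pos x] with y k1 k2
    rw [sphKernel, ← add_mul, ← log_mul (by positivity) (by positivity)]
    congr 2
    field_simp
  refine ⟨(h1.add h2).congr e.symm, ?_⟩
  rw [integral_congr_ae e, integral_add h1 h2, integral_const_mul, mul_add, ← h.sub_eq,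
    h.mass_eq, kelvinTransform]
  have : log (a / ‖x‖) = -log (‖x‖ / a) := by rw [← log_inv, inv_div]
  rw [this]
  field_simp
  ring

/-- Integral representation of the difference between `u` and its reflection. -/
lemma sub_kelvinTransform (h : IntEq u) {a : ℝ} (ha : 0 < a) {x : E3} (hx : x ≠ 0) :
    IntegrableOn (fun y => sphKernel a x y * (exp (3 * u y) - exp (3 * kelvinTransform u a y)))
      {y | a < ‖y‖} ∧
    u x - kelvinTransform u a x = (1 / π ^ 2) * ∫ y in {y | a < ‖y‖},
      sphKernel a x y * (exp (3 * u y) - exp (3 * kelvinTransform u a y)) := by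
  obtain ⟨h1, h2⟩ := h.integrable_sphKernel ha hx
  have hS : {y : E3 | a < ‖y‖} ⊆ {0}ᶜ := fun y (hy : a < ‖y‖) =>
    norm_pos_iff.1 (ha.trans hy)
  have hSm := measurableSet_exterior a
  have hcongr : ∀ y ∈ {y : E3 | a < ‖y‖}, (a / ‖y‖) ^ 6 *
      (sphKernel a x (kelvin a y) * exp (3 * u (kelvin a y))) =
      -(sphKernel a x y * exp (3 * kelvinTransform u a y)) := fun y hy => by
    rw [exp_kelvinTransform u ha (hS hy), sphKernel_kelvin ha hx (hS hy)]; ring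
  have h3 : IntegrableOn (fun y => -(sphKernel a x y * exp (3 * kelvinTransform u a y)))
      {y | a < ‖y‖} := by
    refine IntegrableOn.congr_fun ?_ hcongr hSm
    exact (integrableOn_kelvin_set ha.ne' hS hSm
      (fun y => sphKernel a x y * exp (3 * u y))).1 h1.integrableOn
  have h4 : ∫ y in {y : E3 | a < ‖y‖}ᶜ, sphKernel a x y * exp (3 * u y) =
      ∫ y in {y : E3 | a < ‖y‖}, -(sphKernel a x y * exp (3 * kelvinTransform u a y)) := by
    rw [← setIntegral_congr_fun hSm hcongr, ← integral_kelvin_set ha.ne' hS hSm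
      (fun y => sphKernel a x y * exp (3 * u y)), kelvin_image_ball ha]
    refine setIntegral_congr_set ?_
    have n1 : ∀ᵐ y : E3, y ≠ 0 := E3.ae_ne 0
    have n2 : ∀ᵐ y : E3, y ∉ Metric.sphere (0:E3) a := by
      have := Measure.addHaar_sphere (volume : Measure E3) 0 a
      exact measure_eq_zero_iff_ae_notMem.1 this
    rw [Filter.eventuallyEq_set]
    filter_upwards [n1, n2] with y k1 k2
    rw [mem_sphere_zero_iff_norm] at k2
    simp only [Set.mem_compl_iff, Set.mem_ofPred_eq, not_lt, Set.mem_sdiff, Set.mem_singleton_iff,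
      k1, not_false_eq_true, and_true]
    exact ⟨fun hle => lt_of_le_of_ne hle k2, le_of_lt⟩
  have h5 : (fun y => sphKernel a x y * (exp (3 * u y) - exp (3 * kelvinTransform u a y))) =
      fun y => sphKernel a x y * exp (3 * u y) +
        -(sphKernel a x y * exp (3 * kelvinTransform u a y)) := by ext y; ring
  rw [h5]
  refine ⟨h1.integrableOn.add h3, ?_⟩
  rw [integral_add h1.integrableOn h3, ← h4, integral_add_compl hSm h1, h2]

end IntEq

lemma ofReal_integral_le_lintegral {X : Type*} [MeasurableSpace X] {μ : Measure X} {g : X → ℝ}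
    (hg : Integrable g μ) : ENNReal.ofReal (∫ x, g x ∂μ) ≤ ∫⁻ x, ENNReal.ofReal (g x) ∂μ := by
  have h1 : ∫ x, g x ∂μ ≤ ∫ x, max (g x) 0 ∂μ :=
    integral_mono hg hg.pos_part fun x => le_max_left _ _
  refine (ENNReal.ofReal_le_ofReal h1).trans ?_
  rw [ofReal_integral_eq_lintegral_ofReal hg.pos_part (ae_of_all _ fun x => le_max_right _ _)]
  refine lintegral_mono fun x => ?_
  rcases le_total (g x) 0 with h | h
  · simp [max_eq_right h]
  · simp [max_eq_left h]

/-- The exterior set where the reflected function exceeds `u`. -/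
def badSet (u : E3 → ℝ) (a : ℝ) : Set E3 := {x | a < ‖x‖ ∧ u x < kelvinTransform u a x}

lemma badSet_subset (u : E3 → ℝ) (a : ℝ) : badSet u a ⊆ {x | a < ‖x‖} := fun _ hx => hx.1

lemma continuousAt_kelvin_pair (a : ℝ) {x : E3} (hx : x ≠ 0) :
    ContinuousAt (fun p : ℝ × E3 => kelvin p.1 p.2) (a, x) := by
  have : ‖x‖ ^ 2 ≠ 0 := pow_ne_zero _ (norm_ne_zero_iff.2 hx)
  unfold kelvin
  fun_prop (disch := simpa using hx)

lemma continuousAt_kelvinTransform {u : E3 → ℝ} (hu : Continuous u) {a : ℝ} (ha : 0 < a) {x : E3}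
    (hx : x ≠ 0) : ContinuousAt (fun p : ℝ × E3 => kelvinTransform u p.1 p.2) (a, x) := by
  have h0 : ‖x‖ ≠ 0 := norm_ne_zero_iff.2 hx
  have h1 : a / ‖x‖ ≠ 0 := by positivity
  unfold kelvinTransform
  refine (hu.continuousAt.comp (continuousAt_kelvin_pair a hx)).add (continuousAt_const.mul ?_)
  refine ContinuousAt.log ?_ (by simpa using h1)
  fun_prop (disch := simpa using hx)

lemma isOpen_badSet {u : E3 → ℝ} (hu : Continuous u) {a : ℝ} (ha : 0 < a) :
    IsOpen (badSet u a) := by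
  rw [isOpen_iff_mem_nhds]
  rintro x ⟨h1, h2⟩
  have hx : x ≠ 0 := norm_pos_iff.1 (ha.trans h1)
  have hc : ContinuousAt (fun y => kelvinTransform u a y) x :=
    (continuousAt_kelvinTransform hu ha hx).comp (f := fun y => (a, y))
      (by fun_prop : ContinuousAt (fun y : E3 => (a, y)) x)
  exact (continuous_norm.continuousAt.eventually (lt_mem_nhds h1)).and
    (hu.continuousAt.eventually_lt hc h2)

lemma measurable_kelvinTransform {u : E3 → ℝ} (hu : Continuous u) (a : ℝ) :
    Measurable (kelvinTransform u a) := by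
  have := measurable_kelvin a
  have := hu.measurable
  unfold kelvinTransform
  fun_prop

lemma integrableOn_div_norm_pow {a : ℝ} (ha : 0 < a) :
    IntegrableOn (fun x : E3 => (a / ‖x‖) ^ 4) {x | a < ‖x‖} := by
  refine ((radial_tail ha).const_mul (a ^ 4)).congr (ae_of_all _ fun x => ?_)
  simp only; rw [div_pow]; ring

namespace IntEq

variable {u : E3 → ℝ}

lemma exp_kelvinTransform_le {a M : ℝ} (ha : 0 < a)
    (hM : ∀ y, ‖y‖ ≤ a → exp (3 * u y) ≤ M) {x : E3} (hx : a < ‖x‖) :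
    exp (3 * kelvinTransform u a x) ≤ M * (a / ‖x‖) ^ 6 := by
  have hx0 : 0 < ‖x‖ := ha.trans hx
  rw [exp_kelvinTransform u ha (norm_pos_iff.1 hx0), mul_comm]
  refine mul_le_mul_of_nonneg_right (hM _ ?_) (by positivity)
  rw [norm_kelvin, div_le_iff₀ hx0]
  nlinarith

lemma measurable_defect_integrand {k w f : E3 → ℝ} (hk : Measurable k) (hw : Measurable w)
    (hf : Measurable f) : Measurable (fun y => ENNReal.ofReal (k y) *
      (ENNReal.ofReal (exp (3 * w y)) * ENNReal.ofReal (w y - f y))) := by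
  fun_prop

lemma kelvin_defect_le (h : IntEq u) {a : ℝ} (ha : 0 < a) {x : E3} (hx : a < ‖x‖) :
    ENNReal.ofReal (kelvinTransform u a x - u x) ≤ ENNReal.ofReal (3 / π ^ 2) *
      ∫⁻ y in badSet u a, ENNReal.ofReal (sphKernel a x y) *
        (ENNReal.ofReal (exp (3 * kelvinTransform u a y)) *
          ENNReal.ofReal (kelvinTransform u a y - u y)) := by
  have hx0 : x ≠ 0 := norm_pos_iff.1 (ha.trans hx)
  obtain ⟨h1, h2⟩ := h.sub_kelvinTransform ha hx0
  have hSm := measurableSet_exterior a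
  have hBm := (isOpen_badSet h.continuous_u ha).measurableSet
  have e : kelvinTransform u a x - u x = ∫ y in {y | a < ‖y‖}, (1 / π ^ 2) *
      -(sphKernel a x y * (exp (3 * u y) - exp (3 * kelvinTransform u a y))) := by
    rw [integral_const_mul, integral_neg]; linarith
  have hi : IntegrableOn (fun y => (1 / π ^ 2) *
      -(sphKernel a x y * (exp (3 * u y) - exp (3 * kelvinTransform u a y)))) {y | a < ‖y‖} :=
    h1.neg.const_mul _
  rw [e]
  refine (ofReal_integral_le_lintegral hi).trans ?_
  have hmeas : Measurable (fun y => ENNReal.ofReal (sphKernel a x y) *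
        (ENNReal.ofReal (exp (3 * kelvinTransform u a y)) *
          ENNReal.ofReal (kelvinTransform u a y - u y))) := by
    have m1 := measurable_kelvinTransform h.continuous_u a
    have m2 := h.continuous_u.measurable
    have m3 : Measurable (fun y => sphKernel a x y) :=
      (measurable_sphKernel a).comp (f := fun y => (x, y)) (by fun_prop)
    exact measurable_defect_integrand m3 m1 m2
  rw [← lintegral_const_mul _ hmeas]
  have hsub : ∫⁻ y in badSet u a, ENNReal.ofReal (3 / π ^ 2) * (ENNReal.ofReal (sphKernel a x y) *
        (ENNReal.ofReal (exp (3 * kelvinTransform u a y)) *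
          ENNReal.ofReal (kelvinTransform u a y - u y))) =
      ∫⁻ y in {y | a < ‖y‖}, (badSet u a).indicator (fun y => ENNReal.ofReal (3 / π ^ 2) *
        (ENNReal.ofReal (sphKernel a x y) * (ENNReal.ofReal (exp (3 * kelvinTransform u a y)) *
          ENNReal.ofReal (kelvinTransform u a y - u y)))) y := by
    rw [lintegral_indicator hBm, Measure.restrict_restrict hBm,
      Set.inter_eq_left.2 (badSet_subset u a)]
  rw [hsub]
  refine setLIntegral_mono' hSm fun y hy => ?_
  have hK := sphKernel_nonneg ha hx hy
  by_cases hb : y ∈ badSet u a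
  · rw [Set.indicator_of_mem hb, ← ENNReal.ofReal_mul (exp_pos _).le, ← ENNReal.ofReal_mul hK,
      ← ENNReal.ofReal_mul (by positivity)]
    refine ENNReal.ofReal_le_ofReal ?_
    have h3 := add_one_le_exp (3 * u y - 3 * kelvinTransform u a y)
    have h4 : exp (3 * u y) = exp (3 * kelvinTransform u a y) *
      exp (3 * u y - 3 * kelvinTransform u a y) := by rw [← exp_add]; ring_nf
    have h5 : exp (3 * kelvinTransform u a y) - exp (3 * u y) ≤
        3 * (exp (3 * kelvinTransform u a y) * (kelvinTransform u a y - u y)) := by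
      rw [h4]; nlinarith [exp_pos (3 * kelvinTransform u a y)]
    calc 1 / π ^ 2 * -(sphKernel a x y * (exp (3 * u y) - exp (3 * kelvinTransform u a y)))
        = 1 / π ^ 2 * (sphKernel a x y * (exp (3 * kelvinTransform u a y) - exp (3 * u y))) := by
          ring
      _ ≤ 1 / π ^ 2 * (sphKernel a x y *
          (3 * (exp (3 * kelvinTransform u a y) * (kelvinTransform u a y - u y)))) := by gcongr
      _ = _ := by ring
  · rw [Set.indicator_of_notMem hb]
    have hle : kelvinTransform u a y ≤ u y := by
      by_contra! hlt
      exact hb ⟨hy, hlt⟩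
    rw [ENNReal.ofReal_of_nonpos]
    have : exp (3 * kelvinTransform u a y) ≤ exp (3 * u y) := exp_le_exp.2 (by linarith)
    have := mul_nonneg hK (sub_nonneg.2 this)
    have h6 : 0 ≤ 1 / π ^ 2 * (sphKernel a x y *
      (exp (3 * u y) - exp (3 * kelvinTransform u a y))) := mul_nonneg (by positivity) this
    linarith

lemma lintegral_sphKernel_le (h : IntEq u) {a M δ : ℝ} (ha : 0 < a) (hδ : 0 < δ)
    (hM : ∀ y, ‖y‖ ≤ a → exp (3 * u y) ≤ M) (y : E3) :
    ∫⁻ x in badSet u a, ENNReal.ofReal (sphKernel a x y) *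
        ENNReal.ofReal (exp (3 * kelvinTransform u a x)) ≤
      ENNReal.ofReal (M * ((1 + a / δ) * (∫ x in badSet u a, (a / ‖x‖) ^ 4) +
        2 * π * a * δ ^ 2)) := by
  have hBm := (isOpen_badSet h.continuous_u ha).measurableSet
  have hM0 : 0 ≤ M := (exp_pos _).le.trans (hM 0 (by simpa using ha.le))
  have i1 : IntegrableOn (fun x : E3 => (a / ‖x‖) ^ 4) (badSet u a) :=
    (integrableOn_div_norm_pow ha).mono_set (badSet_subset u a)
  have i2 : Integrable (fun x => (Metric.ball y δ).indicator (fun x => 1 / ‖y - x‖) x) :=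
    (integrable_indicator_iff Metric.isOpen_ball.measurableSet).2 (integrableOn_inv_norm_sub y δ)
  have i3 : IntegrableOn (fun x => M * ((1 + a / δ) * (a / ‖x‖) ^ 4 + a *
      (Metric.ball y δ).indicator (fun x => 1 / ‖y - x‖) x)) (badSet u a) :=
    ((i1.const_mul _).add (i2.integrableOn.const_mul _)).const_mul _
  have hind : ∀ x, 0 ≤ (Metric.ball y δ).indicator (fun x => 1 / ‖y - x‖) x := fun x =>
    Set.indicator_nonneg (fun x _ => by positivity) x
  have hle : ∫ x in badSet u a, M * ((1 + a / δ) * (a / ‖x‖) ^ 4 + a *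
      (Metric.ball y δ).indicator (fun x => 1 / ‖y - x‖) x) ≤
      M * ((1 + a / δ) * (∫ x in badSet u a, (a / ‖x‖) ^ 4) + 2 * π * a * δ ^ 2) := by
    rw [integral_const_mul, integral_add (i1.const_mul _) (i2.integrableOn.const_mul _),
      integral_const_mul, integral_const_mul]
    have : ∫ x in badSet u a, (Metric.ball y δ).indicator (fun x => 1 / ‖y - x‖) x ≤
        2 * π * δ ^ 2 := by
      refine (setIntegral_le_integral i2 (ae_of_all _ hind)).trans (le_of_eq ?_)
      rw [integral_indicator Metric.isOpen_ball.measurableSet, integral_inv_norm_sub y hδ.le]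
    have : a * ∫ x in badSet u a, (Metric.ball y δ).indicator (fun x => 1 / ‖y - x‖) x ≤
        2 * π * a * δ ^ 2 := (mul_le_mul_of_nonneg_left this ha.le).trans (le_of_eq (by ring))
    gcongr
  refine le_trans ?_ (ENNReal.ofReal_le_ofReal hle)
  rw [ofReal_integral_eq_lintegral_ofReal i3 (ae_of_all _ fun x =>
    mul_nonneg hM0 (add_nonneg (by positivity) (mul_nonneg ha.le (hind x))))]
  refine setLIntegral_mono' hBm fun x hx => ?_
  have hxa : a < ‖x‖ := hx.1
  have hx0 : 0 < ‖x‖ := ha.trans hxa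
  rw [← ENNReal.ofReal_mul' (exp_pos _).le]
  refine ENNReal.ofReal_le_ofReal ?_
  have h1 := exp_kelvinTransform_le ha hM hxa
  have h2 := sphKernel_le ha hxa (y := y)
  have hq : a / ‖x‖ ≤ 1 := by rw [div_le_one hx0]; exact hxa.le
  have hq0 : 0 < a / ‖x‖ := by positivity
  calc sphKernel a x y * exp (3 * kelvinTransform u a x)
      ≤ ‖x‖ / a * (1 + ‖x‖ / ‖x - y‖) * exp (3 * kelvinTransform u a x) :=
        mul_le_mul_of_nonneg_right h2 (exp_pos _).le
    _ ≤ ‖x‖ / a * (1 + ‖x‖ / ‖x - y‖) * (M * (a / ‖x‖) ^ 6) := by gcongr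
    _ = M * ((a / ‖x‖) ^ 5 + (a / ‖x‖) ^ 4 * (a * (1 / ‖y - x‖))) := by
        rw [norm_sub_rev x y]; field_simp
    _ ≤ M * ((1 + a / δ) * (a / ‖x‖) ^ 4 + a *
      (Metric.ball y δ).indicator (fun x => 1 / ‖y - x‖) x) := by
      refine mul_le_mul_of_nonneg_left ?_ hM0
      have h5 : (a / ‖x‖) ^ 5 ≤ (a / ‖x‖) ^ 4 := pow_le_pow_of_le_one hq0.le hq (by norm_num)
      have h4 : (a / ‖x‖) ^ 4 ≤ 1 := pow_le_one₀ hq0.le hq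
      by_cases hb : x ∈ Metric.ball y δ
      · rw [Set.indicator_of_mem hb]
        have h6 : 0 ≤ a * (1 / ‖y - x‖) := by positivity
        have h7 : 0 ≤ a / δ * (a / ‖x‖) ^ 4 := by positivity
        nlinarith
      · rw [Set.indicator_of_notMem hb, mul_zero, add_zero]
        rw [Metric.mem_ball, not_lt, dist_comm, dist_eq_norm] at hb
        have h6 : a * (1 / ‖y - x‖) ≤ a / δ := by
          rw [mul_one_div]; gcongr
        have := mul_le_mul_of_nonneg_left h6 (by positivity : 0 ≤ (a / ‖x‖) ^ 4)
        linarith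

lemma lintegral_defect_lt_top (h : IntEq u) {a : ℝ} (ha : 0 < a) :
    ∫⁻ y in badSet u a, ENNReal.ofReal (exp (3 * kelvinTransform u a y)) *
          ENNReal.ofReal (kelvinTransform u a y - u y) < ⊤ := by
  have hBm := (isOpen_badSet h.continuous_u ha).measurableSet
  obtain ⟨C, hC⟩ := h.decay
  obtain ⟨c, hc⟩ := h.lower_bound
  rw [h.alpha_eq] at hc
  set M := exp (3 * C)
  have hup : ∀ y, u y ≤ C := fun y => by
    have : 0 ≤ log (1 + ‖y‖) := log_nonneg (by linarith [norm_nonneg y])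
    linarith [hC y]
  have hM : ∀ y, ‖y‖ ≤ a → exp (3 * u y) ≤ M := fun y _ => exp_le_exp.2 (by linarith [hup y])
  have hi : IntegrableOn (fun x : E3 => M * (|C - c| + 2 * a) * (a / ‖x‖) ^ 4) (badSet u a) :=
    ((integrableOn_div_norm_pow ha).mono_set (badSet_subset u a)).const_mul _
  refine lt_of_le_of_lt ?_ hi.lintegral_lt_top
  refine setLIntegral_mono' hBm fun x hx => ?_
  have hxa : a < ‖x‖ := hx.1
  have hx0 : 0 < ‖x‖ := ha.trans hxa
  rw [← ENNReal.ofReal_mul (exp_pos _).le]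
  refine ENNReal.ofReal_le_ofReal ?_
  have hq : a / ‖x‖ ≤ 1 := by rw [div_le_one hx0]; exact hxa.le
  have hq0 : 0 < a / ‖x‖ := by positivity
  have h1 := exp_kelvinTransform_le ha hM hxa
  have h2 : kelvinTransform u a x - u x ≤ |C - c| + 2 * ‖x‖ := by
    have k1 : log (a / ‖x‖) ≤ 0 := log_nonpos hq0.le hq
    have k2 : log (1 + ‖x‖) ≤ ‖x‖ := by
      have := log_le_sub_one_of_pos (show 0 < 1 + ‖x‖ by positivity)
      linarith
    have k3 := hup (kelvin a x)
    have k4 := hc x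
    have k5 := le_abs_self (C - c)
    rw [kelvinTransform]
    linarith
  have h3 : 0 ≤ kelvinTransform u a x - u x := by linarith [hx.2]
  calc exp (3 * kelvinTransform u a x) * (kelvinTransform u a x - u x)
      ≤ M * (a / ‖x‖) ^ 6 * (|C - c| + 2 * ‖x‖) := by gcongr
    _ = M * (|C - c| * (a / ‖x‖) ^ 6 + 2 * a * (a / ‖x‖) ^ 5) := by field_simp
    _ ≤ M * (|C - c| * (a / ‖x‖) ^ 4 + 2 * a * (a / ‖x‖) ^ 4) := by
      have h5 : (a / ‖x‖) ^ 5 ≤ (a / ‖x‖) ^ 4 := pow_le_pow_of_le_one hq0.le hq (by norm_num)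
      have h6 : (a / ‖x‖) ^ 6 ≤ (a / ‖x‖) ^ 4 := pow_le_pow_of_le_one hq0.le hq (by norm_num)
      gcongr
    _ = _ := by ring

/-- Smallness criterion for the sphere of radius `a` to be admissible. -/
lemma badSet_eq_empty (h : IntEq u) {a M δ : ℝ} (ha : 0 < a) (hδ : 0 < δ)
    (hM : ∀ y, ‖y‖ ≤ a → exp (3 * u y) ≤ M)
    (hs : M * ((1 + a / δ) * (∫ x in badSet u a, (a / ‖x‖) ^ 4) + 2 * π * a * δ ^ 2) < π ^ 2 / 3) :
    badSet u a = ∅ := by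
  have hBm := (isOpen_badSet h.continuous_u ha).measurableSet
  have m1 := measurable_kelvinTransform h.continuous_u a
  have m2 := h.continuous_u.measurable
  have m3 := measurable_sphKernel a
  set S := M * ((1 + a / δ) * (∫ x in badSet u a, (a / ‖x‖) ^ 4) + 2 * π * a * δ ^ 2) with hS
  set g : E3 → ENNReal := fun y => ENNReal.ofReal (exp (3 * kelvinTransform u a y)) with hg
  set d : E3 → ENNReal := fun y => ENNReal.ofReal (kelvinTransform u a y - u y) with hd
  set k : E3 → E3 → ENNReal := fun x y => ENNReal.ofReal (sphKernel a x y) with hk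
  have hgm : Measurable g := by fun_prop
  have hdm : Measurable d := by fun_prop
  have hgd : Measurable (fun y => g y * d y) := hgm.mul hdm
  have hkm : Measurable (Function.uncurry k) := ENNReal.measurable_ofReal.comp m3
  set I := ∫⁻ y in badSet u a, g y * d y with hI
  have hItop : I < ⊤ := h.lintegral_defect_lt_top ha
  have hkey : I ≤ ENNReal.ofReal (3 / π ^ 2 * S) * I := by
    calc I ≤ ∫⁻ x in badSet u a, g x * (ENNReal.ofReal (3 / π ^ 2) *
          ∫⁻ y in badSet u a, k x y * (g y * d y)) := by
          refine setLIntegral_mono' hBm fun x hx => ?_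
          gcongr
          exact h.kelvin_defect_le ha hx.1
      _ = ENNReal.ofReal (3 / π ^ 2) * ∫⁻ x in badSet u a,
          ∫⁻ y in badSet u a, g x * (k x y * (g y * d y)) := by
          rw [← lintegral_const_mul]
          · refine lintegral_congr fun x => ?_
            rw [lintegral_const_mul]
            · ring
            · exact (hkm.comp measurable_prodMk_left).mul hgd
          · refine Measurable.lintegral_prod_right' (f := fun p : E3 × E3 =>
              g p.1 * (k p.1 p.2 * (g p.2 * d p.2))) ?_
            exact (hgm.comp measurable_fst).mul (hkm.mul (hgd.comp measurable_snd))
      _ = ENNReal.ofReal (3 / π ^ 2) * ∫⁻ y in badSet u a,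
          ∫⁻ x in badSet u a, g x * (k x y * (g y * d y)) := by
          rw [lintegral_lintegral_swap]
          exact ((hgm.comp measurable_fst).mul
            (hkm.mul (hgd.comp measurable_snd))).aemeasurable
      _ ≤ ENNReal.ofReal (3 / π ^ 2) * ∫⁻ y in badSet u a, ENNReal.ofReal S * (g y * d y) := by
          gcongr with y
          have : ∫⁻ x in badSet u a, g x * (k x y * (g y * d y)) =
              (∫⁻ x in badSet u a, k x y * g x) * (g y * d y) := by
            rw [← lintegral_mul_const]
            · refine lintegral_congr fun x => ?_
              ring
            · exact (hkm.comp measurable_prodMk_right).mul hgm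
          rw [this]
          gcongr
          exact h.lintegral_sphKernel_le ha hδ hM y
      _ = ENNReal.ofReal (3 / π ^ 2 * S) * I := by
          rw [lintegral_const_mul _ hgd, ← mul_assoc,
            ← ENNReal.ofReal_mul (by positivity)]
  have hθ : ENNReal.ofReal (3 / π ^ 2 * S) < 1 := by
    rw [ENNReal.ofReal_lt_one]
    have : 3 / π ^ 2 * S < 3 / π ^ 2 * (π ^ 2 / 3) := by gcongr
    refine this.trans_eq ?_
    field_simp
  have hI0 : I = 0 := by
    by_contra hne
    have := ENNReal.mul_lt_mul_left hne hItop.ne hθ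
    rw [one_mul] at this
    exact absurd hkey (not_le.2 this)
  rw [hI, setLIntegral_eq_zero_iff hBm hgd] at hI0
  rw [(isOpen_badSet h.continuous_u ha).eq_empty_of_measure_zero (μ := (volume : Measure E3))]
  rw [measure_eq_zero_iff_ae_notMem]
  filter_upwards [hI0] with x hx hxB
  have := hx hxB
  rw [mul_eq_zero, ENNReal.ofReal_eq_zero, ENNReal.ofReal_eq_zero] at this
  rcases this with h1 | h1
  · exact absurd (exp_pos _) (not_lt.2 h1)
  · have := hxB.2
    linarith

end IntEq

namespace IntEq

variable {u : E3 → ℝ}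

lemma exists_exp_le (h : IntEq u) : ∃ M, 0 < M ∧ ∀ y, exp (3 * u y) ≤ M := by
  obtain ⟨C, hC⟩ := h.decay
  refine ⟨exp (3 * C), exp_pos _, fun y => exp_le_exp.2 ?_⟩
  have : 0 ≤ log (1 + ‖y‖) := log_nonneg (by linarith [norm_nonneg y])
  linarith [hC y]

lemma exists_badSet_eq_empty (h : IntEq u) :
    ∃ a₀ : ℝ, 0 < a₀ ∧ ∀ a, 0 < a → a < a₀ → badSet u a = ∅ := by
  obtain ⟨M, hM0, hM⟩ := h.exists_exp_le
  have hc : ContinuousAt (fun a : ℝ => M * (10 * π * a ^ 3)) 0 := by fun_prop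
  have hlt : (fun a : ℝ => M * (10 * π * a ^ 3)) 0 < π ^ 2 / 3 := by
    simp only; norm_num; positivity
  obtain ⟨ε, hε, hb⟩ := Metric.eventually_nhds_iff.1 (hc.eventually_lt continuousAt_const hlt)
  refine ⟨ε, hε, fun a ha haε => ?_⟩
  have h1 := hb (y := a) (by rw [dist_zero_right, norm_of_nonneg ha.le]; exact haε)
  refine h.badSet_eq_empty ha ha (fun y _ => hM y) (lt_of_le_of_lt ?_ h1)
  have h2 : ∫ x in badSet u a, (a / ‖x‖) ^ 4 ≤ 4 * π * a ^ 3 := by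
    refine (setIntegral_mono_set (integrableOn_div_norm_pow ha)
      (ae_of_all _ fun x => by positivity) (badSet_subset u a).eventuallyLE).trans (le_of_eq ?_)
    calc ∫ x : E3 in {x | a < ‖x‖}, (a / ‖x‖) ^ 4
        = ∫ x : E3 in {x | a < ‖x‖}, a ^ 4 * (1 / ‖x‖ ^ 4) := by
          refine integral_congr_ae (ae_of_all _ fun x => ?_)
          simp only; rw [div_pow]; ring
      _ = 4 * π * a ^ 3 := by
          rw [integral_const_mul, integral_radial_tail ha]; field_simp
  rw [div_self ha.ne']
  calc M * ((1 + 1) * (∫ x in badSet u a, (a / ‖x‖) ^ 4) + 2 * π * a * a ^ 2)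
      ≤ M * ((1 + 1) * (4 * π * a ^ 3) + 2 * π * a * a ^ 2) := by gcongr
    _ = _ := by ring

lemma exists_badSet_nonempty (h : IntEq u) : ∃ a : ℝ, 0 < a ∧ (badSet u a).Nonempty := by
  by_contra! hgood
  obtain ⟨c, hc⟩ := h.lower_bound
  rw [h.alpha_eq] at hc
  refine not_integrable_of_inv_cube_le (g := fun x => exp (3 * u x))
    (exp_pos (3 * (c - 2 * log 2))) (fun x hx => ?_) h.integrable
  have hx0 : 0 < ‖x‖ := by linarith
  have key : c - 2 * log 2 - log ‖x‖ ≤ u x := by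
    rcases hx.eq_or_lt with h1 | h1
    · have := hc x
      rw [← h1] at this ⊢
      norm_num at this ⊢
      linarith
    · have hs := hgood (√‖x‖) (sqrt_pos.2 hx0)
      have h2 : √‖x‖ < ‖x‖ := by
        rw [sqrt_lt' hx0]; nlinarith
      have h3 : ¬ u x < kelvinTransform u (√‖x‖) x := fun hlt =>
        (Set.eq_empty_iff_forall_notMem.1 hs x) ⟨h2, hlt⟩
      have h4 : ‖kelvin (√‖x‖) x‖ = 1 := by
        rw [norm_kelvin, sq_sqrt hx0.le, div_self hx0.ne']
      have h5 := hc (kelvin (√‖x‖) x)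
      rw [h4] at h5
      norm_num at h5
      rw [kelvinTransform, log_div (sqrt_pos.2 hx0).ne' hx0.ne', log_sqrt hx0.le] at h3
      linarith
  calc exp (3 * (c - 2 * log 2)) * (1 / ‖x‖ ^ 3)
      = exp (3 * (c - 2 * log 2 - log ‖x‖)) := by
        rw [show 3 * (c - 2 * log 2 - log ‖x‖) = 3 * (c - 2 * log 2) + -(((3:ℕ):ℝ) * log ‖x‖) by
          push_cast; ring, exp_add, exp_neg, ← log_pow, exp_log (by positivity), one_div]
    _ ≤ exp (3 * u x) := exp_le_exp.2 (by linarith)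

/-- Strong comparison: an admissible sphere is either a symmetry or strictly admissible. -/
lemma kelvinTransform_lt_of_ne (h : IntEq u) {a : ℝ} (ha : 0 < a) (hgood : badSet u a = ∅)
    {x₀ : E3} (hx₀ : a < ‖x₀‖) (hne : u x₀ ≠ kelvinTransform u a x₀) {x : E3} (hx : a < ‖x‖) :
    kelvinTransform u a x < u x := by
  have hle : ∀ y : E3, a < ‖y‖ → kelvinTransform u a y ≤ u y := fun y hy => by
    by_contra! hlt
    exact Set.eq_empty_iff_forall_notMem.1 hgood y ⟨hy, hlt⟩
  refine lt_of_le_of_ne (hle x hx) fun heq => hne ?_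
  have hxx : x ≠ 0 := norm_pos_iff.1 (ha.trans hx)
  obtain ⟨h1, h2⟩ := h.sub_kelvinTransform ha hxx
  have hSm := measurableSet_exterior a
  have hSo : IsOpen {y : E3 | a < ‖y‖} := isOpen_lt continuous_const continuous_norm
  have h0 : ∫ y in {y | a < ‖y‖},
      sphKernel a x y * (exp (3 * u y) - exp (3 * kelvinTransform u a y)) = 0 := by
    rw [heq, sub_self] at h2
    have : (1 / π ^ 2) ≠ 0 := by positivity
    exact (mul_eq_zero.1 h2.symm).resolve_left this
  rw [setIntegral_eq_zero_iff_of_nonneg_ae ?_ h1] at h0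
  · have hc : ContinuousOn (kelvinTransform u a) {y : E3 | a < ‖y‖} := fun y hy =>
      ((continuousAt_kelvinTransform h.continuous_u ha
        (norm_pos_iff.1 (ha.trans hy))).comp (f := fun y => (a, y))
        (by fun_prop : ContinuousAt (fun y : E3 => (a, y)) y)).continuousWithinAt
    refine Measure.eqOn_open_of_ae_eq (μ := volume) ?_ hSo h.continuous_u.continuousOn hc hx₀
    filter_upwards [h0, ae_restrict_mem hSm, ae_restrict_of_ae (E3.ae_ne x)] with y hy hya hyx
    have hK := sphKernel_pos ha hx hya (Ne.symm hyx)
    have := (mul_eq_zero.1 hy).resolve_left hK.ne'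
    have := exp_injective (sub_eq_zero.1 this)
    linarith
  · filter_upwards [ae_restrict_mem hSm] with y hy
    refine mul_nonneg (sphKernel_nonneg ha hx hy) (sub_nonneg.2 (exp_le_exp.2 ?_))
    linarith [hle y hy]

lemma tendsto_integral_badSet (h : IntEq u) {a : ℝ} (ha : 0 < a)
    (hlt : ∀ x : E3, a < ‖x‖ → kelvinTransform u a x < u x) :
    Tendsto (fun b => ∫ x in badSet u b, (b / ‖x‖) ^ 4) (𝓝 a) (𝓝 0) := by
  have hev : ∀ᶠ b in 𝓝 a, a / 2 < b ∧ b < 2 * a := by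
    have h1 : a / 2 < a := by linarith
    have h2 : a < 2 * a := by linarith
    exact (lt_mem_nhds h1).and (gt_mem_nhds h2)
  have e : ∀ᶠ b in 𝓝 a, ∫ x, (badSet u b).indicator (fun x => (b / ‖x‖) ^ 4) x =
      ∫ x in badSet u b, (b / ‖x‖) ^ 4 := by
    filter_upwards [hev] with b hb
    rw [integral_indicator (isOpen_badSet h.continuous_u (by linarith)).measurableSet]
  refine Tendsto.congr' e ?_
  rw [← integral_zero E3 ℝ (μ := volume)]
  have hbound : Integrable ({x : E3 | a / 2 < ‖x‖}.indicator
      (fun x => 4 ^ 4 * (a / 2 / ‖x‖) ^ 4)) :=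
    (integrable_indicator_iff (measurableSet_exterior _)).2
      ((integrableOn_div_norm_pow (by linarith)).const_mul _)
  refine tendsto_integral_filter_of_dominated_convergence _ ?_ ?_ hbound ?_
  · filter_upwards [hev] with b hb
    refine Measurable.aestronglyMeasurable ?_
    refine Measurable.indicator (by fun_prop)
      (isOpen_badSet h.continuous_u (by linarith)).measurableSet
  · filter_upwards [hev] with b hb
    refine ae_of_all _ fun x => ?_
    have hb0 : 0 < b := by linarith
    by_cases hx : x ∈ badSet u b
    · have hx' : a / 2 < ‖x‖ := hb.1.trans hx.1
      rw [Set.indicator_of_mem hx, Set.indicator_of_mem (s := {x : E3 | a / 2 < ‖x‖}) hx',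
        norm_of_nonneg (by positivity), ← mul_pow]
      gcongr
      rw [mul_div_assoc']
      gcongr
      linarith
    · rw [Set.indicator_of_notMem hx, norm_zero]
      exact Set.indicator_nonneg (fun x _ => by positivity) x
  · have hs : ∀ᵐ x : E3, x ∉ Metric.sphere (0 : E3) a :=
      measure_eq_zero_iff_ae_notMem.1 (Measure.addHaar_sphere _ _ _)
    filter_upwards [hs] with x hx
    refine tendsto_const_nhds.congr' ?_
    have hne : ‖x‖ ≠ a := by simpa using hx
    have hnot : ∀ᶠ b in 𝓝 a, x ∉ badSet u b := by
      rcases hne.lt_or_gt with h1 | h1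
      · filter_upwards [lt_mem_nhds h1] with b hb hxb
        exact absurd hxb.1 (not_lt.2 hb.le)
      · have hc : ContinuousAt (fun b => kelvinTransform u b x) a :=
          (continuousAt_kelvinTransform h.continuous_u ha
            (norm_pos_iff.1 (ha.trans h1))).comp (f := fun b => (b, x))
            (by fun_prop : ContinuousAt (fun b : ℝ => (b, x)) a)
        filter_upwards [hc.eventually_lt continuousAt_const (hlt x h1)] with b hb hxb
        exact absurd hxb.2 (not_lt.2 hb.le)
    filter_upwards [hnot] with b hb
    rw [Set.indicator_of_notMem hb]

/-- The method of moving spheres: some sphere centred at the origin is a symmetry of `u`. -/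
lemma exists_eq_kelvinTransform (h : IntEq u) :
    ∃ a : ℝ, 0 < a ∧ ∀ x : E3, a < ‖x‖ → u x = kelvinTransform u a x := by
  obtain ⟨a₀, ha₀, hsmall⟩ := h.exists_badSet_eq_empty
  obtain ⟨b₀, hb₀, hbad⟩ := h.exists_badSet_nonempty
  obtain ⟨M, hM0, hM⟩ := h.exists_exp_le
  set S := {a : ℝ | 0 < a ∧ (badSet u a).Nonempty} with hS
  have hSne : S.Nonempty := ⟨b₀, hb₀, hbad⟩
  have hlow : ∀ b ∈ S, a₀ ≤ b := fun b hb => by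
    by_contra! hlt
    exact hb.2.ne_empty (hsmall b hb.1 hlt)
  have hbdd : BddBelow S := ⟨a₀, hlow⟩
  set a := sInf S
  have ha : 0 < a := ha₀.trans_le (le_csInf hSne hlow)
  have hgood : ∀ b, 0 < b → b < a → badSet u b = ∅ := fun b hb hba => by
    by_contra hne
    exact absurd (csInf_le hbdd (show b ∈ S from ⟨hb, Set.nonempty_iff_ne_empty.2 hne⟩))
      (not_le.2 hba)
  have hgooda : badSet u a = ∅ := by
    rw [Set.eq_empty_iff_forall_notMem]
    intro x hx
    have hc : ContinuousAt (fun b => kelvinTransform u b x) a :=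
      (continuousAt_kelvinTransform h.continuous_u ha
        (norm_pos_iff.1 (ha.trans hx.1))).comp (f := fun b => (b, x))
        (by fun_prop : ContinuousAt (fun b : ℝ => (b, x)) a)
    have hev : ∀ᶠ b in 𝓝[<] a, 0 < b ∧ b < a ∧ u x < kelvinTransform u b x := by
      filter_upwards [self_mem_nhdsWithin, nhdsWithin_le_nhds (lt_mem_nhds ha),
        nhdsWithin_le_nhds (continuousAt_const.eventually_lt hc hx.2)] with b h1 h2 h3
      exact ⟨h2, h1, h3⟩
    obtain ⟨b, hb0, hba, hb⟩ := hev.exists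
    exact Set.eq_empty_iff_forall_notMem.1 (hgood b hb0 hba) x ⟨hba.trans hx.1, hb⟩
  refine ⟨a, ha, ?_⟩
  by_contra! hne
  obtain ⟨x₀, hx₀, hne⟩ := hne
  have hT := h.tendsto_integral_badSet ha
    fun x hx => h.kelvinTransform_lt_of_ne ha hgooda hx₀ hne hx
  obtain ⟨δ, hδ, hδs⟩ : ∃ δ : ℝ, 0 < δ ∧ M * (2 * π * a * δ ^ 2) < π ^ 2 / 3 := by
    have hc : ContinuousAt (fun δ : ℝ => M * (2 * π * a * δ ^ 2)) 0 := by fun_prop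
    have hlt : (fun δ : ℝ => M * (2 * π * a * δ ^ 2)) 0 < π ^ 2 / 3 := by
      simp only; norm_num; positivity
    obtain ⟨ε, hε, hb⟩ := Metric.eventually_nhds_iff.1 (hc.eventually_lt continuousAt_const hlt)
    refine ⟨ε / 2, by positivity, hb ?_⟩
    rw [dist_zero_right, norm_of_nonneg (by positivity)]
    linarith
  have hlim : Tendsto (fun b => M * ((1 + b / δ) * (∫ x in badSet u b, (b / ‖x‖) ^ 4) +
      2 * π * b * δ ^ 2)) (𝓝 a) (𝓝 (M * ((1 + a / δ) * 0 + 2 * π * a * δ ^ 2))) := by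
    refine Tendsto.const_mul _ (Tendsto.add (Tendsto.mul ?_ hT) ?_)
    · exact Continuous.tendsto (by fun_prop) a
    · exact Continuous.tendsto (by fun_prop) a
  have hev : ∀ᶠ b in 𝓝 a, badSet u b = ∅ := by
    filter_upwards [hlim.eventually_lt_const (by simpa using hδs), lt_mem_nhds ha] with b h1 h2
    exact h.badSet_eq_empty h2 hδ (fun y _ => hM y) h1
  obtain ⟨ε, hε, hb⟩ := Metric.eventually_nhds_iff.1 hev
  obtain ⟨b, hbS, hblt⟩ := exists_lt_of_csInf_lt hSne (show a < a + ε by linarith)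
  refine hbS.2.ne_empty (hb ?_)
  have : a ≤ b := csInf_le hbdd hbS
  rw [dist_eq, abs_of_nonneg (by linarith)]
  linarith

end IntEq

lemma tendsto_smul_atInfty {e : E3} (he : ‖e‖ = 1) :
    Tendsto (fun t : ℝ => t • e) atTop (comap (fun x : E3 => ‖x‖) atTop) := by
  rw [tendsto_comap_iff]
  refine tendsto_atTop_mono (fun t => ?_) tendsto_id
  simp only [Function.comp, norm_smul, he, mul_one, id]
  exact le_abs_self t

lemma tendsto_add_atInfty (a : E3) :
    Tendsto (fun z : E3 => a + z) (comap (fun x : E3 => ‖x‖) atTop)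
      (comap (fun x : E3 => ‖x‖) atTop) := by
  rw [tendsto_comap_iff]
  have h : Tendsto (fun z : E3 => ‖z‖ - ‖a‖) (comap (fun x : E3 => ‖x‖) atTop) atTop :=
    tendsto_atTop_add_const_right _ _ tendsto_comap
  refine tendsto_atTop_mono (fun z => ?_) h
  have := norm_sub_norm_le z (-a)
  simp only [Function.comp]
  rw [sub_neg_eq_add, norm_neg, add_comm z a] at this
  exact this

/-- Invariance under a Kelvin transform forces a quadratic expansion at infinity. -/
lemma isLittleO_of_kelvin_invariant {E : E3 → ℝ} {a : ℝ} (ha : 0 < a) {x₀ : E3} {L : E3 →L[ℝ] ℝ}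
    (hE : HasFDerivAt E L x₀)
    (hk : ∀ y : E3, a < ‖y‖ → E (x₀ + y) = ‖y‖ ^ 2 / a ^ 2 * E (x₀ + kelvin a y)) :
    (fun y => E (x₀ + y) - E x₀ / a ^ 2 * ‖y‖ ^ 2 - L y)
      =o[comap (fun x : E3 => ‖x‖) atTop] fun y => ‖y‖ := by
  rw [Asymptotics.isLittleO_iff]
  intro c hc
  have h1 := (hasFDerivAt_iff_isLittleO_nhds_zero.1 hE).bound hc
  have hκ : Tendsto (kelvin a) (comap (fun x : E3 => ‖x‖) atTop) (𝓝 0) := by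
    rw [tendsto_zero_iff_norm_tendsto_zero]
    simp only [norm_kelvin]
    exact (tendsto_const_nhds (x := a ^ 2)).div_atTop tendsto_comap
  filter_upwards [hκ.eventually h1, tendsto_comap.eventually (eventually_gt_atTop a)] with y hy hya
  have hy0 : 0 < ‖y‖ := ha.trans hya
  rw [hk y hya]
  have e : ‖y‖ ^ 2 / a ^ 2 * E (x₀ + kelvin a y) - E x₀ / a ^ 2 * ‖y‖ ^ 2 - L y =
      ‖y‖ ^ 2 / a ^ 2 * (E (x₀ + kelvin a y) - E x₀ - L (kelvin a y)) := by
    rw [kelvin, map_smul, smul_eq_mul]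
    field_simp
  rw [e, norm_mul, norm_of_nonneg (show (0:ℝ) ≤ ‖y‖ ^ 2 / a ^ 2 by positivity), norm_norm]
  rw [norm_kelvin] at hy
  calc ‖y‖ ^ 2 / a ^ 2 * ‖E (x₀ + kelvin a y) - E x₀ - L (kelvin a y)‖
      ≤ ‖y‖ ^ 2 / a ^ 2 * (c * (a ^ 2 / ‖y‖)) := by gcongr
    _ = c * ‖y‖ := by field_simp

lemma eq_zero_of_quadratic_isLittleO {β : ℝ} {L : E3 →L[ℝ] ℝ}
    (h : (fun y : E3 => β * ‖y‖ ^ 2 + L y) =o[comap (fun x : E3 => ‖x‖) atTop] fun y => ‖y‖) :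
    L = 0 := by
  have key : ∀ e : E3, ‖e‖ = 1 → L e = 0 := by
    intro e he
    have h1 := (h.comp_tendsto (tendsto_smul_atInfty he)).tendsto_div_nhds_zero
    have h2 : Tendsto (fun t : ℝ => β * t + L e) atTop (𝓝 0) := by
      refine h1.congr' ?_
      filter_upwards [eventually_gt_atTop 0] with t ht
      simp only [Function.comp, norm_smul, he, mul_one, norm_of_nonneg ht.le, map_smul,
        smul_eq_mul]
      field_simp
    have h3 := (h2.comp (tendsto_atTop_add_const_right atTop (1:ℝ) tendsto_id)).sub h2
    have h4 : β = 0 := by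
      rw [sub_zero] at h3
      refine tendsto_nhds_unique (tendsto_const_nhds.congr' (Eventually.of_forall fun t => ?_)) h3
      simp only [Function.comp_apply, id]
      ring
    subst h4
    simpa using h2
  ext v
  rcases eq_or_ne v 0 with rfl | hv
  · simp
  · have hn : ‖v‖ ≠ 0 := norm_ne_zero_iff.2 hv
    have := key (‖v‖⁻¹ • v) (by rw [norm_smul, norm_inv, norm_norm, inv_mul_cancel₀ hn])
    rw [map_smul, smul_eq_mul] at this
    simpa [hn] using this

/-- A positive function invariant under a Kelvin transform about every point is quadratic. -/
lemma exists_quadratic_of_kelvin_invariant {E : E3 → ℝ} (hE : Differentiable ℝ E)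
    (hpos : ∀ x, 0 < E x)
    (hk : ∀ x₀ : E3, ∃ a : ℝ, 0 < a ∧ ∀ y : E3, a < ‖y‖ →
      E (x₀ + y) = ‖y‖ ^ 2 / a ^ 2 * E (x₀ + kelvin a y)) :
    ∃ (b t : ℝ) (p : E3), 0 < b ∧ 0 < t ∧ ∀ x, E x = b * (t ^ 2 + ‖x - p‖ ^ 2) := by
  obtain ⟨a, ha, hka⟩ := hk 0
  set b := E 0 / a ^ 2 with hb
  have hb0 : 0 < b := by have := hpos 0; positivity
  set L := fderiv ℝ E 0 with hL
  have hexp := isLittleO_of_kelvin_invariant ha (hE 0).hasFDerivAt hka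
  have hgrad : ∀ x₀, fderiv ℝ E x₀ = L + (2 * b) • innerSL ℝ x₀ := by
    intro x₀
    obtain ⟨a', ha', hka'⟩ := hk x₀
    have h1 := isLittleO_of_kelvin_invariant ha' (hE x₀).hasFDerivAt hka'
    have h2 := hexp.comp_tendsto (tendsto_add_atInfty x₀)
    have hO : ((fun y : E3 => ‖y‖) ∘ fun z => x₀ + z)
        =O[comap (fun x : E3 => ‖x‖) atTop] fun y => ‖y‖ := by
      refine Asymptotics.IsBigO.of_bound 2 ?_
      filter_upwards [tendsto_comap.eventually (eventually_gt_atTop ‖x₀‖)] with z hz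
      simp only [Function.comp, norm_norm]
      linarith [norm_add_le x₀ z]
    have h3 := h1.sub (h2.trans_isBigO hO)
    have hconst : (fun _ : E3 => b * ‖x₀‖ ^ 2 + L x₀)
        =o[comap (fun x : E3 => ‖x‖) atTop] fun y => ‖y‖ := by
      rw [Asymptotics.isLittleO_const_left]
      right
      simpa [Function.comp_def] using (tendsto_comap : Tendsto (fun x : E3 => ‖x‖) _ atTop)
    have h4 : (fun y : E3 => (b - E x₀ / a' ^ 2) * ‖y‖ ^ 2 +
        (L + (2 * b) • innerSL ℝ x₀ - fderiv ℝ E x₀) y)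
        =o[comap (fun x : E3 => ‖x‖) atTop] fun y => ‖y‖ := by
      refine (h3.sub hconst).congr_left fun y => ?_
      simp only [Function.comp, zero_add, map_add, sub_apply,
        add_apply, smul_apply, innerSL_apply_apply,
        smul_eq_mul, norm_add_sq_real]
      ring
    exact (sub_eq_zero.1 (eq_zero_of_quadratic_isLittleO h4)).symm
  have hG : ∀ x, E x - b * ‖x‖ ^ 2 - L x = E 0 := by
    intro x
    have hd : ∀ y, HasFDerivAt (fun x => E x - b * ‖x‖ ^ 2 - L x) (0 : E3 →L[ℝ] ℝ) y := by
      intro y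
      have h1 := (((hE y).hasFDerivAt.sub
        ((hasStrictFDerivAt_norm_sq y).hasFDerivAt.const_mul b)).sub L.hasFDerivAt)
      refine h1.congr_fderiv ?_
      rw [hgrad y]
      ext v
      simp only [sub_apply, add_apply,
        smul_apply, innerSL_apply_apply, smul_eq_mul,
        zero_apply]
      simp
      ring
    have := is_const_of_fderiv_eq_zero (fun y => (hd y).differentiableAt)
      (fun y => (hd y).fderiv) x 0
    simpa using this
  set c := (InnerProductSpace.toDual ℝ E3).symm L with hc
  have hLc : ∀ x, L x = inner ℝ c x := fun x => by
    rw [hc, InnerProductSpace.toDual_symm_apply]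
  set p := -((1 / (2 * b)) • c) with hp
  have hquad : ∀ x, E x = E p + b * ‖x - p‖ ^ 2 := by
    intro x
    have h1 := hG x
    have h2 := hG p
    have h3 : c = (-(2 * b)) • p := by
      rw [hp, smul_neg, neg_smul, neg_neg, smul_smul]
      field_simp
      simp
    rw [hLc, h3, inner_smul_left] at h1 h2
    rw [real_inner_self_eq_norm_sq] at h2
    rw [norm_sub_sq_real, real_inner_comm]
    simp only [map_neg, map_mul, conj_trivial] at h1 h2
    linarith
  refine ⟨b, √(E p / b), p, hb0, sqrt_pos.2 (div_pos (hpos p) hb0), fun x => ?_⟩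
  rw [sq_sqrt (div_pos (hpos p) hb0).le, hquad x]
  field_simp

lemma IntEq.isSpherical {u : E3 → ℝ} (h : IntEq u) : IsSpherical u := by
  have hd : Differentiable ℝ fun x => exp (-u x) :=
    (h.contDiff.differentiable (by simp)).neg.exp
  obtain ⟨b, t, p, hb, ht, hE⟩ := exists_quadratic_of_kelvin_invariant hd
    (fun x => exp_pos _) (fun x₀ => by
      obtain ⟨a, ha, hka⟩ := (h.translate x₀).exists_eq_kelvinTransform
      refine ⟨a, ha, fun y hy => ?_⟩
      have hy0 : 0 < ‖y‖ := ha.trans hy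
      have := hka y hy
      rw [kelvinTransform] at this
      rw [this, neg_add, exp_add, mul_comm]
      congr 1
      rw [← mul_neg, ← log_inv, inv_div, show (2:ℝ) = ((2:ℕ):ℝ) by norm_num, ← log_pow,
        exp_log (by positivity), div_pow])
  have hu : ∀ x, exp (u x) = 1 / (b * (t ^ 2 + ‖x - p‖ ^ 2)) := fun x => by
    rw [← hE x, exp_neg, one_div, inv_inv]
  have hmass := h.mass_eq
  have hbt : b * t = 1 / 2 := by
    have e : ∀ x, exp (3 * u x) = b⁻¹ ^ 3 * (1 / (t ^ 2 + ‖x - p‖ ^ 2) ^ 3) := fun x => by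
      have : exp (3 * u x) = exp (u x) ^ 3 := by rw [← exp_nat_mul]; norm_num
      rw [this, hu x]
      field_simp
    simp_rw [e] at hmass
    rw [integral_const_mul, integral_sub_right_eq_self
      (fun x : E3 => 1 / (t ^ 2 + ‖x‖ ^ 2) ^ 3) p, (radial_inv_cube ht).2] at hmass
    have h8 : (b * t) ^ 3 = (1 / 2) ^ 3 := by
      field_simp at hmass
      nlinarith
    exact (pow_left_inj₀ (by positivity) (by norm_num) (by norm_num)).1 h8
  refine ⟨1 / t, by positivity, p, fun x => ?_⟩
  rw [← log_exp (u x), hu x]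
  congr 1
  have hb' : b = 1 / (2 * t) := by field_simp; linarith
  rw [hb']
  field_simp

section LogLaplacian

variable {s : ℝ} (hs : 0 < s) (p : E3)
include hs

lemma hasFDerivAt_log_add_norm_sq (x : E3) :
    HasFDerivAt (fun y : E3 => log (s + ‖y - p‖ ^ 2))
      ((2 / (s + ‖x - p‖ ^ 2)) • innerSL ℝ (x - p)) x := by
  have h0 : s + ‖x - p‖ ^ 2 ≠ 0 := by positivity
  have h1 : HasFDerivAt (fun y : E3 => s + ‖y - p‖ ^ 2) (2 • innerSL ℝ (x - p)) x := by
    have := ((hasStrictFDerivAt_norm_sq (x - p)).hasFDerivAt.comp x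
      ((hasFDerivAt_id x).sub_const p)).const_add s
    simpa using this
  refine (h1.log h0).congr_fderiv ?_
  ext v
  simp
  ring

lemma contDiff_log_add_norm_sq : ContDiff ℝ (⊤ : ℕ∞) fun y : E3 => log (s + ‖y - p‖ ^ 2) := by
  refine ContDiff.log (contDiff_const.add ((contDiff_id.sub contDiff_const).norm_sq ℝ))
    fun x => ?_
  positivity

lemma lap_log_add_norm_sq (x : E3) : lap (fun y : E3 => log (s + ‖y - p‖ ^ 2)) x =
    6 / (s + ‖x - p‖ ^ 2) - 4 * ‖x - p‖ ^ 2 / (s + ‖x - p‖ ^ 2) ^ 2 := by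
  have h0 : s + ‖x - p‖ ^ 2 ≠ 0 := by positivity
  have e : ∀ i : Fin 3, fderiv ℝ (fun y => fderiv ℝ (fun y : E3 => log (s + ‖y - p‖ ^ 2)) y
      (EuclideanSpace.single i 1)) x (EuclideanSpace.single i 1) =
      2 / (s + ‖x - p‖ ^ 2) - 4 * ((x - p) i) ^ 2 / (s + ‖x - p‖ ^ 2) ^ 2 := by
    intro i
    have e1 : (fun y => fderiv ℝ (fun y : E3 => log (s + ‖y - p‖ ^ 2)) y
        (EuclideanSpace.single i 1)) = fun y => 2 * (y i - p i) / (s + ‖y - p‖ ^ 2) := by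
      funext y
      rw [(hasFDerivAt_log_add_norm_sq hs p y).fderiv]
      simp [EuclideanSpace.inner_single_right]
      ring
    rw [e1]
    have h1 : HasFDerivAt (fun y : E3 => s + ‖y - p‖ ^ 2) (2 • innerSL ℝ (x - p)) x := by
      have := ((hasStrictFDerivAt_norm_sq (x - p)).hasFDerivAt.comp x
        ((hasFDerivAt_id x).sub_const p)).const_add s
      simpa using this
    have h2 : HasFDerivAt (fun y : E3 => 2 * (y i - p i))
        ((2:ℝ) • (EuclideanSpace.proj i : E3 →L[ℝ] ℝ)) x :=
      (((EuclideanSpace.proj i : E3 →L[ℝ] ℝ).hasFDerivAt).sub_const (p i)).const_mul 2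
    have h3 := h2.mul ((hasDerivAt_inv h0).comp_hasFDerivAt x h1)
    have h4 : (fun y : E3 => 2 * (y i - p i) / (s + ‖y - p‖ ^ 2)) =
      (fun y : E3 => 2 * (y i - p i)) * (Inv.inv ∘ fun y : E3 => s + ‖y - p‖ ^ 2) := by
      funext y; simp [div_eq_mul_inv]
    rw [h4, h3.fderiv]
    simp [EuclideanSpace.inner_single_right]
    field_simp
    ring
  unfold lap
  simp_rw [e]
  rw [EuclideanSpace.real_norm_sq_eq, Fin.sum_univ_three, Fin.sum_univ_three]
  rw [EuclideanSpace.real_norm_sq_eq, Fin.sum_univ_three] at h0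
  field_simp
  ring

end LogLaplacian

lemma lap_const_sub (c : ℝ) (g : E3 → ℝ) (x : E3) : lap (fun y => c - g y) x = -lap g x := by
  unfold lap
  rw [← Finset.sum_neg_distrib]
  refine Finset.sum_congr rfl fun i _ => ?_
  simp only [fderiv_const_sub, neg_apply]
  rw [fderiv_fun_neg]
  rfl

lemma lap_const_mul (c : ℝ) (g : E3 → ℝ) (x : E3) : lap (fun y => c * g y) x = c * lap g x := by
  unfold lap
  rw [Finset.mul_sum]
  refine Finset.sum_congr rfl fun i _ => ?_
  have : ∀ h : E3 → ℝ, fderiv ℝ (fun y => c * h y) = fun y => c • fderiv ℝ h y := fun h => by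
    have := fderiv_const_smul_field (𝕜 := ℝ) (f := h) c
    simpa [Pi.smul_def] using this
  rw [this g]
  simp only [smul_apply, smul_eq_mul, this]

namespace IsSpherical

variable {u : E3 → ℝ}

lemma exists_eq_sub_log (h : IsSpherical u) : ∃ (c s : ℝ) (p : E3), 0 < s ∧
    u = fun x => c - log (s + ‖x - p‖ ^ 2) := by
  obtain ⟨l, hl, p, hu⟩ := h
  refine ⟨log (2 / l), 1 / l ^ 2, p, by positivity, funext fun x => ?_⟩
  rw [hu x, ← log_div (by positivity) (by positivity)]
  congr 1
  field_simp

lemma tendsto_lap (h : IsSpherical u) :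
    Tendsto (fun x : E3 => lap u x) (comap (fun x : E3 => ‖x‖) atTop) (𝓝 0) := by
  obtain ⟨c, s, p, hs, rfl⟩ := h.exists_eq_sub_log
  simp_rw [lap_const_sub, lap_log_add_norm_sq hs]
  have h1 : Tendsto (fun x : E3 => x - p) (comap (fun x : E3 => ‖x‖) atTop)
      (comap (fun x : E3 => ‖x‖) atTop) := by
    simp_rw [sub_eq_neg_add]
    exact tendsto_add_atInfty (-p)
  have h2 : Tendsto (fun x : E3 => s + ‖x - p‖ ^ 2) (comap (fun x : E3 => ‖x‖) atTop) atTop :=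
    tendsto_atTop_add_const_left _ _
      ((tendsto_pow_atTop two_ne_zero).comp (tendsto_comap.comp h1))
  have h3 : Tendsto (fun x : E3 => 6 / (s + ‖x - p‖ ^ 2)) (comap (fun x : E3 => ‖x‖) atTop)
      (𝓝 0) := tendsto_const_nhds.div_atTop h2
  refine squeeze_zero_norm (fun x => ?_) h3
  rw [norm_neg]
  have hd : 0 < s + ‖x - p‖ ^ 2 := by positivity
  have h4 : 4 * ‖x - p‖ ^ 2 / (s + ‖x - p‖ ^ 2) ^ 2 ≤ 4 / (s + ‖x - p‖ ^ 2) := by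
    rw [div_le_div_iff₀ (by positivity) hd]
    nlinarith
  have h5 : 0 ≤ 4 * ‖x - p‖ ^ 2 / (s + ‖x - p‖ ^ 2) ^ 2 := by positivity
  have h6 : 4 / (s + ‖x - p‖ ^ 2) ≤ 6 / (s + ‖x - p‖ ^ 2) := by gcongr; norm_num
  rw [norm_of_nonneg (by linarith)]
  linarith

lemma tendsto_div_norm_sq (h : IsSpherical u) :
    Tendsto (fun x : E3 => u x / ‖x‖ ^ 2) (comap (fun x : E3 => ‖x‖) atTop) (𝓝 0) := by
  obtain ⟨c, s, p, hs, rfl⟩ := h.exists_eq_sub_log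
  have hn : Tendsto (fun x : E3 => ‖x‖) (comap (fun x : E3 => ‖x‖) atTop) atTop := tendsto_comap
  have h3 : Tendsto (fun x : E3 => (|c| + |log s|) / ‖x‖ ^ 2 + (s + 2 * ‖p‖) / ‖x‖ ^ 2
      + 2 / ‖x‖) (comap (fun x : E3 => ‖x‖) atTop) (𝓝 (0 + 0 + 0)) := by
    have h2 := (tendsto_pow_atTop (α := ℝ) two_ne_zero).comp hn
    exact ((tendsto_const_nhds.div_atTop h2).add (tendsto_const_nhds.div_atTop h2)).add
      (tendsto_const_nhds.div_atTop hn)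
  rw [add_zero, add_zero] at h3
  refine squeeze_zero_norm' ?_ h3
  filter_upwards [hn.eventually (eventually_gt_atTop 0)] with x hx
  have hlow : log s ≤ log (s + ‖x - p‖ ^ 2) := log_le_log hs (by nlinarith [norm_nonneg (x - p)])
  have hup : log (s + ‖x - p‖ ^ 2) ≤ s + 2 * (‖x‖ + ‖p‖) := by
    have : log (s + ‖x - p‖ ^ 2) ≤ log (exp s * exp (‖x - p‖) ^ 2) := by
      refine log_le_log (by positivity) ?_
      have h1 := add_one_le_exp s
      have h2 := add_one_le_exp ‖x - p‖
      have h4 : (‖x - p‖ + 1) ^ 2 ≤ exp ‖x - p‖ ^ 2 := by gcongr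
      have h5 := norm_nonneg (x - p)
      nlinarith [exp_pos s, exp_pos ‖x - p‖]
    rw [log_mul (exp_pos _).ne' (by positivity), log_exp, log_pow, log_exp] at this
    have h6 := norm_sub_le x p
    push_cast at this
    linarith
  have hnum : |c - log (s + ‖x - p‖ ^ 2)| ≤ |c| + |log s| + (s + 2 * ‖p‖) + 2 * ‖x‖ := by
    have := norm_nonneg p
    rw [abs_le]
    constructor
    · linarith [neg_abs_le c, abs_nonneg (log s)]
    · linarith [le_abs_self c, neg_abs_le (log s)]
  rw [norm_eq_abs, abs_div, abs_of_pos (by positivity : 0 < ‖x‖ ^ 2)]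
  calc |c - log (s + ‖x - p‖ ^ 2)| / ‖x‖ ^ 2
      ≤ (|c| + |log s| + (s + 2 * ‖p‖) + 2 * ‖x‖) / ‖x‖ ^ 2 := by gcongr
    _ = _ := by field_simp

end IsSpherical

/-- The radial weight `(1 - |z|²)₊ⁿ`. -/
noncomputable def ballWeight (n : ℕ) (z : E3) : ℝ := max (1 - ‖z‖ ^ 2) 0 ^ n

section BallWeight

variable {n : ℕ}

lemma ballWeight_nonneg (n : ℕ) (z : E3) : 0 ≤ ballWeight n z := pow_nonneg (le_max_right _ _) n

lemma ballWeight_le_one (n : ℕ) (z : E3) : ballWeight n z ≤ 1 :=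
  pow_le_one₀ (le_max_right _ _) (max_le (by nlinarith [norm_nonneg z]) zero_le_one)

lemma ballWeight_eq_zero (hn : n ≠ 0) {z : E3} (hz : 1 ≤ ‖z‖) : ballWeight n z = 0 := by
  rw [ballWeight, max_eq_right (by nlinarith), zero_pow hn]

lemma continuous_ballWeight (n : ℕ) : Continuous (ballWeight n) := by
  unfold ballWeight; fun_prop

lemma hasCompactSupport_ballWeight (hn : n ≠ 0) : HasCompactSupport (ballWeight n) := by
  refine HasCompactSupport.intro (isCompact_closedBall (0 : E3) 1) fun z hz => ?_
  rw [mem_closedBall_zero_iff, not_le] at hz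
  exact ballWeight_eq_zero hn hz.le

lemma integrable_ballWeight_mul (hn : n ≠ 0) {g : E3 → ℝ} (hg : Continuous g) :
    Integrable fun z => ballWeight n z * g z :=
  ((continuous_ballWeight n).mul hg).integrable_of_hasCompactSupport
    (hasCompactSupport_ballWeight hn).mul_right

lemma integrable_ballWeight (hn : n ≠ 0) : Integrable (ballWeight n) :=
  (continuous_ballWeight n).integrable_of_hasCompactSupport (hasCompactSupport_ballWeight hn)

lemma integral_ballWeight_pos (hn : n ≠ 0) : 0 < ∫ z, ballWeight n z :=
  (continuous_ballWeight n).integral_pos_of_hasCompactSupport_nonneg_nonzero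
    (hasCompactSupport_ballWeight hn) (ballWeight_nonneg n) (x := 0) (by simp [ballWeight])

lemma setIntegral_ballWeight_mul (hn : n ≠ 0) (g : E3 → ℝ) :
    ∫ z in Metric.closedBall (0 : E3) 1, ballWeight n z * g z = ∫ z, ballWeight n z * g z := by
  refine setIntegral_eq_integral_of_forall_compl_eq_zero fun z hz => ?_
  rw [ballWeight_eq_zero hn (by simpa using (not_le.1 (mt mem_closedBall_zero_iff.2 hz)).le),
    zero_mul]

lemma hasDerivAt_max_sq (t : ℝ) : HasDerivAt (fun t : ℝ => max t 0 ^ 2) (2 * max t 0) t := by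
  rcases lt_trichotomy t 0 with h | rfl | h
  · rw [max_eq_right h.le, mul_zero]
    refine (hasDerivAt_const t (0:ℝ)).congr_of_eventuallyEq ?_
    filter_upwards [gt_mem_nhds h] with s hs
    simp [max_eq_right hs.le]
  · rw [max_self, mul_zero, hasDerivAt_iff_isLittleO_nhds_zero]
    refine (Asymptotics.IsBigO.of_bound 1 (Eventually.of_forall fun h => ?_)).trans_isLittleO
      (Asymptotics.isLittleO_pow_id (n := 2) one_lt_two)
    have h1 : max (0 + h) 0 ^ 2 - max 0 0 ^ 2 - h • (0:ℝ) = max h 0 ^ 2 := by simp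
    rw [h1, one_mul, norm_pow, norm_pow]
    have h2 : ‖max h 0‖ ≤ ‖h‖ := by
      rcases le_total h 0 with h0 | h0
      · rw [max_eq_right h0, norm_zero]; exact norm_nonneg h
      · rw [max_eq_left h0]
    gcongr
  · rw [max_eq_left h.le]
    have := hasDerivAt_pow 2 t
    refine (this.congr_deriv (by simp)).congr_of_eventuallyEq ?_
    filter_upwards [lt_mem_nhds h] with s hs
    simp [max_eq_left hs.le]

lemma hasFDerivAt_ballWeight_two (z : E3) :
    HasFDerivAt (ballWeight 2) ((-4 * ballWeight 1 z) • innerSL ℝ z) z := by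
  have h1 : HasFDerivAt (fun y : E3 => 1 - ‖y‖ ^ 2) (-(2 • innerSL ℝ z)) z :=
    (hasStrictFDerivAt_norm_sq z).hasFDerivAt.const_sub 1
  refine ((hasDerivAt_max_sq (1 - ‖z‖ ^ 2)).comp_hasFDerivAt z h1).congr_fderiv ?_
  ext v
  simp [ballWeight]
  ring

end BallWeight

section MeanValue

variable {g : E3 → ℝ}

lemma contDiff_fderiv_apply (hg : ContDiff ℝ (⊤ : ℕ∞) g) (v : E3) :
    ContDiff ℝ (⊤ : ℕ∞) fun x => fderiv ℝ g x v :=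
  (hg.fderiv_right (m := (⊤ : ℕ∞)) (by simp)).clm_apply contDiff_const

lemma continuous_lap (hg : ContDiff ℝ (⊤ : ℕ∞) g) : Continuous (lap g) := by
  unfold lap
  refine continuous_finsetSum _ fun i _ => ?_
  exact (contDiff_fderiv_apply (contDiff_fderiv_apply hg _) _).continuous

lemma integral_ballWeight_mul_fderiv (hg : ContDiff ℝ (⊤ : ℕ∞) g) (x : E3) (r : ℝ) :
    ∫ z, ballWeight 1 z * fderiv ℝ g (x + r • z) z =
      r / 4 * ∫ z, ballWeight 2 z * lap g (x + r • z) := by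
  set e : Fin 3 → E3 := fun i => EuclideanSpace.single i 1 with he
  set G : Fin 3 → E3 → ℝ := fun i z => fderiv ℝ g (x + r • z) (e i) with hG
  have hGd : ∀ i, ContDiff ℝ (⊤ : ℕ∞) (G i) := fun i =>
    (contDiff_fderiv_apply hg (e i)).comp (by fun_prop)
  have hG' : ∀ i z, fderiv ℝ (G i) z (e i) =
      r * fderiv ℝ (fun y => fderiv ℝ g y (e i)) (x + r • z) (e i) := by
    intro i z
    have h1 : HasFDerivAt (fun z : E3 => x + r • z) (r • ContinuousLinearMap.id ℝ E3) z :=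
      ((hasFDerivAt_id z).const_smul r).const_add x
    have h2 := (((contDiff_fderiv_apply hg (e i)).differentiable (by simp))
      (x + r • z)).hasFDerivAt.comp z h1
    have h3 : fderiv ℝ (G i) z = _ := h2.fderiv
    rw [h3]
    simp
  have hi1 : ∀ i, Integrable fun z : E3 => ballWeight 1 z * (z i * G i z) := fun i =>
    integrable_ballWeight_mul one_ne_zero ((by fun_prop : Continuous fun z : E3 => z i).mul
      (hGd i).continuous)
  have hfd : ∀ i z, fderiv ℝ (ballWeight 2) z (e i) = -4 * (ballWeight 1 z * z i) := fun i z => by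
    rw [(hasFDerivAt_ballWeight_two z).fderiv]
    simp [he, EuclideanSpace.inner_single_right]
    ring
  have hGc : ∀ i, Continuous fun z => fderiv ℝ (G i) z (e i) := fun i =>
    (contDiff_fderiv_apply (hGd i) (e i)).continuous
  have hi2 : ∀ i, Integrable fun z : E3 => ballWeight 2 z * fderiv ℝ (G i) z (e i) := fun i =>
    integrable_ballWeight_mul two_ne_zero (hGc i)
  have key : ∀ i, ∫ z : E3, ballWeight 1 z * (z i * G i z) =
      1 / 4 * ∫ z, ballWeight 2 z * fderiv ℝ (G i) z (e i) := by
    intro i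
    have hi3 : Integrable fun z : E3 => fderiv ℝ (ballWeight 2) z (e i) * G i z := by
      refine ((hi1 i).const_mul (-4)).congr (ae_of_all _ fun z => ?_)
      simp only [hfd]; ring
    rw [integral_mul_fderiv_eq_neg_fderiv_mul_of_integrable hi3 (hi2 i)
      (integrable_ballWeight_mul two_ne_zero (hGd i).continuous)
      (fun z _ => (hasFDerivAt_ballWeight_two z).differentiableAt)
      (fun z _ => (hGd i).differentiable (by simp) z), ← integral_neg, ← integral_const_mul]
    refine integral_congr_ae (ae_of_all _ fun z => ?_)
    simp only [hfd]; ring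
  calc ∫ z, ballWeight 1 z * fderiv ℝ g (x + r • z) z
      = ∫ z, ∑ i, ballWeight 1 z * (z i * G i z) := by
        refine integral_congr_ae (ae_of_all _ fun z => ?_)
        simp only
        rw [← Finset.mul_sum]
        congr 1
        have hz : z = ∑ i, z i • e i := by
          simpa [he] using ((EuclideanSpace.basisFun (Fin 3) ℝ).sum_repr z).symm
        have := congrArg (fderiv ℝ g (x + r • z)) hz
        rw [this, map_sum]
        simp [hG]
    _ = ∑ i, 1 / 4 * ∫ z, ballWeight 2 z * fderiv ℝ (G i) z (e i) := by
        rw [integral_finsetSum _ fun i _ => hi1 i]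
        exact Finset.sum_congr rfl fun i _ => key i
    _ = 1 / 4 * ∫ z, ∑ i, ballWeight 2 z * fderiv ℝ (G i) z (e i) := by
        rw [integral_finsetSum _ fun i _ => hi2 i, Finset.mul_sum]
    _ = 1 / 4 * ∫ z, r * (ballWeight 2 z * lap g (x + r • z)) := by
        congr 1
        refine integral_congr_ae (ae_of_all _ fun z => ?_)
        simp only [lap, hG']
        rw [Finset.mul_sum, Finset.mul_sum]
        refine Finset.sum_congr rfl fun i _ => ?_
        ring
    _ = _ := by rw [integral_const_mul]; ring

lemma hasDerivAt_integral_ballWeight (hg : ContDiff ℝ (⊤ : ℕ∞) g) (x : E3) (r : ℝ) :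
    HasDerivAt (fun r : ℝ => ∫ z, ballWeight 1 z * g (x + r • z))
      (r / 4 * ∫ z, ballWeight 2 z * lap g (x + r • z)) r := by
  rw [← integral_ballWeight_mul_fderiv hg]
  have hcd : Continuous fun y => fderiv ℝ g y := hg.continuous_fderiv (by simp)
  obtain ⟨B, hB⟩ := (isCompact_closedBall (0 : E3) (‖x‖ + (|r| + 1))).exists_bound_of_continuousOn
    hcd.continuousOn
  have h1 := setIntegral_ballWeight_mul one_ne_zero fun z => fderiv ℝ g (x + r • z) z
  rw [← h1]
  simp_rw [← setIntegral_ballWeight_mul one_ne_zero]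
  have hgc := hg.continuous
  have hwc := continuous_ballWeight 1
  have hsub : ∀ z ∈ Metric.closedBall (0 : E3) 1, ∀ r' ∈ Metric.ball r 1,
      x + r' • z ∈ Metric.closedBall (0 : E3) (‖x‖ + (|r| + 1)) := by
    intro z hz r' hr'
    rw [mem_closedBall_zero_iff] at hz ⊢
    rw [Metric.mem_ball, dist_eq] at hr'
    have h2 : |r'| ≤ |r| + 1 := by
      have := abs_sub_abs_le_abs_sub r' r
      linarith
    refine (norm_add_le _ _).trans (add_le_add le_rfl ?_)
    rw [norm_smul, norm_eq_abs]
    calc |r'| * ‖z‖ ≤ (|r| + 1) * 1 := by gcongr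
      _ = _ := mul_one _
  refine (hasDerivAt_integral_of_dominated_loc_of_deriv_le (s := Metric.ball r 1)
    (bound := fun _ => B) (F := fun r z => ballWeight 1 z * g (x + r • z))
    (F' := fun r z => ballWeight 1 z * fderiv ℝ g (x + r • z) z)
    (Metric.ball_mem_nhds r one_pos) ?_ ?_ ?_ ?_ ?_ ?_).2
  · exact Eventually.of_forall fun r' =>
      (by fun_prop : Continuous fun z => ballWeight 1 z * g (x + r' • z)).aestronglyMeasurable
  · exact (by fun_prop : Continuous fun z =>
      ballWeight 1 z * g (x + r • z)).continuousOn.integrableOn_compact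
      (isCompact_closedBall _ _)
  · exact (hwc.mul ((hcd.comp (by fun_prop)).clm_apply continuous_id)).aestronglyMeasurable
  · filter_upwards [ae_restrict_mem Metric.isClosed_closedBall.measurableSet] with z hz r' hr'
    have h3 := hB _ (hsub z hz r' hr')
    rw [norm_mul, norm_of_nonneg (ballWeight_nonneg 1 z)]
    rw [mem_closedBall_zero_iff] at hz
    have h4 := (fderiv ℝ g (x + r' • z)).le_opNorm z
    calc ballWeight 1 z * ‖fderiv ℝ g (x + r' • z) z‖
        ≤ 1 * (B * 1) := by
          have hB0 : 0 ≤ B := (norm_nonneg _).trans h3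
          gcongr
          · exact ballWeight_le_one 1 z
          · exact h4.trans (by gcongr)
      _ = B := by ring
  · exact integrableOn_const (measure_closedBall_lt_top.ne)
  · refine ae_of_all _ fun z r' _ => HasDerivAt.const_mul _ ?_
    have h5 : HasDerivAt (fun r : ℝ => x + r • z) z r' := by
      simpa using ((hasDerivAt_id r').smul_const z).const_add x
    exact ((hg.differentiable (by simp)) (x + r' • z)).hasFDerivAt.comp_hasDerivAt r' h5

/-- Averaged mean value formula on balls. -/
lemma integral_ballWeight_sub (hg : ContDiff ℝ (⊤ : ℕ∞) g) (x : E3) (r : ℝ) :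
    (∫ z, ballWeight 1 z * g (x + r • z)) - (∫ z, ballWeight 1 z) * g x =
      ∫ s in (0:ℝ)..r, s / 4 * ∫ z, ballWeight 2 z * lap g (x + s • z) := by
  rw [intervalIntegral.integral_eq_sub_of_hasDerivAt
    fun s _ => hasDerivAt_integral_ballWeight hg x s]
  · simp [integral_mul_const]
  · refine Continuous.intervalIntegrable ?_ _ _
    refine (by fun_prop : Continuous fun s : ℝ => s / 4).mul ?_
    simp_rw [← setIntegral_ballWeight_mul two_ne_zero]
    refine continuous_parametric_integral_of_continuous ?_ (isCompact_closedBall _ _)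
    have h1 := continuous_lap hg
    have h2 := continuous_ballWeight 2
    simp only [Function.uncurry_def]
    fun_prop

end MeanValue

lemma measurable_ballWeight_mul {n : ℕ} {g : E3 → ℝ} (hg : Measurable g) :
    Measurable fun z => ballWeight n z * g z :=
  (continuous_ballWeight n).measurable.mul hg

/-- Weighted ball averages of `1 / |·|²` are controlled by its value at the centre. -/
lemma exists_integral_ballWeight_riesz_le {n : ℕ} (hn : n ≠ 0) : ∃ C, 0 ≤ C ∧
    ∀ a : E3, a ≠ 0 → ∀ s : ℝ, 0 ≤ s →
      Integrable (fun z => ballWeight n z * (1 / ‖a + s • z‖ ^ 2)) ∧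
      ∫ z, ballWeight n z * (1 / ‖a + s • z‖ ^ 2) ≤ C * (1 / ‖a‖ ^ 2) := by
  set C₁ := ∫ z : E3 in Metric.ball 0 1, 1 / ‖z‖ ^ 2 with hC₁
  set c := ∫ z, ballWeight n z with hc
  have hc0 : 0 < c := integral_ballWeight_pos hn
  have hC₁0 : 0 ≤ C₁ := integral_nonneg fun z => by positivity
  clear_value c C₁
  refine ⟨4 * (c + C₁), by positivity, fun a ha s hs => ?_⟩
  have ha0 : 0 < ‖a‖ := norm_pos_iff.2 ha
  have hmeas : Measurable fun z : E3 => ballWeight n z * (1 / ‖a + s • z‖ ^ 2) :=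
    measurable_ballWeight_mul (by fun_prop)
  rcases le_or_gt s (‖a‖ / 2) with h | h
  · have hi : Integrable fun z => 4 / ‖a‖ ^ 2 * ballWeight n z :=
      (integrable_ballWeight hn).const_mul _
    have hb : ∀ z, ballWeight n z * (1 / ‖a + s • z‖ ^ 2) ≤ 4 / ‖a‖ ^ 2 * ballWeight n z := by
      intro z
      have hw := ballWeight_nonneg n z
      rcases le_or_gt 1 ‖z‖ with hz | hz
      · rw [ballWeight_eq_zero hn hz]; simp
      · have h1 : ‖a‖ / 2 ≤ ‖a + s • z‖ := by
          have := norm_sub_norm_le a (-(s • z))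
          rw [sub_neg_eq_add, norm_neg, norm_smul, norm_of_nonneg hs] at this
          nlinarith [norm_nonneg z]
        rw [mul_comm]
        refine mul_le_mul_of_nonneg_right ?_ hw
        calc 1 / ‖a + s • z‖ ^ 2 ≤ 1 / (‖a‖ / 2) ^ 2 := by gcongr
          _ = 4 / ‖a‖ ^ 2 := by field_simp; norm_num
    have hI : Integrable (fun z => ballWeight n z * (1 / ‖a + s • z‖ ^ 2)) := by
      refine hi.mono' hmeas.aestronglyMeasurable (ae_of_all _ fun z => ?_)
      rw [norm_of_nonneg (mul_nonneg (ballWeight_nonneg n z) (by positivity))]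
      exact hb z
    refine ⟨hI, (integral_mono hI hi hb).trans ?_⟩
    rw [integral_const_mul, ← hc]
    have : 4 / ‖a‖ ^ 2 * c = 4 * c * (1 / ‖a‖ ^ 2) := by ring
    rw [this]
    gcongr
    linarith
  · have hs0 : 0 < s := by linarith
    set b := -(s⁻¹ • a) with hb
    have hab : ∀ z, ‖a + s • z‖ = s * ‖z - b‖ := fun z => by
      rw [← norm_of_nonneg hs0.le, ← norm_smul, norm_of_nonneg hs0.le, hb, sub_neg_eq_add,
        smul_add, smul_smul, mul_inv_cancel₀ hs0.ne', one_smul, add_comm]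
    set J : E3 → ℝ := fun z => (Metric.ball (0 : E3) 1).indicator (fun z => 1 / ‖z‖ ^ 2) z with hJ
    have hJi : Integrable J :=
      (integrable_indicator_iff Metric.isOpen_ball.measurableSet).2 (integrableOn_inv_norm_sq_ball 1)
    have hJe : ∫ z, J z = C₁ :=
      (integral_indicator Metric.isOpen_ball.measurableSet).trans hC₁.symm
    have hi : Integrable fun z => 1 / s ^ 2 * (ballWeight n z + J (z - b)) :=
      ((integrable_ballWeight hn).add (hJi.comp_sub_right b)).const_mul _
    have hle : ∀ z, ballWeight n z * (1 / ‖a + s • z‖ ^ 2) ≤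
        1 / s ^ 2 * (ballWeight n z + J (z - b)) := by
      intro z
      have hw := ballWeight_nonneg n z
      have hw1 := ballWeight_le_one n z
      have h1 : ballWeight n z * (1 / ‖a + s • z‖ ^ 2) =
          1 / s ^ 2 * (ballWeight n z * (1 / ‖z - b‖ ^ 2)) := by
        rw [hab, mul_pow, ← one_div_mul_one_div]; ring
      rw [h1]
      refine mul_le_mul_of_nonneg_left ?_ (by positivity)
      by_cases hz : z - b ∈ Metric.ball (0 : E3) 1
      · have h2 : J (z - b) = 1 / ‖z - b‖ ^ 2 := Set.indicator_of_mem hz _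
        have h3 : 0 ≤ 1 / ‖z - b‖ ^ 2 := by positivity
        rw [h2]
        nlinarith
      · have h2 : J (z - b) = 0 := Set.indicator_of_notMem hz _
        rw [mem_ball_zero_iff, not_lt] at hz
        have h3 : 1 / ‖z - b‖ ^ 2 ≤ 1 := by
          rw [div_le_one (by positivity)]; nlinarith
        rw [h2]
        nlinarith
    have hI : Integrable (fun z => ballWeight n z * (1 / ‖a + s • z‖ ^ 2)) := by
      refine hi.mono' hmeas.aestronglyMeasurable (ae_of_all _ fun z => ?_)
      rw [norm_of_nonneg (mul_nonneg (ballWeight_nonneg n z) (by positivity))]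
      exact hle z
    refine ⟨hI, (integral_mono hI hi hle).trans ?_⟩
    rw [integral_const_mul, integral_add (integrable_ballWeight hn) (hJi.comp_sub_right b),
      integral_sub_right_eq_self J b, hJe, ← hc]
    have : 4 * (c + C₁) * (1 / ‖a‖ ^ 2) = 1 / (‖a‖ / 2) ^ 2 * (c + C₁) := by
      field_simp; norm_num
    rw [this]
    refine mul_le_mul_of_nonneg_right (one_div_le_one_div_of_le (by positivity) ?_) (by positivity)
    exact pow_le_pow_left₀ (by positivity) h.le 2

lemma lap_half_log {s : ℝ} (hs : 0 < s) (x : E3) :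
    lap (fun y : E3 => 1 / 2 * log (s + ‖y‖ ^ 2)) x =
      3 / (s + ‖x‖ ^ 2) - 2 * ‖x‖ ^ 2 / (s + ‖x‖ ^ 2) ^ 2 := by
  have := lap_log_add_norm_sq hs 0 x
  simp only [sub_zero] at this
  rw [lap_const_mul, this]
  ring

lemma abs_lap_half_log_le {s : ℝ} (hs : 0 < s) {x : E3} (hx : x ≠ 0) :
    |lap (fun y : E3 => 1 / 2 * log (s + ‖y‖ ^ 2)) x| ≤ 3 * (1 / ‖x‖ ^ 2) := by
  have hx0 : 0 < ‖x‖ := norm_pos_iff.2 hx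
  rw [lap_half_log hs]
  have h1 : 2 * ‖x‖ ^ 2 / (s + ‖x‖ ^ 2) ^ 2 ≤ 2 / (s + ‖x‖ ^ 2) := by
    rw [div_le_div_iff₀ (by positivity) (by positivity)]
    nlinarith
  have h2 : 2 / (s + ‖x‖ ^ 2) ≤ 3 / (s + ‖x‖ ^ 2) := by gcongr; norm_num
  have h3 : 0 ≤ 2 * ‖x‖ ^ 2 / (s + ‖x‖ ^ 2) ^ 2 := by positivity
  have h4 : 3 / (s + ‖x‖ ^ 2) ≤ 3 * (1 / ‖x‖ ^ 2) := by
    rw [mul_one_div]; gcongr; linarith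
  rw [abs_of_nonneg (by linarith)]
  linarith

lemma abs_half_log_le {s : ℝ} (hs : 0 < s) (hs1 : s ≤ 1) {r : ℝ} (hr : 0 < r) :
    |1 / 2 * log (s + r ^ 2)| ≤ r ^ 2 + 1 / r ^ 2 := by
  have h1 : log (s + r ^ 2) ≤ r ^ 2 := by
    have := log_le_sub_one_of_pos (show 0 < s + r ^ 2 by positivity)
    linarith
  have h2 : -(1 / r ^ 2) ≤ log (s + r ^ 2) := by
    have h3 := one_sub_inv_le_log_of_pos (show 0 < r ^ 2 by positivity)
    have h4 : log (r ^ 2) ≤ log (s + r ^ 2) := log_le_log (by positivity) (by linarith)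
    rw [one_div]; linarith
  have h5 : 0 ≤ 1 / r ^ 2 := by positivity
  have h6 : 0 ≤ r ^ 2 := by positivity
  rw [abs_le]
  constructor <;> linarith

lemma ae_add_smul_ne_zero {a : E3} (ha : a ≠ 0) (s : ℝ) : ∀ᵐ z : E3, a + s • z ≠ 0 := by
  rcases eq_or_ne s 0 with rfl | hs
  · simpa using ha
  filter_upwards [E3.ae_ne (-(s⁻¹ • a))] with z hz h
  refine hz ?_
  rw [add_eq_zero_iff_neg_eq] at h
  rw [← smul_neg, h, smul_smul, inv_mul_cancel₀ hs, one_smul]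

/-- The averaged mean value formula for the logarithmic kernel away from its pole. -/
lemma integral_ballWeight_log_sub {a : E3} (ha : a ≠ 0) {r : ℝ} (hr : 0 ≤ r) :
    (∫ z, ballWeight 1 z * log ‖a + r • z‖) - (∫ z, ballWeight 1 z) * log ‖a‖ =
      ∫ s in (0:ℝ)..r, s / 4 * ∫ z, ballWeight 2 z * (1 / ‖a + s • z‖ ^ 2) := by
  obtain ⟨C₁, -, hC₁⟩ := exists_integral_ballWeight_riesz_le one_ne_zero
  obtain ⟨C₂, hC₂0, hC₂⟩ := exists_integral_ballWeight_riesz_le two_ne_zero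
  set ε : ℕ → ℝ := fun k => 1 / ((k:ℝ) + 1) with hε
  have hε0 : ∀ k, 0 < ε k := fun k => by simp only [hε]; positivity
  have hε1 : ∀ k, ε k ≤ 1 := fun k => by
    simp only [hε]; rw [div_le_one (by positivity)]; linarith [k.cast_nonneg (α := ℝ)]
  have hεlim : Tendsto ε atTop (𝓝 0) := tendsto_one_div_add_atTop_nhds_zero_nat
  set A : ℕ → E3 → ℝ := fun k y => 1 / 2 * log (ε k + ‖y‖ ^ 2) with hA
  have hAc : ∀ k, ContDiff ℝ (⊤ : ℕ∞) (A k) := fun k => by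
    have := contDiff_log_add_norm_sq (hε0 k) 0
    simp only [sub_zero] at this
    exact contDiff_const.mul this
  have hAlim : ∀ y : E3, y ≠ 0 → Tendsto (fun k => A k y) atTop (𝓝 (log ‖y‖)) := by
    intro y hy
    have hy0 : 0 < ‖y‖ := norm_pos_iff.2 hy
    have h1 : Tendsto (fun k => ε k + ‖y‖ ^ 2) atTop (𝓝 (0 + ‖y‖ ^ 2)) := hεlim.add_const _
    have h2 := (h1.log (by positivity)).const_mul (1 / 2)
    rw [zero_add, log_pow] at h2
    convert h2 using 2
    push_cast
    ring
  have hLlim : ∀ y : E3, y ≠ 0 → Tendsto (fun k => lap (A k) y) atTop (𝓝 (1 / ‖y‖ ^ 2)) := by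
    intro y hy
    have hy0 : 0 < ‖y‖ := norm_pos_iff.2 hy
    have h1 : Tendsto (fun k => ε k + ‖y‖ ^ 2) atTop (𝓝 (0 + ‖y‖ ^ 2)) := hεlim.add_const _
    rw [zero_add] at h1
    have h2 := ((tendsto_const_nhds (x := (3:ℝ))).div h1 (by positivity)).sub
      ((tendsto_const_nhds (x := 2 * ‖y‖ ^ 2)).div (h1.pow 2) (by positivity))
    have h3 : 3 / ‖y‖ ^ 2 - 2 * ‖y‖ ^ 2 / (‖y‖ ^ 2) ^ 2 = 1 / ‖y‖ ^ 2 := by field_simp; norm_num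
    rw [h3] at h2
    refine h2.congr fun k => ?_
    rw [hA, lap_half_log (hε0 k)]
    rfl
  have lim1 : Tendsto (fun k => ∫ z, ballWeight 1 z * A k (a + r • z)) atTop
      (𝓝 (∫ z, ballWeight 1 z * log ‖a + r • z‖)) := by
    refine tendsto_integral_of_dominated_convergence
      (fun z => ballWeight 1 z * ‖a + r • z‖ ^ 2 + ballWeight 1 z * (1 / ‖a + r • z‖ ^ 2))
      (fun k => ?_) ?_ (fun k => ?_) ?_
    · exact ((continuous_ballWeight 1).mul
        ((hAc k).continuous.comp (by fun_prop))).aestronglyMeasurable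
    · exact (integrable_ballWeight_mul one_ne_zero (by fun_prop)).add (hC₁ a ha r hr).1
    · filter_upwards [ae_add_smul_ne_zero ha r] with z hz
      rw [norm_mul, norm_of_nonneg (ballWeight_nonneg 1 z), ← mul_add]
      exact mul_le_mul_of_nonneg_left (abs_half_log_le (hε0 k) (hε1 k) (norm_pos_iff.2 hz))
        (ballWeight_nonneg 1 z)
    · filter_upwards [ae_add_smul_ne_zero ha r] with z hz
      exact (hAlim _ hz).const_mul _
  have lim2 : ∀ s : ℝ, 0 ≤ s → Tendsto (fun k => ∫ z, ballWeight 2 z * lap (A k) (a + s • z)) atTop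
      (𝓝 (∫ z, ballWeight 2 z * (1 / ‖a + s • z‖ ^ 2))) := by
    intro s hs
    refine tendsto_integral_of_dominated_convergence
      (fun z => 3 * (ballWeight 2 z * (1 / ‖a + s • z‖ ^ 2)))
      (fun k => ?_) ?_ (fun k => ?_) ?_
    · exact ((continuous_ballWeight 2).mul
        ((continuous_lap (hAc k)).comp (by fun_prop))).aestronglyMeasurable
    · exact (hC₂ a ha s hs).1.const_mul 3
    · filter_upwards [ae_add_smul_ne_zero ha s] with z hz
      rw [norm_mul, norm_of_nonneg (ballWeight_nonneg 2 z)]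
      calc ballWeight 2 z * ‖lap (A k) (a + s • z)‖
          ≤ ballWeight 2 z * (3 * (1 / ‖a + s • z‖ ^ 2)) :=
            mul_le_mul_of_nonneg_left (abs_lap_half_log_le (hε0 k) hz) (ballWeight_nonneg 2 z)
        _ = _ := by ring
    · filter_upwards [ae_add_smul_ne_zero ha s] with z hz
      exact (hLlim _ hz).const_mul _
  have bd : ∀ (k : ℕ) (s : ℝ), 0 ≤ s → |∫ z, ballWeight 2 z * lap (A k) (a + s • z)| ≤
      3 * (C₂ * (1 / ‖a‖ ^ 2)) := by
    intro k s hs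
    have h1 := hC₂ a ha s hs
    rw [← norm_eq_abs]
    refine (norm_integral_le_of_norm_le (h1.1.const_mul 3) ?_).trans ?_
    · filter_upwards [ae_add_smul_ne_zero ha s] with z hz
      rw [norm_mul, norm_of_nonneg (ballWeight_nonneg 2 z)]
      calc ballWeight 2 z * ‖lap (A k) (a + s • z)‖
          ≤ ballWeight 2 z * (3 * (1 / ‖a + s • z‖ ^ 2)) :=
            mul_le_mul_of_nonneg_left (abs_lap_half_log_le (hε0 k) hz) (ballWeight_nonneg 2 z)
        _ = _ := by ring
    · rw [integral_const_mul]
      exact mul_le_mul_of_nonneg_left h1.2 (by norm_num)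
  have lim3 : Tendsto (fun k => ∫ s in (0:ℝ)..r, s / 4 * ∫ z, ballWeight 2 z * lap (A k) (a + s • z))
      atTop (𝓝 (∫ s in (0:ℝ)..r, s / 4 * ∫ z, ballWeight 2 z * (1 / ‖a + s • z‖ ^ 2))) := by
    refine intervalIntegral.tendsto_integral_filter_of_dominated_convergence
      (fun _ => r / 4 * (3 * (C₂ * (1 / ‖a‖ ^ 2)))) ?_ ?_ ?_ ?_
    · refine Eventually.of_forall fun k => Continuous.aestronglyMeasurable ?_
      refine (by fun_prop : Continuous fun s : ℝ => s / 4).mul ?_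
      simp_rw [← setIntegral_ballWeight_mul two_ne_zero]
      refine continuous_parametric_integral_of_continuous ?_ (isCompact_closedBall _ _)
      have h1 := continuous_lap (hAc k)
      have h2 := continuous_ballWeight 2
      simp only [Function.uncurry_def]
      fun_prop
    · refine Eventually.of_forall fun k => ae_of_all _ fun s hs => ?_
      rw [Set.uIoc_of_le hr] at hs
      have h0 : 0 ≤ s := hs.1.le
      rw [norm_mul, norm_of_nonneg (by positivity)]
      refine mul_le_mul (by linarith [hs.2]) (bd k s h0) (norm_nonneg _) (by positivity)
    · simp
    · refine ae_of_all _ fun s hs => ?_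
      rw [Set.uIoc_of_le hr] at hs
      exact (lim2 s hs.1.le).const_mul _
  refine tendsto_nhds_unique ((lim1.sub ((hAlim a ha).const_mul _))) (lim3.congr fun k => ?_)
  rw [integral_ballWeight_sub (hAc k)]

/-- A practical form of Tonelli's criterion. -/
lemma integrable_uncurry_of_le {X Y : Type*} [MeasurableSpace X] [MeasurableSpace Y]
    {μ : Measure X} {ν : Measure Y} [SFinite μ] [SFinite ν] {F : X → Y → ℝ}
    (hF : Measurable (Function.uncurry F)) {G : Y → ℝ} (hG : Integrable G ν)
    (h : ∀ᵐ y ∂ν, ∃ D : X → ℝ, Integrable D μ ∧ (∀ᵐ x ∂μ, |F x y| ≤ D x) ∧ ∫ x, D x ∂μ ≤ G y) :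
    Integrable (Function.uncurry F) (μ.prod ν) := by
  have key : ∀ᵐ y ∂ν, Integrable (fun x => F x y) μ ∧ ∫ x, |F x y| ∂μ ≤ G y := by
    filter_upwards [h] with y ⟨D, hD, hFD, hDG⟩
    have hi : Integrable (fun x => F x y) μ :=
      hD.mono' (hF.comp (measurable_id.prodMk measurable_const)).aestronglyMeasurable hFD
    exact ⟨hi, (integral_mono_ae hi.abs hD hFD).trans hDG⟩
  rw [integrable_prod_iff' hF.aestronglyMeasurable]
  refine ⟨key.mono fun y hy => hy.1, hG.mono' ?_ ?_⟩
  · exact hF.aestronglyMeasurable.norm.prod_swap.integral_prod_right'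
  · filter_upwards [key] with y hy
    rw [norm_of_nonneg (integral_nonneg fun x => norm_nonneg _)]
    exact hy.2

section potential

variable {f : E3 → ℝ} (hf : Continuous f) (hfi : Integrable f) (hf0 : ∀ y, 0 ≤ f y)
include hf hfi hf0

lemma exists_integrable_ballWeight_log : ∃ K, 0 ≤ K ∧ ∀ r : ℝ, 0 ≤ r →
    (∀ x, Integrable (Function.uncurry fun z y : E3 =>
      ballWeight 1 z * (log (‖y‖ / ‖x + r • z - y‖) * f y)) (volume.prod volume)) ∧
    |∫ z, ballWeight 1 z * ∫ y, log (‖y‖ / ‖r • z - y‖) * f y| ≤ K * r := by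
  obtain ⟨C, hC0, hC⟩ := exists_integral_ballWeight_riesz_le one_ne_zero
  set c := ∫ z, ballWeight 1 z with hc
  set G : E3 → E3 → ℝ := fun x y => f y * (c * (1 / ‖y‖ + 1) + C * (1 / ‖x - y‖ ^ 2)) with hG
  have hGi : ∀ x, Integrable (G x) := fun x => by
    have h1 := (((integrable_newton hf hfi 0).add hfi).const_mul c).add
      ((integrable_riesz hf hfi x).const_mul C)
    refine h1.congr (ae_of_all _ fun y => ?_)
    simp only [hG, Pi.add_apply, zero_sub, norm_neg]
    ring
  have hdom : ∀ r : ℝ, 0 ≤ r → ∀ x, ∀ᵐ y : E3, ∃ D : E3 → ℝ, Integrable D ∧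
      (∀ᵐ z, |ballWeight 1 z * (log (‖y‖ / ‖x + r • z - y‖) * f y)| ≤ D z) ∧
      ∫ z, D z ≤ (‖x‖ + r) * G x y := by
    intro r hr x
    filter_upwards [E3.ae_ne x] with y hy
    have h1 := hC (x - y) (sub_ne_zero.2 hy.symm) r hr
    refine ⟨fun z => (‖x‖ + r) * f y * ((1 / ‖y‖ + 1) * ballWeight 1 z +
      ballWeight 1 z * (1 / ‖x - y + r • z‖ ^ 2)),
      ((((integrable_ballWeight one_ne_zero).const_mul _).add h1.1).const_mul _),
      ae_of_all _ fun z => ?_, ?_⟩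
    · have hw := ballWeight_nonneg 1 z
      rcases le_or_gt 1 ‖z‖ with hz | hz
      · simp [ballWeight_eq_zero one_ne_zero hz]
      · have h2 := abs_log_kernel_le 0 (x + r • z) y
        simp only [zero_sub, norm_neg] at h2
        have h3 : ‖x + r • z‖ ≤ ‖x‖ + r := by
          refine (norm_add_le _ _).trans ?_
          rw [norm_smul, norm_of_nonneg hr]
          nlinarith
        have h4 : ∀ t : ℝ, 0 ≤ t → 1 / t ≤ 1 + 1 / t ^ 2 := by
          intro t ht
          have := sq_nonneg (1 / t - 1)
          rw [← one_div_pow]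
          nlinarith [sq_nonneg (1 / t)]
        have h5 := h4 ‖x + r • z - y‖ (norm_nonneg _)
        have h6 : x - y + r • z = x + r • z - y := by abel
        simp only [h6]
        rw [abs_mul, abs_mul, abs_of_nonneg hw, abs_of_nonneg (hf0 y)]
        calc ballWeight 1 z * (|log (‖y‖ / ‖x + r • z - y‖)| * f y)
            ≤ ballWeight 1 z * ((‖x‖ + r) * (1 / ‖y‖ + (1 + 1 / ‖x + r • z - y‖ ^ 2)) * f y) := by
              refine mul_le_mul_of_nonneg_left (mul_le_mul_of_nonneg_right (h2.trans ?_) (hf0 y)) hw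
              gcongr
          _ = _ := by ring
    · rw [integral_const_mul, integral_add ((integrable_ballWeight one_ne_zero).const_mul _) h1.1,
        integral_const_mul, ← hc, mul_assoc]
      refine mul_le_mul_of_nonneg_left ?_ (by positivity)
      refine mul_le_mul_of_nonneg_left ?_ (hf0 y)
      linarith [h1.2]
  have hmeas : ∀ (r : ℝ) (x : E3), Measurable (Function.uncurry fun z y : E3 =>
      ballWeight 1 z * (log (‖y‖ / ‖x + r • z - y‖) * f y)) := by
    intro r x
    have h1 := (continuous_ballWeight 1).measurable
    have h2 := hf.measurable
    simp only [Function.uncurry_def]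
    fun_prop
  have hprod_int := fun (r : ℝ) (hr : 0 ≤ r) x =>
    integrable_uncurry_of_le (hmeas r x) ((hGi x).const_mul (‖x‖ + r)) (hdom r hr x)
  have hG0 : 0 ≤ ∫ y, G 0 y := integral_nonneg fun y => by
    have : 0 ≤ c := (integral_ballWeight_pos one_ne_zero).le
    have := hf0 y
    simp only [hG]
    positivity
  refine ⟨∫ y, G 0 y, hG0, fun r hr => ⟨hprod_int r hr, ?_⟩⟩
  have h1 := hprod_int r hr 0
  have h2 := integral_integral_swap h1
  simp only [zero_add, integral_const_mul] at h2
  rw [h2, ← norm_eq_abs, mul_comm, ← integral_const_mul]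
  refine norm_integral_le_of_norm_le ((hGi 0).const_mul r) ?_
  filter_upwards [hdom r hr 0] with y ⟨D, hD, hFD, hDG⟩
  rw [norm_zero, zero_add] at hDG
  refine (norm_integral_le_of_norm_le hD ?_).trans hDG
  simpa only [zero_add, norm_eq_abs] using hFD

/-- The averaged mean value formula for the logarithmic potential. -/
lemma integral_ballWeight_log_potential_sub (x : E3) {r : ℝ} (hr : 0 ≤ r) :
    (∫ z, ballWeight 1 z * ∫ y, log (‖y‖ / ‖x + r • z - y‖) * f y) -
      (∫ z, ballWeight 1 z) * ∫ y, log (‖y‖ / ‖x - y‖) * f y =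
      -∫ s in (0:ℝ)..r, s / 4 * ∫ z, ballWeight 2 z * ∫ y, 1 / ‖x + s • z - y‖ ^ 2 * f y := by
  obtain ⟨K, -, hK⟩ := exists_integrable_ballWeight_log hf hfi hf0
  obtain ⟨C₁, hC₁0, hC₁⟩ := exists_integral_ballWeight_riesz_le one_ne_zero
  obtain ⟨C, hC0, hC⟩ := exists_integral_ballWeight_riesz_le two_ne_zero
  set c := ∫ z, ballWeight 1 z with hc
  set H : ℝ → E3 → ℝ := fun s y => ∫ z, ballWeight 2 z * (1 / ‖x + s • z - y‖ ^ 2) with hH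
  have hHeq : ∀ s y, H s y = ∫ z, ballWeight 2 z * (1 / ‖x - y + s • z‖ ^ 2) := by
    intro s y
    simp only [hH, sub_add_eq_add_sub]
  have hf1 := hf.measurable
  have hb2 := (continuous_ballWeight 2).measurable
  have e1 : (∫ z, ballWeight 1 z * ∫ y, log (‖y‖ / ‖x + r • z - y‖) * f y) =
      ∫ y, f y * ∫ z, ballWeight 1 z * log (‖y‖ / ‖x + r • z - y‖) := by
    have h1 := integral_integral_swap ((hK r hr).1 x)
    simp only [integral_const_mul] at h1
    rw [h1]
    congr 1
    ext y
    rw [← integral_const_mul]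
    congr 1
    ext z
    ring
  have e2 : ∀ᵐ y : E3, f y * ∫ z, ballWeight 1 z * log (‖y‖ / ‖x + r • z - y‖) =
      c * (log (‖y‖ / ‖x - y‖) * f y) - f y * ∫ s in (0:ℝ)..r, s / 4 * H s y := by
    filter_upwards [E3.ae_ne x, E3.ae_ne 0] with y hy hy0
    have hxy : x - y ≠ 0 := sub_ne_zero.2 hy.symm
    have h1 := integral_ballWeight_log_sub hxy hr
    simp only [← hHeq] at h1
    rw [← h1, log_div (norm_ne_zero_iff.2 hy0) (norm_ne_zero_iff.2 hxy)]
    have h2 : ∫ z, ballWeight 1 z * log (‖y‖ / ‖x + r • z - y‖) =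
        ∫ z, (ballWeight 1 z * log ‖y‖ - ballWeight 1 z * log ‖x - y + r • z‖) := by
      refine integral_congr_ae ?_
      filter_upwards [ae_add_smul_ne_zero hxy r] with z hz
      have h3 : x - y + r • z = x + r • z - y := by abel
      rw [h3] at hz ⊢
      rw [log_div (norm_ne_zero_iff.2 hy0) (norm_ne_zero_iff.2 hz)]
      ring
    have h4 : Integrable fun z => ballWeight 1 z * log ‖x - y + r • z‖ := by
      refine ((integrable_ballWeight_mul one_ne_zero (g := fun z => ‖x - y + r • z‖ ^ 2)
        (by fun_prop)).add (hC₁ (x - y) hxy r hr).1).mono'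
        (measurable_ballWeight_mul (by fun_prop)).aestronglyMeasurable ?_
      filter_upwards [ae_add_smul_ne_zero hxy r] with z hz
      have h5 : 0 < ‖x - y + r • z‖ := norm_pos_iff.2 hz
      rw [norm_mul, norm_of_nonneg (ballWeight_nonneg 1 z), Pi.add_apply, ← mul_add]
      refine mul_le_mul_of_nonneg_left ?_ (ballWeight_nonneg 1 z)
      have h6 := log_le_sub_one_of_pos (show 0 < ‖x - y + r • z‖ ^ 2 by positivity)
      have h7 := one_sub_inv_le_log_of_pos (show 0 < ‖x - y + r • z‖ ^ 2 by positivity)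
      rw [log_pow] at h6 h7
      push_cast at h6 h7
      have h8 : 0 < 1 / ‖x - y + r • z‖ ^ 2 := by positivity
      have h9 : 0 < ‖x - y + r • z‖ ^ 2 := by positivity
      rw [← one_div] at h7
      rw [norm_eq_abs, abs_le]
      constructor <;> linarith
    rw [h2, integral_sub ((integrable_ballWeight one_ne_zero).mul_const _) h4, integral_mul_const]
    ring
  -- Fubini in the `s`-integral
  have hHm : Measurable (Function.uncurry H) := by
    have h1 : Measurable fun p : (ℝ × E3) × E3 =>
        ballWeight 2 p.2 * (1 / ‖x + p.1.1 • p.2 - p.1.2‖ ^ 2) := by fun_prop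
    exact h1.stronglyMeasurable.integral_prod_right'.measurable
  have hHb : ∀ s, 0 ≤ s → ∀ y, y ≠ x → 0 ≤ H s y ∧ H s y ≤ C * (1 / ‖x - y‖ ^ 2) := by
    intro s hs y hy
    rw [hHeq]
    exact ⟨integral_nonneg fun z => mul_nonneg (ballWeight_nonneg 2 z) (by positivity),
      (hC (x - y) (sub_ne_zero.2 hy.symm) s hs).2⟩
  have hFub : Integrable (Function.uncurry fun (s : ℝ) y => f y * (s / 4 * H s y))
      ((volume.restrict (Set.Ioc 0 r)).prod volume) := by
    refine integrable_uncurry_of_le ?_ (((integrable_riesz hf hfi x).const_mul (r / 4 * C)).mul_const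
      r) ?_
    · have : Measurable fun p : ℝ × E3 => f p.2 * (p.1 / 4 * Function.uncurry H p) := by fun_prop
      exact this
    · filter_upwards [E3.ae_ne x] with y hy
      refine ⟨fun _ => f y * (r / 4 * (C * (1 / ‖x - y‖ ^ 2))), integrable_const _, ?_, ?_⟩
      · refine (ae_restrict_iff' measurableSet_Ioc).2 (ae_of_all _ fun s hs => ?_)
        obtain ⟨h1, h2⟩ := hHb s hs.1.le y hy
        have h3 := hs.1.le
        rw [abs_of_nonneg (by have := hf0 y; positivity)]
        refine mul_le_mul_of_nonneg_left (mul_le_mul ?_ h2 h1 (by linarith)) (hf0 y)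
        linarith [hs.2]
      · rw [integral_const, smul_eq_mul, measureReal_restrict_apply_univ, volume_real_Ioc_of_le hr]
        apply le_of_eq
        ring
  have e3 : ∫ y, f y * ∫ s in (0:ℝ)..r, s / 4 * H s y =
      ∫ s in (0:ℝ)..r, s / 4 * ∫ y, f y * H s y := by
    have h1 := integral_integral_swap hFub
    simp only [intervalIntegral.integral_of_le hr]
    simp only [integral_const_mul] at h1
    rw [← h1]
    congr 1
    ext s
    rw [← integral_const_mul]
    congr 1
    ext y
    ring
  have e4 : ∀ s, 0 ≤ s → ∫ y, f y * H s y =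
      ∫ z, ballWeight 2 z * ∫ y, 1 / ‖x + s • z - y‖ ^ 2 * f y := by
    intro s hs
    have h1 : Integrable (Function.uncurry fun z y : E3 =>
        ballWeight 2 z * (1 / ‖x + s • z - y‖ ^ 2 * f y)) (volume.prod volume) := by
      refine integrable_uncurry_of_le (by simp only [Function.uncurry_def]; fun_prop)
        ((integrable_riesz hf hfi x).const_mul C) ?_
      filter_upwards [E3.ae_ne x] with y hy
      have h2 := hC (x - y) (sub_ne_zero.2 hy.symm) s hs
      simp only [sub_add_eq_add_sub] at h2
      refine ⟨_, h2.1.const_mul (f y), ae_of_all _ fun z => ?_, ?_⟩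
      · rw [abs_of_nonneg (mul_nonneg (ballWeight_nonneg 2 z)
          (mul_nonneg (by positivity) (hf0 y)))]
        apply le_of_eq
        ring
      · rw [integral_const_mul]
        calc _ ≤ f y * (C * (1 / ‖x - y‖ ^ 2)) := mul_le_mul_of_nonneg_left h2.2 (hf0 y)
          _ = _ := by ring
    have h2 := integral_integral_swap h1
    simp only [integral_const_mul] at h2
    rw [h2]
    congr 1
    ext y
    rw [hH, ← integral_const_mul]
    congr 1
    ext z
    ring
  have hi1 : Integrable fun y => c * (log (‖y‖ / ‖x - y‖) * f y) := by
    have := integrable_log_kernel hf hfi 0 x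
    simp only [zero_sub, norm_neg] at this
    exact this.const_mul c
  have hi2 : Integrable fun y => f y * ∫ s in (0:ℝ)..r, s / 4 * H s y := by
    refine hFub.integral_prod_right.congr (ae_of_all _ fun y => ?_)
    simp only [Function.uncurry_apply_pair]
    rw [integral_const_mul, intervalIntegral.integral_of_le hr]
  rw [e1, integral_congr_ae e2, integral_sub hi1 hi2, integral_const_mul, e3, sub_sub_cancel_left]
  congr 1
  refine intervalIntegral.integral_congr fun s hs => ?_
  rw [Set.uIcc_of_le hr] at hs
  exact congrArg (s / 4 * ·) (e4 s hs.1)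

end potential

lemma nonpos_of_forall_mul_le {A B r₀ : ℝ} (h : ∀ r, r₀ ≤ r → A * r ≤ B) : A ≤ 0 := by
  by_contra! hA
  have h1 := h (max r₀ (|B| / A + 1)) (le_max_left _ _)
  have h2 : A * (|B| / A + 1) ≤ A * max r₀ (|B| / A + 1) :=
    mul_le_mul_of_nonneg_left (le_max_right _ _) hA.le
  have h3 : A * (|B| / A + 1) = |B| + A := by field_simp
  linarith [le_abs_self B]

lemma ballWeight_one_comp_le {q : ℝ} (hq : 1 ≤ q) {b : E3} (hb : ‖b‖ ≤ q - 1) (z : E3) :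
    ballWeight 1 (q • z + b) ≤ q ^ 2 * ballWeight 1 z := by
  have h0 := ballWeight_nonneg 1 z
  have h1 : q * ‖z‖ ≤ ‖q • z + b‖ + (q - 1) := by
    have := norm_sub_le (q • z + b) b
    rw [add_sub_cancel_right, norm_smul, norm_of_nonneg (by linarith)] at this
    linarith
  rcases le_or_gt 1 ‖q • z + b‖ with h | h
  · rw [ballWeight_eq_zero one_ne_zero h]; positivity
  · have h2 : 1 - ‖z‖ ^ 2 ≤ ballWeight 1 z := by
      rw [ballWeight, pow_one]; exact le_max_left _ _
    have h3 : ballWeight 1 (q • z + b) = 1 - ‖q • z + b‖ ^ 2 := by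
      rw [ballWeight, pow_one]
      exact max_eq_left (by nlinarith [norm_nonneg (q • z + b)])
    have h4 : (q * ‖z‖) ^ 2 ≤ (‖q • z + b‖ + (q - 1)) ^ 2 :=
      pow_le_pow_left₀ (by positivity) h1 2
    have h5 : 1 - ‖q • z + b‖ ^ 2 ≤ q ^ 2 * (1 - ‖z‖ ^ 2) := by
      nlinarith [norm_nonneg (q • z + b)]
    rw [h3]
    exact h5.trans (mul_le_mul_of_nonneg_left h2 (by positivity))

/-- Harnack's inequality from the mean value property. -/
lemma harnack_of_mean_value {N : E3 → ℝ} (hi : ∀ x, ∀ r : ℝ, 0 ≤ r →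
      Integrable fun z => ballWeight 1 z * N (x + r • z))
    (hm : ∀ x, ∀ r : ℝ, 0 ≤ r → ∫ z, ballWeight 1 z * N (x + r • z) = (∫ z, ballWeight 1 z) * N x)
    (x x' : E3) {R : ℝ} (hR : 0 < R)
    (hN : ∀ y, ‖y - x'‖ ≤ R + ‖x - x'‖ → 0 ≤ N y) :
    N x ≤ ((R + ‖x - x'‖) / R) ^ 5 * N x' := by
  set a := ‖x - x'‖ with ha
  have ha0 : 0 ≤ a := norm_nonneg _
  set q := (R + a) / R with hq
  have hq1 : 1 ≤ q := by rw [hq, le_div_iff₀ hR]; linarith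
  have hq0 : 0 < q := by linarith
  have hqR : R * q = R + a := by rw [hq]; field_simp
  set b := R⁻¹ • (x' - x) with hb
  have hbn : ‖b‖ ≤ q - 1 := by
    rw [hb, norm_smul, norm_of_nonneg (by positivity), norm_sub_rev, ← ha, hq]
    apply le_of_eq
    field_simp
    ring
  have hx : ∀ z, x + R • (q • z + b) = x' + (R + a) • z := fun z => by
    rw [smul_add, smul_smul, hqR, hb, smul_smul, mul_inv_cancel₀ hR.ne', one_smul]; abel
  have h1 : ∫ z, ballWeight 1 z * N (x + R • z) =
      q ^ 3 * ∫ z, ballWeight 1 (q • z + b) * N (x' + (R + a) • z) := by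
    have h2 := Measure.integral_comp_smul volume
      (fun z => ballWeight 1 (z + b) * N (x + R • (z + b))) q
    rw [E3.finrank_eq, integral_add_right_eq_self (fun z => ballWeight 1 z * N (x + R • z)) b,
      abs_of_pos (by positivity), smul_eq_mul] at h2
    simp only [hx] at h2
    rw [h2, mul_inv_cancel_left₀ (by positivity)]
  have h3 : ∫ z, ballWeight 1 (q • z + b) * N (x' + (R + a) • z) ≤
      q ^ 2 * ((∫ z, ballWeight 1 z) * N x') := by
    rw [← hm x' (R + a) (by linarith), ← integral_const_mul]
    have h4 : ∀ z, 0 ≤ ballWeight 1 (q • z + b) * N (x' + (R + a) • z) ∧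
        ballWeight 1 (q • z + b) * N (x' + (R + a) • z) ≤
        q ^ 2 * (ballWeight 1 z * N (x' + (R + a) • z)) := by
      intro z
      have h5 := ballWeight_one_comp_le hq1 hbn z
      have h6 := ballWeight_nonneg 1 (q • z + b)
      rcases le_or_gt 1 ‖z‖ with hz | hz
      · rw [ballWeight_eq_zero one_ne_zero hz, mul_zero] at h5
        rw [le_antisymm h5 h6, ballWeight_eq_zero one_ne_zero hz]
        simp
      · have h7 : 0 ≤ N (x' + (R + a) • z) := hN _ (by
          rw [add_sub_cancel_left, norm_smul, norm_of_nonneg (by linarith)]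
          nlinarith)
        exact ⟨mul_nonneg h6 h7, by rw [← mul_assoc]; exact mul_le_mul_of_nonneg_right h5 h7⟩
    refine integral_mono_of_nonneg (ae_of_all _ fun z => (h4 z).1)
      ((hi x' (R + a) (by linarith)).const_mul _) (ae_of_all _ fun z => (h4 z).2)
  have h8 := integral_ballWeight_pos one_ne_zero
  rw [hm x R hR.le] at h1
  have h9 : (∫ z, ballWeight 1 z) * N x ≤ (∫ z, ballWeight 1 z) * (q ^ 5 * N x') := by
    calc _ = _ := h1
      _ ≤ q ^ 3 * (q ^ 2 * ((∫ z, ballWeight 1 z) * N x')) :=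
        mul_le_mul_of_nonneg_left h3 (by positivity)
      _ = _ := by ring
  exact le_of_mul_le_mul_left h9 h8

/-- Liouville's theorem: a function with the mean value property that grows sublinearly from
above is constant. -/
lemma liouville_of_mean_value {p : E3 → ℝ} (hi : ∀ x, ∀ r : ℝ, 0 ≤ r →
      Integrable fun z => ballWeight 1 z * p (x + r • z))
    (hm : ∀ x, ∀ r : ℝ, 0 ≤ r → ∫ z, ballWeight 1 z * p (x + r • z) = (∫ z, ballWeight 1 z) * p x)
    (hp : ∀ ε : ℝ, 0 < ε → ∃ C, ∀ x, p x ≤ C + ε * ‖x‖) (x x' : E3) : p x' ≤ p x := by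
  set a := ‖x - x'‖ with ha
  have ha0 : 0 ≤ a := norm_nonneg _
  suffices h : ∀ ε : ℝ, 0 < ε → p x' - p x ≤ ε * (31 * a) by
    by_contra! hlt
    have h1 := h ((p x' - p x) / (2 * (31 * a + 1))) (by
      have : 0 < p x' - p x := by linarith
      positivity)
    rw [div_mul_eq_mul_div, le_div_iff₀ (by positivity)] at h1
    nlinarith
  intro ε hε
  obtain ⟨C, hC⟩ := hp ε hε
  set B := C + ε * (‖x'‖ + a) - p x' with hB
  suffices h : p x' - p x - ε * (31 * a) ≤ 0 by linarith
  refine nonpos_of_forall_mul_le (r₀ := 1 + a) (B := 31 * a * B) fun R hR => ?_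
  have hR0 : 0 < R := by linarith
  set L := C + ε * (‖x'‖ + (R + a)) with hL
  have h1 := harnack_of_mean_value (N := fun y => L - p y) (fun y r hr => by
      simp only [mul_sub]
      exact ((integrable_ballWeight one_ne_zero).mul_const L).sub (hi y r hr))
    (fun y r hr => by
      simp only [mul_sub]
      rw [integral_sub ((integrable_ballWeight one_ne_zero).mul_const L) (hi y r hr),
        integral_mul_const, hm y r hr]) x x' hR0 (fun y hy => by
      have h2 : ‖y‖ ≤ ‖x'‖ + (R + a) := by
        have := norm_sub_norm_le y x'
        linarith
      have h3 := hC y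
      have h4 := mul_le_mul_of_nonneg_left h2 hε.le
      simp only [hL]
      linarith)
  simp only [← ha] at h1
  have hLB : L - p x' = B + ε * R := by rw [hL, hB]; ring
  have hL0 : 0 ≤ L - p x' := by
    have h3 := hC x'
    have : 0 ≤ ε * (R + a) := by positivity
    simp only [hL]; linarith
  have h5 : ((R + a) / R) ^ 5 ≤ 1 + 31 * (a / R) := by
    have e : (R + a) / R = 1 + a / R := by field_simp
    have t0 : 0 ≤ a / R := by positivity
    have t1 : a / R ≤ 1 := by rw [div_le_one hR0]; linarith
    rw [e]
    generalize a / R = t at t0 t1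
    have h2 : t ^ 2 ≤ t := by nlinarith
    have h3 : t ^ 3 ≤ t := by nlinarith
    have h4 : t ^ 4 ≤ t := by nlinarith
    have h6 : t ^ 5 ≤ t := by nlinarith
    have : (1 + t) ^ 5 = 1 + 5 * t + 10 * t ^ 2 + 10 * t ^ 3 + 5 * t ^ 4 + t ^ 5 := by ring
    linarith
  have h6 : p x' - p x ≤ 31 * (a / R) * (B + ε * R) := by
    have h7 := h1.trans (mul_le_mul_of_nonneg_right h5 hL0)
    rw [hLB] at h7
    have h8 : L - p x = (p x' - p x) + (B + ε * R) := by rw [← hLB]; ring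
    rw [h8] at h7
    linarith
  have h9 := mul_le_mul_of_nonneg_right h6 hR0.le
  have h10 : 31 * (a / R) * (B + ε * R) * R = 31 * a * B + ε * (31 * a) * R := by
    field_simp
  linarith

section representation

variable {u : E3 → ℝ} (hu : ContDiff ℝ (⊤ : ℕ∞) u) (hi : Integrable fun x => exp (3 * u x))
include hu

lemma continuous_exp_three_mul : Continuous fun x => exp (3 * u x) := by
  have := hu.continuous; fun_prop

include hi

lemma exists_integrable_ballWeight_solV : ∃ K, 0 ≤ K ∧ ∀ r : ℝ, 0 ≤ r →
    (∀ x, Integrable fun z => ballWeight 1 z * solV u (x + r • z)) ∧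
    |∫ z, ballWeight 1 z * solV u (r • z)| ≤ K * r := by
  obtain ⟨K, hK0, hK⟩ := exists_integrable_ballWeight_log (continuous_exp_three_mul hu) hi
    (fun y => (exp_pos _).le)
  refine ⟨1 / π ^ 2 * K, by positivity, fun r hr => ⟨fun x => ?_, ?_⟩⟩
  · refine (((hK r hr).1 x).integral_prod_left.const_mul (1 / π ^ 2)).congr (ae_of_all _ fun z => ?_)
    simp only [Function.uncurry_apply_pair, integral_const_mul, solV]
    ring
  · have : ∫ z, ballWeight 1 z * solV u (r • z) = 1 / π ^ 2 *
        ∫ z, ballWeight 1 z * ∫ y, log (‖y‖ / ‖r • z - y‖) * exp (3 * u y) := by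
      rw [← integral_const_mul]
      congr 1
      ext z
      rw [solV]; ring
    rw [this, abs_mul, abs_of_pos (by positivity), mul_assoc]
    exact mul_le_mul_of_nonneg_left (hK r hr).2 (by positivity)

/-- Averaged mean value formula for `u - v` when `-Δu` is a Riesz potential up to a constant. -/
lemma integral_ballWeight_sub_solV {C₀ : ℝ}
    (hlap : ∀ x, -lap u x = 1 / π ^ 2 * (∫ y, 1 / ‖x - y‖ ^ 2 * exp (3 * u y)) + C₀)
    (x : E3) {r : ℝ} (hr : 0 ≤ r) :
    ∫ z, ballWeight 1 z * (u (x + r • z) - solV u (x + r • z)) =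
      (∫ z, ballWeight 1 z) * (u x - solV u x) - C₀ * (∫ z, ballWeight 2 z) * (r ^ 2 / 8) := by
  obtain ⟨K, hK0, hK⟩ := exists_integrable_ballWeight_solV hu hi
  set c₁ := ∫ z, ballWeight 1 z with hc₁
  set c₂ := ∫ z, ballWeight 2 z with hc₂
  have h1 := integral_ballWeight_sub hu x r
  have h2 := integral_ballWeight_log_potential_sub (continuous_exp_three_mul hu) hi
    (fun y => (exp_pos _).le) x hr
  have hlc := continuous_lap hu
  have e1 : ∫ z, ballWeight 1 z * solV u (x + r • z) = 1 / π ^ 2 *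
      ∫ z, ballWeight 1 z * ∫ y, log (‖y‖ / ‖x + r • z - y‖) * exp (3 * u y) := by
    rw [← integral_const_mul]
    congr 1
    ext z
    rw [solV]; ring
  have e2 : ∀ s : ℝ, ∫ z, ballWeight 2 z * ∫ y, 1 / ‖x + s • z - y‖ ^ 2 * exp (3 * u y) =
      -(π ^ 2 * ((∫ z, ballWeight 2 z * lap u (x + s • z)) + C₀ * c₂)) := by
    intro s
    have hw : ∀ y, ∫ z, 1 / ‖y - z‖ ^ 2 * exp (3 * u z) = -(π ^ 2 * (lap u y + C₀)) := by
      intro y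
      have h3 := hlap y
      have h4 : π ^ 2 * (1 / π ^ 2) = 1 := by field_simp
      linear_combination (-π ^ 2) * h3 - (∫ z, 1 / ‖y - z‖ ^ 2 * exp (3 * u z)) * h4
    simp only [hw]
    have h4 : Integrable fun z => ballWeight 2 z * lap u (x + s • z) :=
      integrable_ballWeight_mul two_ne_zero (hlc.comp (by fun_prop))
    have h5 : Integrable fun z => C₀ * ballWeight 2 z :=
      (integrable_ballWeight two_ne_zero).const_mul C₀
    rw [hc₂, ← integral_const_mul, ← integral_add h4 h5, ← integral_const_mul, ← integral_neg]
    congr 1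
    ext z
    ring
  have e3 : ∫ s in (0:ℝ)..r, s / 4 * ∫ z, ballWeight 2 z * ∫ y, 1 / ‖x + s • z - y‖ ^ 2 *
      exp (3 * u y) = -(π ^ 2 * ((∫ s in (0:ℝ)..r, s / 4 * ∫ z, ballWeight 2 z *
        lap u (x + s • z)) + C₀ * c₂ * (r ^ 2 / 8))) := by
    have hc : Continuous fun s : ℝ => s / 4 * ∫ z, ballWeight 2 z * lap u (x + s • z) := by
      refine (by fun_prop : Continuous fun s : ℝ => s / 4).mul ?_
      simp_rw [← setIntegral_ballWeight_mul two_ne_zero]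
      refine continuous_parametric_integral_of_continuous ?_ (isCompact_closedBall _ _)
      have h2 := continuous_ballWeight 2
      simp only [Function.uncurry_def]
      fun_prop
    have e4 : ∫ s in (0:ℝ)..r, C₀ * c₂ * (s / 4) = C₀ * c₂ * (r ^ 2 / 8) := by
      rw [intervalIntegral.integral_const_mul, intervalIntegral.integral_div, integral_id]
      ring
    rw [← e4, ← intervalIntegral.integral_add (hc.intervalIntegrable _ _)
      (Continuous.intervalIntegrable (by fun_prop) _ _), ← intervalIntegral.integral_const_mul,
      ← intervalIntegral.integral_neg]
    congr 1
    ext s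
    rw [e2]
    ring
  rw [e3] at h2
  have e5 : solV u x = 1 / π ^ 2 * ∫ y, log (‖y‖ / ‖x - y‖) * exp (3 * u y) := rfl
  simp only [mul_sub]
  have hiu : Integrable fun z => ballWeight 1 z * u (x + r • z) :=
    integrable_ballWeight_mul one_ne_zero (hu.continuous.comp (by fun_prop))
  rw [integral_sub hiu ((hK r hr).1 x), e1, e5]
  have h6 : 1 / π ^ 2 * π ^ 2 = 1 := by field_simp
  linear_combination h1 - 1 / π ^ 2 * h2 -
    ((∫ s in (0:ℝ)..r, s / 4 * ∫ z, ballWeight 2 z * lap u (x + s • z)) + C₀ * c₂ * (r ^ 2 / 8)) * h6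

/-- If `-Δu` is the Riesz potential of `e^{3u}`, then `u - v` is constant. -/
lemma exists_sub_solV_const
    (hlap : ∀ x, -lap u x = 1 / π ^ 2 * ∫ y, 1 / ‖x - y‖ ^ 2 * exp (3 * u y)) :
    ∃ c, ∀ x, u x - solV u x = c := by
  obtain ⟨K, hK0, hK⟩ := exists_integrable_ballWeight_solV hu hi
  have hfc := continuous_exp_three_mul hu
  set c₁ := ∫ z, ballWeight 1 z with hc₁
  have hc₁0 : 0 < c₁ := integral_ballWeight_pos one_ne_zero
  set m := ∫ y, exp (3 * u y) with hm
  have hm0 : 0 ≤ m := integral_nonneg fun y => (exp_pos _).le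
  set p : E3 → ℝ := fun x => u x - solV u x with hp
  have hpi : ∀ x, ∀ r : ℝ, 0 ≤ r → Integrable fun z => ballWeight 1 z * p (x + r • z) := by
    intro x r hr
    simp only [hp, mul_sub]
    exact (integrable_ballWeight_mul one_ne_zero (hu.continuous.comp (by fun_prop))).sub
      ((hK r hr).1 x)
  have hpm : ∀ x, ∀ r : ℝ, 0 ≤ r → ∫ z, ballWeight 1 z * p (x + r • z) = c₁ * p x := by
    intro x r hr
    have h := integral_ballWeight_sub_solV hu hi (C₀ := 0) (by simpa using hlap) x hr
    rw [zero_mul, zero_mul, sub_zero] at h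
    exact h
  obtain ⟨D, hD⟩ : ∃ D, ∀ x, p x ≤ exp (3 * u x) / 3 + 1 / π ^ 2 * m * log (1 + ‖x‖) + D := by
    refine ⟨1 / π ^ 2 * ∫ y, 1 / ‖0 - y‖ * exp (3 * u y), fun x => ?_⟩
    have h1 := le_log_potential hfc hi (fun y => (exp_pos _).le) x
    simp only [zero_sub, norm_neg] at h1 ⊢
    have h2 := mul_le_mul_of_nonneg_left h1 (by positivity : 0 ≤ 1 / π ^ 2)
    have h3 : u x ≤ exp (3 * u x) / 3 := by linarith [add_one_le_exp (3 * u x)]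
    simp only [hp, solV]
    rw [← hm] at h2
    linarith
  have hp1 : ∀ x, c₁ * p x ≤ m / 3 + c₁ * (1 / π ^ 2 * m * log (2 + ‖x‖) + D) := by
    intro x
    rw [← hpm x 1 zero_le_one]
    have hi1 : Integrable fun z => exp (3 * u (x + z)) / 3 := (hi.comp_add_left x).div_const 3
    have hi2 : Integrable fun z => ballWeight 1 z * (1 / π ^ 2 * m * log (2 + ‖x‖) + D) :=
      (integrable_ballWeight one_ne_zero).mul_const _
    have e : m / 3 + c₁ * (1 / π ^ 2 * m * log (2 + ‖x‖) + D) =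
        ∫ z, (exp (3 * u (x + z)) / 3 +
          ballWeight 1 z * (1 / π ^ 2 * m * log (2 + ‖x‖) + D)) := by
      rw [integral_add hi1 hi2, integral_mul_const, integral_div,
        integral_add_left_eq_self (fun z => exp (3 * u z)) x]
    rw [e]
    refine integral_mono (hpi x 1 zero_le_one) (hi1.add hi2) fun z => ?_
    have hw := ballWeight_nonneg 1 z
    have hw1 := ballWeight_le_one 1 z
    have hf0 := exp_pos (3 * u (x + z))
    simp only [one_smul]
    rcases le_or_gt 1 ‖z‖ with hz | hz
    · rw [ballWeight_eq_zero one_ne_zero hz]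
      simp only [zero_mul, add_zero]
      positivity
    · have h1 := hD (x + z)
      have h2 : log (1 + ‖x + z‖) ≤ log (2 + ‖x‖) :=
        log_le_log (by positivity) (by linarith [norm_add_le x z])
      have h3 : p (x + z) ≤ exp (3 * u (x + z)) / 3 + (1 / π ^ 2 * m * log (2 + ‖x‖) + D) := by
        have := mul_le_mul_of_nonneg_left h2 (by positivity : 0 ≤ 1 / π ^ 2 * m)
        linarith
      have h4 := mul_le_mul_of_nonneg_left h3 hw
      have h5 : ballWeight 1 z * (exp (3 * u (x + z)) / 3) ≤ exp (3 * u (x + z)) / 3 :=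
        mul_le_of_le_one_left (by positivity) hw1
      linarith
  have hsub : ∀ ε : ℝ, 0 < ε → ∃ C, ∀ x, p x ≤ C + ε * ‖x‖ := by
    intro ε hε
    set A := 1 / π ^ 2 * m with hA
    have hA0 : 0 ≤ A := by positivity
    set δ := ε / (A + 1) with hδ
    have hδ0 : 0 < δ := by positivity
    refine ⟨m / 3 / c₁ + (A * (2 * δ - 1 - log δ) + D), fun x => ?_⟩
    have h1 : log (2 + ‖x‖) ≤ δ * ‖x‖ + (2 * δ - 1 - log δ) := by
      have h2 := log_le_sub_one_of_pos (show 0 < δ * (2 + ‖x‖) by positivity)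
      rw [log_mul hδ0.ne' (by positivity)] at h2
      linarith
    have h3 := mul_le_mul_of_nonneg_left h1 hA0
    have h4 : A * δ ≤ ε := by
      rw [hδ, mul_div_assoc', div_le_iff₀ (by positivity)]
      nlinarith
    have h5 := mul_le_mul_of_nonneg_right h4 (norm_nonneg x)
    have h6 : p x ≤ m / 3 / c₁ + (A * log (2 + ‖x‖) + D) := by
      have h7 := hp1 x
      rw [← mul_le_mul_iff_right₀ hc₁0]
      have : c₁ * (m / 3 / c₁ + (A * log (2 + ‖x‖) + D)) =
        m / 3 + c₁ * (A * log (2 + ‖x‖) + D) := by field_simp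
      rw [this]
      exact h7
    linarith
  exact ⟨p 0, fun x => le_antisymm (liouville_of_mean_value hpi hpm hsub 0 x)
    (liouville_of_mean_value hpi hpm hsub x 0)⟩

/-- Subquadratic growth of `u` forces the additive constant in `-Δu` to vanish. -/
lemma const_eq_zero_of_tendsto_div_norm_sq {C₀ : ℝ}
    (hlap : ∀ x, -lap u x = 1 / π ^ 2 * (∫ y, 1 / ‖x - y‖ ^ 2 * exp (3 * u y)) + C₀)
    (ht : Tendsto (fun x : E3 => u x / ‖x‖ ^ 2) (comap (fun x : E3 => ‖x‖) atTop) (𝓝 0)) :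
    C₀ = 0 := by
  obtain ⟨K, hK0, hK⟩ := exists_integrable_ballWeight_solV hu hi
  set c₁ := ∫ z, ballWeight 1 z with hc₁
  have hc₁0 : 0 < c₁ := integral_ballWeight_pos one_ne_zero
  set c₂ := ∫ z, ballWeight 2 z with hc₂
  have hc₂0 : 0 < c₂ := integral_ballWeight_pos two_ne_zero
  have hgrowth : ∀ ε : ℝ, 0 < ε → ∃ B, 0 ≤ B ∧ ∀ x, |u x| ≤ ε * ‖x‖ ^ 2 + B := by
    intro ε hε
    have h1 : ∀ᶠ x : E3 in comap (fun x : E3 => ‖x‖) atTop, |u x / ‖x‖ ^ 2| ≤ ε := by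
      have := (tendsto_order.1 ht.abs).2 ε (by simpa using hε)
      exact this.mono fun x hx => hx.le
    obtain ⟨R, hR⟩ := (eventually_atTop.1 (eventually_comap.1 h1))
    obtain ⟨B, hB⟩ := (isCompact_closedBall (0 : E3) (max R 1)).exists_bound_of_continuousOn
      hu.continuous.continuousOn
    refine ⟨max B 0, le_max_right _ _, fun x => ?_⟩
    rcases le_or_gt ‖x‖ (max R 1) with hx | hx
    · have h2 := hB x (mem_closedBall_zero_iff.2 hx)
      rw [norm_eq_abs] at h2
      have : 0 ≤ ε * ‖x‖ ^ 2 := by positivity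
      linarith [le_max_left B 0]
    · have h2 := hR ‖x‖ (le_trans (le_max_left _ _) hx.le) x rfl
      have h3 : 0 < ‖x‖ := by linarith [le_max_right R 1]
      rw [abs_div, abs_of_pos (by positivity : 0 < ‖x‖ ^ 2), div_le_iff₀ (by positivity)] at h2
      linarith [le_max_right B 0]
  have key : ∀ ε : ℝ, 0 < ε → |C₀| * c₂ / 8 ≤ c₁ * ε := by
    intro ε hε
    obtain ⟨B, hB0, hB⟩ := hgrowth ε hε
    suffices h : |C₀| * c₂ / 8 - c₁ * ε ≤ 0 by linarith
    set P := |c₁ * (u 0 - solV u 0)| with hP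
    refine nonpos_of_forall_mul_le (r₀ := 1) (B := P + c₁ * B + K) fun r hr => ?_
    have hr0 : 0 ≤ r := by linarith
    have h1 := integral_ballWeight_sub_solV hu hi hlap 0 hr0
    simp only [mul_sub, zero_add] at h1
    have hiu : Integrable fun z => ballWeight 1 z * u (r • z) :=
      integrable_ballWeight_mul one_ne_zero (hu.continuous.comp (by fun_prop))
    rw [integral_sub hiu (by simpa using (hK r hr0).1 0)] at h1
    have h2 := (hK r hr0).2
    have h3 : |∫ z, ballWeight 1 z * u (r • z)| ≤ c₁ * (ε * r ^ 2 + B) := by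
      rw [← norm_eq_abs, hc₁, ← integral_mul_const]
      refine norm_integral_le_of_norm_le ((integrable_ballWeight one_ne_zero).mul_const _)
        (ae_of_all _ fun z => ?_)
      rw [norm_mul, norm_of_nonneg (ballWeight_nonneg 1 z)]
      rcases le_or_gt 1 ‖z‖ with hz | hz
      · rw [ballWeight_eq_zero one_ne_zero hz]; simp
      · refine mul_le_mul_of_nonneg_left ((hB _).trans ?_) (ballWeight_nonneg 1 z)
        rw [norm_smul, norm_of_nonneg hr0]
        have : (r * ‖z‖) ^ 2 ≤ r ^ 2 := pow_le_pow_left₀ (by positivity) (by nlinarith) 2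
        nlinarith
    have h4 : |C₀| * c₂ * (r ^ 2 / 8) = |C₀ * c₂ * (r ^ 2 / 8)| := by
      rw [abs_mul, abs_mul, abs_of_pos hc₂0, abs_of_nonneg (by positivity : 0 ≤ r ^ 2 / 8)]
    have h5 : C₀ * c₂ * (r ^ 2 / 8) = c₁ * (u 0 - solV u 0) -
        ((∫ z, ballWeight 1 z * u (r • z)) - ∫ z, ballWeight 1 z * solV u (r • z)) := by
      linarith
    have h6 : |C₀| * c₂ * (r ^ 2 / 8) ≤ P + (c₁ * (ε * r ^ 2 + B) + K * r) := by
      rw [h4, h5]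
      refine (abs_sub _ _).trans ?_
      have := abs_sub (∫ z, ballWeight 1 z * u (r • z)) (∫ z, ballWeight 1 z * solV u (r • z))
      linarith
    have hPB : 0 ≤ P + c₁ * B := by positivity
    have h7 : (|C₀| * c₂ / 8 - c₁ * ε) * r * r ≤ (P + c₁ * B + K) * r := by nlinarith
    exact le_of_mul_le_mul_right h7 (by linarith)
  by_contra hne
  have hpos : 0 < |C₀| * c₂ / 8 := by have := abs_pos.2 hne; positivity
  have h := key (|C₀| * c₂ / 8 / (2 * c₁)) (by positivity)
  have : c₁ * (|C₀| * c₂ / 8 / (2 * c₁)) = |C₀| * c₂ / 8 / 2 := by field_simp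
  linarith

end representation

/-- The symmetric second difference of `φ` at `x` in the direction `h`. -/
noncomputable def secondDiff (φ : E3 → ℝ) (x h : E3) : ℝ := 2 * φ x - φ (x + h) - φ (x - h)

lemma abs_secondDiff_inv_le {M : ℝ} {x : E3} (hM : 0 < M) (hx : ‖x‖ ≤ M) (z : E3) :
    |secondDiff (fun z => 1 / (M ^ 2 + ‖z‖ ^ 2)) z x| ≤
      6 * ‖x‖ ^ 2 * (1 / (M ^ 2 + ‖z + x‖ ^ 2) ^ 2 + 1 / (M ^ 2 + ‖z - x‖ ^ 2) ^ 2) := by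
  have e1 := norm_add_sq_real z x
  have e2 := norm_sub_sq_real z x
  have hcs := abs_real_inner_le_norm z x
  have p1 : 0 < M ^ 2 + ‖z + x‖ ^ 2 := by positivity
  have p2 : 0 < M ^ 2 + ‖z - x‖ ^ 2 := by positivity
  have pc : 0 < M ^ 2 + ‖z‖ ^ 2 := by positivity
  have hxM : ‖x‖ ^ 2 ≤ M ^ 2 := by gcongr
  simp only [secondDiff]
  set b := inner ℝ z x
  have hb : b ^ 2 ≤ ‖z‖ ^ 2 * ‖x‖ ^ 2 := by
    rw [← mul_pow]; exact sq_le_sq' (by linarith [neg_abs_le b]) (by linarith [le_abs_self b])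
  set P := M ^ 2 + ‖z + x‖ ^ 2 with hP
  set Q := M ^ 2 + ‖z - x‖ ^ 2 with hQ
  set c := M ^ 2 + ‖z‖ ^ 2 with hc
  set q := ‖x‖ ^ 2 with hq
  have hq0 : 0 ≤ q := by positivity
  have hPc : P = c + q + 2 * b := by rw [hP, e1, hc, hq]; ring
  have hQc : Q = c + q - 2 * b := by rw [hQ, e2, hc, hq]; ring
  have hqc : q ≤ c := by nlinarith [sq_nonneg ‖z‖]
  have hbc : b ^ 2 ≤ c * q := hb.trans (by gcongr; nlinarith [sq_nonneg M])
  clear_value P Q c q b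
  have key : 2 * (1 / c) - 1 / P - 1 / Q = (2 * (c + q) * q - 8 * b ^ 2) / (c * P * Q) := by
    have : P * Q = (c + q) ^ 2 - 4 * b ^ 2 := by rw [hPc, hQc]; ring
    field_simp
    nlinarith
  rw [key, abs_div, abs_of_pos (by positivity : 0 < c * P * Q)]
  have hn : |2 * (c + q) * q - 8 * b ^ 2| ≤ 8 * c * q := by
    rw [abs_le]; constructor <;> nlinarith [sq_nonneg b, mul_nonneg hq0 pc.le]
  have hPQ : 2 / (P * Q) ≤ 1 / P ^ 2 + 1 / Q ^ 2 := by
    have : 0 ≤ (1 / P - 1 / Q) ^ 2 := sq_nonneg _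
    have e : (1 / P - 1 / Q) ^ 2 = 1 / P ^ 2 + 1 / Q ^ 2 - 2 / (P * Q) := by field_simp; ring
    linarith
  calc _ ≤ 8 * c * q / (c * P * Q) := by gcongr
    _ = 4 * q * (2 / (P * Q)) := by field_simp; ring
    _ ≤ 4 * q * (1 / P ^ 2 + 1 / Q ^ 2) := by gcongr
    _ ≤ _ := by
      have : 0 ≤ q * (1 / P ^ 2 + 1 / Q ^ 2) := by positivity
      linarith

lemma integrable_secondDiff_inv_of_le {M : ℝ} {x : E3} (hM : 0 < M) (hx : ‖x‖ ≤ M) :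
    Integrable (fun z => secondDiff (fun z => 1 / (M ^ 2 + ‖z‖ ^ 2)) z x) ∧
      |∫ z, secondDiff (fun z => 1 / (M ^ 2 + ‖z‖ ^ 2)) z x| ≤ 12 * ‖x‖ ^ 2 * π ^ 2 / M := by
  obtain ⟨hi, hv⟩ := radial_inv_sq hM
  have h1 := hi.comp_add_right x
  have h2 := hi.comp_sub_right x
  have hb := (h1.add h2).const_mul (6 * ‖x‖ ^ 2)
  have hm : Continuous (fun z => secondDiff (fun z => 1 / (M ^ 2 + ‖z‖ ^ 2)) z x) := by
    unfold secondDiff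
    have : ∀ z : E3, M ^ 2 + ‖z‖ ^ 2 ≠ 0 := fun z => by positivity
    fun_prop (disch := intros; positivity)
  refine ⟨hb.mono' hm.aestronglyMeasurable (.of_forall fun z => ?_), ?_⟩
  · rw [norm_eq_abs]; exact abs_secondDiff_inv_le hM hx z
  · rw [← norm_eq_abs]
    refine (norm_integral_le_of_norm_le hb (.of_forall fun z => ?_)).trans ?_
    · rw [norm_eq_abs]; exact abs_secondDiff_inv_le hM hx z
    · simp only [Pi.add_apply]
      rw [integral_const_mul, integral_add h1 h2,
        integral_add_right_eq_self (fun z : E3 => 1 / (M ^ 2 + ‖z‖ ^ 2) ^ 2),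
        integral_sub_right_eq_self (fun z : E3 => 1 / (M ^ 2 + ‖z‖ ^ 2) ^ 2), hv]
      apply le_of_eq; ring

lemma integrable_inv_sub_inv {t M : ℝ} (ht : 0 < t) (hM : t ≤ M) :
    Integrable (fun z : E3 => 1 / (t ^ 2 + ‖z‖ ^ 2) - 1 / (M ^ 2 + ‖z‖ ^ 2)) := by
  obtain ⟨hi, -⟩ := radial_inv_sq ht
  have hM0 : 0 < M := ht.trans_le hM
  have hm : Continuous (fun z : E3 => 1 / (t ^ 2 + ‖z‖ ^ 2) - 1 / (M ^ 2 + ‖z‖ ^ 2)) := by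
    fun_prop (disch := intros; positivity)
  refine (hi.const_mul (M ^ 2 - t ^ 2)).mono' hm.aestronglyMeasurable (.of_forall fun z => ?_)
  have p1 : 0 < t ^ 2 + ‖z‖ ^ 2 := by positivity
  have p2 : 0 < M ^ 2 + ‖z‖ ^ 2 := by positivity
  have h0 : t ^ 2 ≤ M ^ 2 := by gcongr
  have e : 1 / (t ^ 2 + ‖z‖ ^ 2) - 1 / (M ^ 2 + ‖z‖ ^ 2) =
      (M ^ 2 - t ^ 2) * (1 / ((t ^ 2 + ‖z‖ ^ 2) * (M ^ 2 + ‖z‖ ^ 2))) := by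
    field_simp; ring
  rw [e, norm_eq_abs, abs_mul, abs_of_nonneg (by linarith : 0 ≤ M ^ 2 - t ^ 2),
    abs_of_pos (by positivity : 0 < 1 / ((t ^ 2 + ‖z‖ ^ 2) * (M ^ 2 + ‖z‖ ^ 2)))]
  have : 0 ≤ M ^ 2 - t ^ 2 := by linarith
  rw [sq (t ^ 2 + ‖z‖ ^ 2)]
  gcongr

lemma integral_secondDiff_inv {t : ℝ} (ht : 0 < t) (x : E3) :
    Integrable (fun z => secondDiff (fun z => 1 / (t ^ 2 + ‖z‖ ^ 2)) z x) ∧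
      ∫ z, secondDiff (fun z => 1 / (t ^ 2 + ‖z‖ ^ 2)) z x = 0 := by
  have key : ∀ M, t ≤ M → ‖x‖ ≤ M →
      Integrable (fun z => secondDiff (fun z => 1 / (t ^ 2 + ‖z‖ ^ 2)) z x) ∧
      |∫ z, secondDiff (fun z => 1 / (t ^ 2 + ‖z‖ ^ 2)) z x| ≤ 12 * ‖x‖ ^ 2 * π ^ 2 / M := by
    intro M htM hxM
    obtain ⟨h1, h2⟩ := integrable_secondDiff_inv_of_le (ht.trans_le htM) hxM
    have hd := integrable_inv_sub_inv ht htM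
    have hd1 := hd.comp_add_right x
    have hd2 := hd.comp_sub_right x
    have hd0 := hd.const_mul 2
    have e : (fun z => secondDiff (fun z => 1 / (t ^ 2 + ‖z‖ ^ 2)) z x) = fun z =>
        secondDiff (fun z => 1 / (M ^ 2 + ‖z‖ ^ 2)) z x +
        (2 * (1 / (t ^ 2 + ‖z‖ ^ 2) - 1 / (M ^ 2 + ‖z‖ ^ 2)) -
          (1 / (t ^ 2 + ‖z + x‖ ^ 2) - 1 / (M ^ 2 + ‖z + x‖ ^ 2)) -
          (1 / (t ^ 2 + ‖z - x‖ ^ 2) - 1 / (M ^ 2 + ‖z - x‖ ^ 2))) := by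
      ext z; unfold secondDiff; ring
    have h3 : Integrable fun z => 2 * (1 / (t ^ 2 + ‖z‖ ^ 2) - 1 / (M ^ 2 + ‖z‖ ^ 2)) -
          (1 / (t ^ 2 + ‖z + x‖ ^ 2) - 1 / (M ^ 2 + ‖z + x‖ ^ 2)) := hd0.sub hd1
    rw [e]
    have h4 : Integrable fun z => 2 * (1 / (t ^ 2 + ‖z‖ ^ 2) - 1 / (M ^ 2 + ‖z‖ ^ 2)) -
          (1 / (t ^ 2 + ‖z + x‖ ^ 2) - 1 / (M ^ 2 + ‖z + x‖ ^ 2)) -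
          (1 / (t ^ 2 + ‖z - x‖ ^ 2) - 1 / (M ^ 2 + ‖z - x‖ ^ 2)) := h3.sub hd2
    refine ⟨h1.add h4, ?_⟩
    rw [integral_add h1 h4, integral_sub h3 hd2, integral_sub hd0 hd1,
      integral_const_mul,
      integral_add_right_eq_self (fun z : E3 => 1 / (t ^ 2 + ‖z‖ ^ 2) - 1 / (M ^ 2 + ‖z‖ ^ 2)),
      integral_sub_right_eq_self (fun z : E3 => 1 / (t ^ 2 + ‖z‖ ^ 2) - 1 / (M ^ 2 + ‖z‖ ^ 2))]
    convert h2 using 2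
    ring
  refine ⟨(key _ (le_max_left t ‖x‖) (le_max_right _ _)).1, ?_⟩
  have hl : Tendsto (fun M : ℝ => 12 * ‖x‖ ^ 2 * π ^ 2 / M) atTop (𝓝 0) :=
    tendsto_const_nhds.div_atTop tendsto_id
  have h0 := ge_of_tendsto hl ((eventually_ge_atTop t).and (eventually_ge_atTop ‖x‖) |>.mono
    fun M hM => (key M hM.1 hM.2).2)
  exact abs_nonpos_iff.1 h0

lemma kelvin_secondDiff_inv {t R : ℝ} (ht : 0 < t) {x z : E3} (hR : 0 < R)
    (hR2 : R ^ 2 = t ^ 2 + ‖x‖ ^ 2) (hz : z ≠ 0) :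
    (R / ‖z‖) ^ 6 * (secondDiff (fun x => 1 / (t ^ 2 + ‖x‖ ^ 2)) x (kelvin R z) /
        ‖kelvin R z‖ ^ 4) =
      1 / R ^ 4 * (2 * t ^ 2 * (1 / (‖z‖ ^ 2 * (t ^ 2 + ‖z‖ ^ 2))) +
        secondDiff (fun z => 1 / (t ^ 2 + ‖z‖ ^ 2)) z x) := by
  have hz' : 0 < ‖z‖ := norm_pos_iff.2 hz
  have hp : t ^ 2 + ‖x + kelvin R z‖ ^ 2 = R ^ 2 / ‖z‖ ^ 2 * (t ^ 2 + ‖z + x‖ ^ 2) := by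
    rw [norm_add_sq_real, norm_add_sq_real, norm_kelvin, kelvin, inner_smul_right,
      real_inner_comm]
    field_simp
    linear_combination (-‖z‖ ^ 2 + R ^ 2) * hR2
  have hm : t ^ 2 + ‖x - kelvin R z‖ ^ 2 = R ^ 2 / ‖z‖ ^ 2 * (t ^ 2 + ‖z - x‖ ^ 2) := by
    rw [norm_sub_sq_real, norm_sub_sq_real, norm_kelvin, kelvin, inner_smul_right,
      real_inner_comm]
    field_simp
    linear_combination (-‖z‖ ^ 2 + R ^ 2) * hR2
  unfold secondDiff
  simp only
  rw [hp, hm, ← hR2, norm_kelvin]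
  have p1 : 0 < t ^ 2 + ‖z + x‖ ^ 2 := by positivity
  have p2 : 0 < t ^ 2 + ‖z - x‖ ^ 2 := by positivity
  have p3 : 0 < t ^ 2 + ‖z‖ ^ 2 := by positivity
  field_simp
  ring

/-- The half-Laplacian of `1 / (t² + |x|²)`, as an absolutely convergent integral. -/
lemma integral_secondDiff_inv_div {t : ℝ} (ht : 0 < t) (x : E3) :
    Integrable (fun h => secondDiff (fun x => 1 / (t ^ 2 + ‖x‖ ^ 2)) x h / ‖h‖ ^ 4) ∧
      ∫ h, secondDiff (fun x => 1 / (t ^ 2 + ‖x‖ ^ 2)) x h / ‖h‖ ^ 4 =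
        4 * π ^ 2 * (t / (t ^ 2 + ‖x‖ ^ 2) ^ 2) := by
  have hpos : 0 < t ^ 2 + ‖x‖ ^ 2 := by positivity
  obtain ⟨R, hR, hR2⟩ : ∃ R : ℝ, 0 < R ∧ R ^ 2 = t ^ 2 + ‖x‖ ^ 2 :=
    ⟨√(t ^ 2 + ‖x‖ ^ 2), sqrt_pos.2 hpos, sq_sqrt hpos.le⟩
  obtain ⟨h1, h2⟩ := integral_secondDiff_inv ht x
  obtain ⟨k1, k2⟩ := radial_one_div_sq_mul ht
  have k1' := k1.const_mul (2 * t ^ 2)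
  have hae : (fun z => (R / ‖z‖) ^ 6 * (secondDiff (fun x => 1 / (t ^ 2 + ‖x‖ ^ 2)) x
      (kelvin R z) / ‖kelvin R z‖ ^ 4)) =ᵐ[volume] fun z =>
      1 / R ^ 4 * (2 * t ^ 2 * (1 / (‖z‖ ^ 2 * (t ^ 2 + ‖z‖ ^ 2))) +
        secondDiff (fun z => 1 / (t ^ 2 + ‖z‖ ^ 2)) z x) :=
    (E3.ae_ne 0).mono fun z hz => kelvin_secondDiff_inv ht hR hR2 hz
  constructor
  · rw [integrable_kelvin hR.ne', integrable_congr hae]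
    exact (k1'.add h1).const_mul _
  · rw [integral_kelvin hR.ne', integral_congr_ae hae, integral_const_mul,
      integral_add k1' h1, integral_const_mul, k2, h2, ← hR2]
    field_simp
    ring

lemma one_add_pow_mul_exp_neg_le {a : ℝ} (ha : 0 < a) (N : ℕ) {r : ℝ} (hr : 0 ≤ r) :
    (1 + r) ^ N * exp (-(a * r ^ 2)) ≤ N.factorial * exp (1 + 1 / a) := by
  have h1 : (1 + r) ^ N ≤ N.factorial * exp (1 + r) := by
    have := pow_div_factorial_le_exp (1 + r) (by linarith) N
    rwa [div_le_iff₀' (by positivity)] at this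
  have h2 : r ≤ a * r ^ 2 + 1 / a := by
    have h3 : 0 ≤ a * (r - 1 / (2 * a)) ^ 2 := by positivity
    have h4 : a * (r - 1 / (2 * a)) ^ 2 = a * r ^ 2 - r + 1 / a / 4 := by field_simp; ring
    have h5 : 0 < 1 / a := by positivity
    linarith
  calc (1 + r) ^ N * exp (-(a * r ^ 2))
      ≤ N.factorial * exp (1 + r) * exp (-(a * r ^ 2)) := by gcongr
    _ = N.factorial * exp (1 + r - a * r ^ 2) := by
      rw [mul_assoc, ← exp_add, ← sub_eq_add_neg]
    _ ≤ _ := by gcongr; linarith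

/-- The Gaussian `exp (-a‖x‖²)` as a Schwartz function. -/
noncomputable def gaussianSchwartz (a : ℝ) (ha : 0 < a) : SchwartzMap E3 ℝ where
  toFun x := exp (-a * ‖x‖ ^ 2)
  smooth' := ((contDiff_const.mul (contDiff_norm_sq ℝ)).exp)
  decay' k n := by
    obtain ⟨l, C, hC, hbound⟩ :=
      (Function.hasTemperateGrowth_norm_sq E3).norm_iteratedFDeriv_le_uniform n
    refine ⟨n.factorial * (1 + a) ^ n * (1 + C) ^ n *
      ((k + l * n).factorial * exp (1 + 1 / a)), fun x => ?_⟩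
    have hx := norm_nonneg x
    have h := norm_iteratedFDeriv_comp_le (𝕜 := ℝ) (n := n) (N := (⊤ : ℕ∞))
      (g := fun r : ℝ => exp (-a * r)) (f := fun x : E3 => ‖x‖ ^ 2)
      (contDiff_const.mul contDiff_id).exp (contDiff_norm_sq ℝ) (by exact_mod_cast le_top) x
      (C := (1 + a) ^ n * exp (-(a * ‖x‖ ^ 2))) (D := (1 + C) * (1 + ‖x‖) ^ l)
      (fun i hi => by
        rw [norm_iteratedFDeriv_eq_norm_iteratedDeriv, iteratedDeriv_exp_const_mul]
        simp only [norm_mul, norm_pow, norm_neg, norm_eq_abs, abs_exp, abs_of_pos ha]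
        rw [neg_mul]
        gcongr
        calc a ^ i ≤ (1 + a) ^ i := by gcongr; linarith
          _ ≤ _ := pow_le_pow_right₀ (by linarith) hi)
      (fun i h1 hi => by
        have hD : 1 ≤ (1 + C) * (1 + ‖x‖) ^ l :=
          one_le_mul_of_one_le_of_one_le (by linarith) (one_le_pow₀ (by linarith))
        refine (hbound i hi x).trans ?_
        calc C * (1 + ‖x‖) ^ l ≤ (1 + C) * (1 + ‖x‖) ^ l := by gcongr; linarith
          _ ≤ _ := le_self_pow₀ hD (by lia))
    have he := one_add_pow_mul_exp_neg_le ha (k + l * n) hx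
    calc _ ≤ (1 + ‖x‖) ^ k * (n.factorial * ((1 + a) ^ n * exp (-(a * ‖x‖ ^ 2))) *
          ((1 + C) * (1 + ‖x‖) ^ l) ^ n) := by
          gcongr
          · linarith
          · exact h
      _ = n.factorial * (1 + a) ^ n * (1 + C) ^ n *
          ((1 + ‖x‖) ^ (k + l * n) * exp (-(a * ‖x‖ ^ 2))) := by
          rw [mul_pow, ← pow_mul, pow_add]; ring
      _ ≤ _ := by gcongr

lemma setIntegral_sub_eq_secondDiff {φ : E3 → ℝ} (hφ : Continuous φ) {K : ℝ}
    (hK : ∀ x, |φ x| ≤ K) (x : E3) {ε : ℝ} (hε : 0 < ε) :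
    ∫ y in {y : E3 | ε < ‖x - y‖}, (φ x - φ y) / ‖x - y‖ ^ 4 =
      1 / 2 * ∫ h, {h : E3 | ε < ‖h‖}.indicator (fun h => secondDiff φ x h / ‖h‖ ^ 4) h := by
  have hm : MeasurableSet {h : E3 | ε < ‖h‖} := measurableSet_lt measurable_const measurable_norm
  have hm' : MeasurableSet {y : E3 | ε < ‖x - y‖} :=
    measurableSet_lt measurable_const (by fun_prop)
  rw [← integral_indicator hm']
  set F := {y : E3 | ε < ‖x - y‖}.indicator (fun y => (φ x - φ y) / ‖x - y‖ ^ 4) with hF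
  have hFp : ∀ h, F (x + h) = {h : E3 | ε < ‖h‖}.indicator
      (fun h => (φ x - φ (x + h)) / ‖h‖ ^ 4) h := by
    intro h
    simp only [hF, Set.indicator, Set.mem_ofPred_eq, sub_add_cancel_left, norm_neg]
  have hFm : ∀ h, F (x - h) = {h : E3 | ε < ‖h‖}.indicator
      (fun h => (φ x - φ (x - h)) / ‖h‖ ^ 4) h := by
    intro h
    simp only [hF, Set.indicator, Set.mem_ofPred_eq, sub_sub_cancel]
  have hprod_int : ∀ ψ : E3 → E3, Continuous ψ → Integrable ({h : E3 | ε < ‖h‖}.indicator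
      (fun h => (φ x - φ (ψ h)) / ‖h‖ ^ 4)) := by
    intro ψ hψ
    rw [integrable_indicator_iff hm]
    refine ((radial_tail hε).const_mul (2 * K)).mono' ?_ (.of_forall fun h => ?_)
    · exact (((measurable_const.sub (hφ.comp hψ).measurable).div
        (measurable_norm.pow_const 4))).aestronglyMeasurable
    · rw [norm_div, norm_pow, norm_norm, norm_eq_abs, mul_one_div]
      gcongr
      have := abs_sub (φ x) (φ (ψ h))
      linarith [hK x, hK (ψ h)]
  have e1 : ∫ y, F y = ∫ h, {h : E3 | ε < ‖h‖}.indicator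
      (fun h => (φ x - φ (x + h)) / ‖h‖ ^ 4) h := by
    rw [← integral_add_left_eq_self F x]; simp only [hFp]
  have e2 : ∫ y, F y = ∫ h, {h : E3 | ε < ‖h‖}.indicator
      (fun h => (φ x - φ (x - h)) / ‖h‖ ^ 4) h := by
    rw [← integral_sub_left_eq_self F volume x]; simp only [hFm]
  have e3 : ∫ h, {h : E3 | ε < ‖h‖}.indicator (fun h => secondDiff φ x h / ‖h‖ ^ 4) h =
      (∫ y, F y) + ∫ y, F y := by
    nth_rewrite 1 [e1]
    rw [e2, ← integral_add (hprod_int _ (by fun_prop)) (hprod_int _ (by fun_prop))]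
    congr 1 with h
    by_cases hh : ε < ‖h‖
    · simp only [Set.indicator, Set.mem_ofPred_eq, hh, if_true, secondDiff]; ring
    · simp only [Set.indicator, Set.mem_ofPred_eq, hh, if_false, add_zero]
  rw [e3]; ring

lemma halfLap_eq_integral_secondDiff (φ : SchwartzMap E3 ℝ) {K : ℝ} (hK : ∀ x, |φ x| ≤ K)
    (x : E3) (hi : Integrable fun h => secondDiff φ x h / ‖h‖ ^ 4) :
    halfLap φ x = 1 / (2 * π ^ 2) * ∫ h, secondDiff φ x h / ‖h‖ ^ 4 := by
  have hm : ∀ ε, MeasurableSet {h : E3 | ε < ‖h‖} := fun ε =>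
    measurableSet_lt measurable_const measurable_norm
  have ht : Tendsto (fun ε => ∫ h, {h : E3 | ε < ‖h‖}.indicator
      (fun h => secondDiff φ x h / ‖h‖ ^ 4) h) (𝓝[>] (0 : ℝ))
      (𝓝 (∫ h, secondDiff φ x h / ‖h‖ ^ 4)) := by
    refine tendsto_integral_filter_of_dominated_convergence
      (fun h => ‖secondDiff φ x h / ‖h‖ ^ 4‖) (.of_forall fun ε =>
        (hi.indicator (hm ε)).aestronglyMeasurable)
      (.of_forall fun ε => .of_forall fun h => norm_indicator_le_norm_self _ _) hi.norm ?_
    filter_upwards [E3.ae_ne 0] with h hh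
    refine tendsto_const_nhds.congr' ?_
    filter_upwards [Ioo_mem_nhdsGT (norm_pos_iff.2 hh)] with ε hε
    rw [Set.indicator_of_mem]
    exact hε.2
  refine Tendsto.limUnder_eq ?_
  refine (ht.const_mul (1 / (2 * π ^ 2))).congr' ?_
  filter_upwards [self_mem_nhdsWithin] with ε hε
  rw [setIntegral_sub_eq_secondDiff φ.continuous hK x hε]
  field_simp

lemma two_mul_cosh_sub_one_le (y : ℝ) : 2 * (cosh y - 1) ≤ y ^ 2 * exp |y| := by
  have h1 : exp |y| * (2 * (cosh y - 1)) = (exp |y| - 1) ^ 2 := by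
    rw [← cosh_abs, cosh_eq, exp_neg]
    field_simp
    ring
  have h2 : exp |y| - 1 ≤ |y| * exp |y| := by
    have h3 := one_sub_le_exp_neg |y|
    rw [exp_neg, ← one_div, le_div_iff₀ (exp_pos _)] at h3
    linarith
  have h0 : 0 ≤ exp |y| - 1 := by linarith [one_le_exp (abs_nonneg y)]
  have h4 : exp |y| * (2 * (cosh y - 1)) ≤ exp |y| * (y ^ 2 * exp |y|) := by
    rw [h1, ← sq_abs y]
    calc _ ≤ (|y| * exp |y|) ^ 2 := by gcongr
      _ = _ := by ring
  exact le_of_mul_le_mul_left h4 (exp_pos _)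

lemma abs_secondDiff_gaussian_le {z h : E3} (hh : ‖h‖ ≤ (1 + ‖z‖) / 8) :
    |secondDiff (fun x => exp (-‖x‖ ^ 2)) z h| ≤
      ‖h‖ ^ 2 * ((2 + 4 * exp 1 * ‖z‖ ^ 2) * exp (-(1 / 2 * ‖z‖ ^ 2))) := by
  have hcs := abs_real_inner_le_norm z h
  have hz := norm_nonneg z
  have hn := norm_nonneg h
  simp only [secondDiff]
  rw [norm_add_sq_real, norm_sub_sq_real]
  set b := inner ℝ z h
  set r := ‖z‖
  set q := ‖h‖
  clear_value b r q
  have hb2 : |2 * b| ≤ r ^ 2 / 2 + 1 := by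
    rw [abs_mul, abs_two]
    nlinarith [sq_nonneg (r - 1 / 2), mul_le_mul_of_nonneg_left hh hz]
  have hb3 : (2 * b) ^ 2 ≤ 4 * r ^ 2 * q ^ 2 := by
    have : b ^ 2 ≤ (r * q) ^ 2 := sq_le_sq' (by linarith [neg_abs_le b]) (by linarith [le_abs_self b])
    nlinarith
  have e : 2 * exp (-r ^ 2) - exp (-(r ^ 2 + 2 * b + q ^ 2)) - exp (-(r ^ 2 - 2 * b + q ^ 2)) =
      exp (-r ^ 2) * (2 * (1 - exp (-q ^ 2)) - exp (-q ^ 2) * (2 * (cosh (2 * b) - 1))) := by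
    rw [cosh_eq]
    have e1 : exp (-(r ^ 2 + 2 * b + q ^ 2)) = exp (-r ^ 2) * exp (-q ^ 2) * exp (-(2 * b)) := by
      rw [← exp_add, ← exp_add]; ring_nf
    have e2 : exp (-(r ^ 2 - 2 * b + q ^ 2)) = exp (-r ^ 2) * exp (-q ^ 2) * exp (2 * b) := by
      rw [← exp_add, ← exp_add]; ring_nf
    rw [e1, e2]; ring
  have hc0 : 0 ≤ 2 * (cosh (2 * b) - 1) := by linarith [one_le_cosh (2 * b)]
  have hc : 2 * (cosh (2 * b) - 1) ≤ 4 * r ^ 2 * q ^ 2 * exp (r ^ 2 / 2 + 1) :=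
    (two_mul_cosh_sub_one_le _).trans (by gcongr)
  have hq1 : exp (-q ^ 2) ≤ 1 := exp_le_one_iff.2 (by nlinarith [sq_nonneg q])
  have hq2 : 1 - exp (-q ^ 2) ≤ q ^ 2 := by have := one_sub_le_exp_neg (q ^ 2); linarith
  have hq3 := exp_pos (-q ^ 2)
  rw [e, abs_mul, abs_exp]
  have h5 : |2 * (1 - exp (-q ^ 2)) - exp (-q ^ 2) * (2 * (cosh (2 * b) - 1))| ≤
      2 * q ^ 2 + 4 * r ^ 2 * q ^ 2 * exp (r ^ 2 / 2 + 1) := by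
    have h6 : exp (-q ^ 2) * (2 * (cosh (2 * b) - 1)) ≤ 4 * r ^ 2 * q ^ 2 * exp (r ^ 2 / 2 + 1) := by
      nlinarith
    have h7 : 0 ≤ exp (-q ^ 2) * (2 * (cosh (2 * b) - 1)) := by positivity
    rw [abs_le]; constructor <;> nlinarith [sq_nonneg q]
  have h8 : exp (-r ^ 2) ≤ exp (-(1 / 2 * r ^ 2)) := exp_le_exp.2 (by nlinarith [sq_nonneg r])
  have h9 : exp (-r ^ 2) * exp (r ^ 2 / 2 + 1) = exp 1 * exp (-(1 / 2 * r ^ 2)) := by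
    rw [← exp_add, ← exp_add]; ring_nf
  calc _ ≤ exp (-r ^ 2) * (2 * q ^ 2 + 4 * r ^ 2 * q ^ 2 * exp (r ^ 2 / 2 + 1)) := by gcongr
    _ = 2 * q ^ 2 * exp (-r ^ 2) +
        4 * r ^ 2 * q ^ 2 * (exp (-r ^ 2) * exp (r ^ 2 / 2 + 1)) := by ring
    _ ≤ 2 * q ^ 2 * exp (-(1 / 2 * r ^ 2)) +
        4 * r ^ 2 * q ^ 2 * (exp 1 * exp (-(1 / 2 * r ^ 2))) := by rw [h9]; gcongr
    _ = _ := by ring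

lemma one_add_pow_four_mul_abs_secondDiff_gaussian_le : ∃ C, 0 ≤ C ∧ ∀ z h : E3, h ≠ 0 →
    (1 + ‖z‖ ^ 4) * (|secondDiff (fun x => exp (-‖x‖ ^ 2)) z h| / ‖h‖ ^ 4) ≤
      C * (1 / (‖h‖ ^ 2 * (1 ^ 2 + ‖h‖ ^ 2)) + exp (-‖z + h‖ ^ 2) + exp (-‖z - h‖ ^ 2)) := by
  set K := (Nat.factorial 8 : ℝ) * exp (1 + 1 / (1 / 2)) with hK
  have hK0 : 0 < K := by positivity
  have hpoly : ∀ z : E3, (1 + ‖z‖) ^ 8 * exp (-(1 / 2 * ‖z‖ ^ 2)) ≤ K := fun z =>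
    one_add_pow_mul_exp_neg_le (by norm_num) 8 (norm_nonneg z)
  have h4 : ∀ z : E3, 1 + ‖z‖ ^ 4 ≤ (1 + ‖z‖) ^ 4 := fun z => by
    have := norm_nonneg z
    nlinarith [pow_nonneg this 2, pow_nonneg this 3]
  refine ⟨2 * (2 + 4 * exp 1) * K + 4096 + 130 * K, by positivity, fun z h hh => ?_⟩
  have hq : 0 < ‖h‖ := norm_pos_iff.2 hh
  have hz := norm_nonneg z
  set X := exp (-‖z + h‖ ^ 2) with hX
  set Y := exp (-‖z - h‖ ^ 2) with hY
  have hX0 : 0 < X := exp_pos _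
  have hY0 : 0 < Y := exp_pos _
  set H := 1 / (‖h‖ ^ 2 * (1 ^ 2 + ‖h‖ ^ 2)) with hH
  have hH0 : 0 < H := by positivity
  have e1 : 0 < exp 1 := exp_pos 1
  rcases le_total ‖h‖ ((1 + ‖z‖) / 8) with hc | hc
  · have h1 := abs_secondDiff_gaussian_le hc
    have h2 : 1 + ‖h‖ ^ 2 ≤ 2 * (1 + ‖z‖) ^ 2 := by nlinarith
    have h3 : 2 + 4 * exp 1 * ‖z‖ ^ 2 ≤ (2 + 4 * exp 1) * (1 + ‖z‖) ^ 2 := by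
      have : ‖z‖ ^ 2 ≤ (1 + ‖z‖) ^ 2 := by gcongr; linarith
      have : 1 ≤ (1 + ‖z‖) ^ 2 := one_le_pow₀ (by linarith)
      nlinarith
    calc _ ≤ (1 + ‖z‖) ^ 4 * (‖h‖ ^ 2 * ((2 + 4 * exp 1 * ‖z‖ ^ 2) *
          exp (-(1 / 2 * ‖z‖ ^ 2))) / ‖h‖ ^ 4) := by
          gcongr; exact h4 z
      _ = (1 + ‖z‖) ^ 4 * (2 + 4 * exp 1 * ‖z‖ ^ 2) * (1 + ‖h‖ ^ 2) *
          exp (-(1 / 2 * ‖z‖ ^ 2)) * H := by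
          rw [hH]; field_simp
      _ ≤ (1 + ‖z‖) ^ 4 * ((2 + 4 * exp 1) * (1 + ‖z‖) ^ 2) * (2 * (1 + ‖z‖) ^ 2) *
          exp (-(1 / 2 * ‖z‖ ^ 2)) * H := by gcongr
      _ = 2 * (2 + 4 * exp 1) * ((1 + ‖z‖) ^ 8 * exp (-(1 / 2 * ‖z‖ ^ 2))) * H := by ring
      _ ≤ 2 * (2 + 4 * exp 1) * K * H := by gcongr; exact hpoly z
      _ ≤ (2 * (2 + 4 * exp 1) * K + 4096 + 130 * K) * (H + X + Y) := by
          gcongr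
          · linarith
          · linarith
  · have h5 : |secondDiff (fun x => exp (-‖x‖ ^ 2)) z h| ≤ 2 * exp (-‖z‖ ^ 2) + X + Y := by
      simp only [secondDiff]
      rw [← hX, ← hY, abs_le]
      constructor <;> linarith [exp_pos (-‖z‖ ^ 2)]
    have h6 : (1 + ‖z‖ ^ 4) / ‖h‖ ^ 4 ≤ 4096 := by
      rw [div_le_iff₀ (by positivity)]
      calc _ ≤ (1 + ‖z‖) ^ 4 := h4 z
        _ ≤ (8 * ‖h‖) ^ 4 := by gcongr; linarith
        _ = _ := by ring
    have h7 : 1 / ‖h‖ ^ 4 ≤ 65 * H := by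
      rw [hH, mul_one_div, div_le_div_iff₀ (by positivity) (by positivity)]
      have : 1 / 8 ≤ ‖h‖ := by linarith
      have : (1 / 8) ^ 2 ≤ ‖h‖ ^ 2 := by gcongr
      nlinarith [sq_nonneg ‖h‖]
    have h8 : (1 + ‖z‖ ^ 4) * exp (-‖z‖ ^ 2) ≤ K := by
      refine le_trans ?_ (hpoly z)
      gcongr
      · exact (h4 z).trans (pow_le_pow_right₀ (by linarith) (by norm_num))
      · nlinarith [sq_nonneg ‖z‖]
    calc _ ≤ (1 + ‖z‖ ^ 4) * ((2 * exp (-‖z‖ ^ 2) + X + Y) / ‖h‖ ^ 4) := by gcongr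
      _ = 2 * ((1 + ‖z‖ ^ 4) * exp (-‖z‖ ^ 2)) * (1 / ‖h‖ ^ 4) +
          (1 + ‖z‖ ^ 4) / ‖h‖ ^ 4 * (X + Y) := by ring
      _ ≤ 2 * K * (65 * H) + 4096 * (X + Y) := by gcongr
      _ ≤ _ := by
        have : 0 ≤ 2 * (2 + 4 * exp 1) * K * (H + X + Y) := by positivity
        have : 0 ≤ 4096 * H := by positivity
        have : 0 ≤ 130 * K * (X + Y) := by positivity
        nlinarith

lemma integrable_gaussian : Integrable (fun x : E3 => exp (-‖x‖ ^ 2)) := by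
  have := (gaussianSchwartz 1 one_pos).integrable (μ := (volume : Measure E3))
  refine this.congr (.of_forall fun x => ?_)
  change exp (-1 * ‖x‖ ^ 2) = _
  rw [neg_one_mul]

lemma integrable_secondDiff_unit_gaussian : ∃ C, 0 ≤ C ∧ ∀ z : E3,
    Integrable (fun h => secondDiff (fun x => exp (-‖x‖ ^ 2)) z h / ‖h‖ ^ 4) ∧
    ∫ h, |secondDiff (fun x => exp (-‖x‖ ^ 2)) z h / ‖h‖ ^ 4| ≤ C / (1 + ‖z‖ ^ 4) := by
  obtain ⟨C, hC, hb⟩ := one_add_pow_four_mul_abs_secondDiff_gaussian_le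
  refine ⟨C * (2 * π ^ 2 / 1 + (∫ x : E3, exp (-‖x‖ ^ 2)) + ∫ x : E3, exp (-‖x‖ ^ 2)),
    by positivity, fun z => ?_⟩
  obtain ⟨k1, k2⟩ := radial_one_div_sq_mul one_pos
  have g1 : Integrable fun h => exp (-‖z + h‖ ^ 2) := integrable_gaussian.comp_add_left z
  have g2 : Integrable fun h => exp (-‖z - h‖ ^ 2) := integrable_gaussian.comp_sub_left z
  have k3 : Integrable fun h => 1 / (‖h‖ ^ 2 * (1 ^ 2 + ‖h‖ ^ 2)) + exp (-‖z + h‖ ^ 2) :=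
    k1.add g1
  have hD : Integrable fun h => 1 / (1 + ‖z‖ ^ 4) *
      (C * (1 / (‖h‖ ^ 2 * (1 ^ 2 + ‖h‖ ^ 2)) + exp (-‖z + h‖ ^ 2) + exp (-‖z - h‖ ^ 2))) :=
    ((k3.add g2).const_mul C).const_mul _
  have hm : Measurable fun h => secondDiff (fun x => exp (-‖x‖ ^ 2)) z h / ‖h‖ ^ 4 := by
    unfold secondDiff; fun_prop
  have hp : 0 < 1 + ‖z‖ ^ 4 := by positivity
  have hle : ∀ᵐ h, ‖secondDiff (fun x => exp (-‖x‖ ^ 2)) z h / ‖h‖ ^ 4‖ ≤ 1 / (1 + ‖z‖ ^ 4) *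
      (C * (1 / (‖h‖ ^ 2 * (1 ^ 2 + ‖h‖ ^ 2)) + exp (-‖z + h‖ ^ 2) + exp (-‖z - h‖ ^ 2))) := by
    filter_upwards [E3.ae_ne 0] with h hh
    rw [norm_eq_abs, abs_div, abs_of_nonneg (by positivity : 0 ≤ ‖h‖ ^ 4), one_div,
      ← div_eq_inv_mul, le_div_iff₀' hp]
    exact hb z h hh
  refine ⟨hD.mono' hm.aestronglyMeasurable hle, ?_⟩
  have := integral_mono_of_nonneg (.of_forall fun h => norm_nonneg _) hD hle
  simp only [norm_eq_abs] at this
  refine this.trans (le_of_eq ?_)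
  rw [integral_const_mul, integral_const_mul, integral_add k3 g2, integral_add k1 g1, k2,
    integral_add_left_eq_self (fun x : E3 => exp (-‖x‖ ^ 2)),
    integral_sub_left_eq_self (fun x : E3 => exp (-‖x‖ ^ 2))]
  ring

lemma integrable_secondDiff_gaussian : ∃ C, 0 ≤ C ∧ ∀ s : ℝ, 0 < s → ∀ x : E3,
    Integrable (fun h => secondDiff (fun x => exp (-s ^ 2 * ‖x‖ ^ 2)) x h / ‖h‖ ^ 4) ∧
    ∫ h, |secondDiff (fun x => exp (-s ^ 2 * ‖x‖ ^ 2)) x h / ‖h‖ ^ 4| ≤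
      C * s / (1 + s ^ 4 * ‖x‖ ^ 4) := by
  obtain ⟨C, hC, hb⟩ := integrable_secondDiff_unit_gaussian
  refine ⟨C, hC, fun s hs x => ?_⟩
  obtain ⟨h1, h2⟩ := hb (s • x)
  have e : ∀ h, secondDiff (fun x => exp (-s ^ 2 * ‖x‖ ^ 2)) x h / ‖h‖ ^ 4 =
      s ^ 4 * (secondDiff (fun x => exp (-‖x‖ ^ 2)) (s • x) (s • h) / ‖s • h‖ ^ 4) := by
    intro h
    simp only [secondDiff, ← smul_add, ← smul_sub, norm_smul, norm_eq_abs, abs_of_pos hs,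
      mul_pow, neg_mul]
    field_simp
  simp only [e]
  refine ⟨((integrable_comp_smul_iff volume
    (fun h => secondDiff (fun x => exp (-‖x‖ ^ 2)) (s • x) h / ‖h‖ ^ 4) hs.ne').2 h1).const_mul _,
    ?_⟩
  simp only [abs_mul, abs_of_pos (pow_pos hs 4)]
  rw [integral_const_mul, Measure.integral_comp_smul volume
    (fun h => |secondDiff (fun x => exp (-‖x‖ ^ 2)) (s • x) h / ‖h‖ ^ 4|) s, E3.finrank_eq,
    abs_of_pos (by positivity : 0 < (s ^ 3)⁻¹), smul_eq_mul, ← mul_assoc]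
  rw [norm_smul, norm_eq_abs, abs_of_pos hs, mul_pow] at h2
  calc _ ≤ s ^ 4 * (s ^ 3)⁻¹ * (C / (1 + s ^ 4 * ‖x‖ ^ 4)) := by gcongr
    _ = _ := by field_simp

/-- Up to normalization, the half-Laplacian at `x` of the Gaussian `exp (-s²‖·‖²)`. -/
noncomputable def gaussianSecondDiffIntegral (s : ℝ) (x : E3) : ℝ :=
  ∫ h, secondDiff (fun x => exp (-s ^ 2 * ‖x‖ ^ 2)) x h / ‖h‖ ^ 4

lemma halfLap_gaussian {s : ℝ} (hs : 0 < s) (x₀ x : E3) :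
    halfLap ((gaussianSchwartz (s ^ 2) (by positivity)).compSubConstCLM ℝ x₀) (x₀ + x) =
      1 / (2 * π ^ 2) * gaussianSecondDiffIntegral s x := by
  obtain ⟨C, -, hb⟩ := integrable_secondDiff_gaussian
  set φ := (gaussianSchwartz (s ^ 2) (by positivity)).compSubConstCLM ℝ x₀ with hφ
  have hv : ∀ y, φ y = exp (-s ^ 2 * ‖y - x₀‖ ^ 2) := fun y => rfl
  have he : (fun h => secondDiff φ (x₀ + x) h / ‖h‖ ^ 4) =
      fun h => secondDiff (fun x => exp (-s ^ 2 * ‖x‖ ^ 2)) x h / ‖h‖ ^ 4 := by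
    ext h
    simp only [secondDiff, hv]
    rw [add_sub_cancel_left, show x₀ + x + h - x₀ = x + h by abel,
      show x₀ + x - h - x₀ = x - h by abel]
  rw [halfLap_eq_integral_secondDiff φ (K := 1), he, gaussianSecondDiffIntegral]
  · intro y
    rw [hv, abs_exp, exp_le_one_iff]
    nlinarith [mul_nonneg (sq_nonneg s) (sq_nonneg ‖y - x₀‖)]
  · rw [he]; exact (hb s hs x).1

lemma integral_Ioi_mul_exp_neg {c : ℝ} (hc : 0 < c) :
    IntegrableOn (fun s : ℝ => 2 * s * exp (-(c * s ^ 2))) (Set.Ioi 0) ∧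
      ∫ s in Set.Ioi (0 : ℝ), 2 * s * exp (-(c * s ^ 2)) = 1 / c := by
  have hi : IntegrableOn (fun s : ℝ => 2 * s * exp (-(c * s ^ 2))) (Set.Ioi 0) := by
    refine (((integrable_mul_exp_neg_mul_sq hc).const_mul 2).congr
      (.of_forall fun s => ?_)).integrableOn
    simp only [neg_mul]; ring
  have hd : ∀ s ∈ Set.Ici (0 : ℝ), HasDerivAt (fun s : ℝ => -(1 / c) * exp (-(c * s ^ 2)))
      (2 * s * exp (-(c * s ^ 2))) s := by
    intro s _
    refine (((((hasDerivAt_pow 2 s).const_mul c).neg).exp).const_mul (-(1 / c))).congr_deriv ?_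
    simp only [Nat.cast_ofNat]
    field_simp
    simp [mul_comm]
  have ht : Tendsto (fun s : ℝ => -(1 / c) * exp (-(c * s ^ 2))) atTop (𝓝 (-(1 / c) * 0)) := by
    refine (tendsto_exp_atBot.comp (tendsto_neg_atTop_atBot.comp ?_)).const_mul _
    exact (tendsto_pow_atTop two_ne_zero).const_mul_atTop hc
  refine ⟨hi, ?_⟩
  rw [integral_Ioi_of_hasDerivAt_of_tendsto' hd hi ht]
  simp

/-- The weight representing `1 / (t² + r²) - 1 / (T² + r²)` as a mixture of the Gaussians
`exp (-s² r²)`. -/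
noncomputable def gaussianMixture (t T s : ℝ) : ℝ :=
  2 * s * (exp (-(t ^ 2 * s ^ 2)) - exp (-(T ^ 2 * s ^ 2)))

lemma abs_gaussianMixture_le {t T s : ℝ} (ht : 0 < t) (hT : t ≤ T) (hs : 0 < s) :
    |gaussianMixture t T s| ≤ 2 * T ^ 2 * s ^ 3 * exp (-t ^ 2 * s ^ 2) := by
  have h1 : t ^ 2 ≤ T ^ 2 := by gcongr
  have h2 : exp (-(T ^ 2 * s ^ 2)) = exp (-(t ^ 2 * s ^ 2)) * exp (-((T ^ 2 - t ^ 2) * s ^ 2)) := by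
    rw [← exp_add]; ring_nf
  have h3 := one_sub_le_exp_neg ((T ^ 2 - t ^ 2) * s ^ 2)
  have h4 : exp (-((T ^ 2 - t ^ 2) * s ^ 2)) ≤ 1 := by
    rw [exp_le_one_iff]; nlinarith [mul_nonneg (sub_nonneg.2 h1) (sq_nonneg s)]
  have h5 : 1 - exp (-((T ^ 2 - t ^ 2) * s ^ 2)) ≤ T ^ 2 * s ^ 2 := by
    nlinarith [mul_nonneg (sq_nonneg t) (sq_nonneg s)]
  have h6 : 0 ≤ 1 - exp (-((T ^ 2 - t ^ 2) * s ^ 2)) := by linarith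
  have h7 : gaussianMixture t T s =
      2 * s * (exp (-(t ^ 2 * s ^ 2)) * (1 - exp (-((T ^ 2 - t ^ 2) * s ^ 2)))) := by
    rw [gaussianMixture, h2]; ring
  rw [h7, abs_of_nonneg (by positivity)]
  calc _ ≤ 2 * s * (exp (-(t ^ 2 * s ^ 2)) * (T ^ 2 * s ^ 2)) := by gcongr
    _ = _ := by rw [neg_mul]; ring

lemma integrable_gaussianMixture_bound {t : ℝ} (ht : 0 < t) (T : ℝ) :
    Integrable (fun s : ℝ => 2 * T ^ 2 * ((1 + s ^ 4) * exp (-t ^ 2 * s ^ 2))) := by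
  have h1 : Integrable fun s : ℝ => exp (-t ^ 2 * s ^ 2) := integrable_exp_neg_mul_sq (by positivity)
  have h2 : Integrable fun s : ℝ => s ^ 4 * exp (-t ^ 2 * s ^ 2) := by
    simpa using integrable_rpow_mul_exp_neg_mul_sq (b := t ^ 2) (by positivity)
      (s := 4) (by norm_num)
  refine ((h1.add h2).const_mul (2 * T ^ 2)).congr (.of_forall fun s => ?_)
  simp only [Pi.add_apply]; ring

lemma integral_gaussianMixture {t T : ℝ} (ht : 0 < t) (hT : t ≤ T) (r : ℝ) :
    IntegrableOn (fun s => gaussianMixture t T s * exp (-s ^ 2 * r ^ 2)) (Set.Ioi 0) ∧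
      ∫ s in Set.Ioi 0, gaussianMixture t T s * exp (-s ^ 2 * r ^ 2) =
        1 / (t ^ 2 + r ^ 2) - 1 / (T ^ 2 + r ^ 2) := by
  have hT0 := ht.trans_le hT
  obtain ⟨a1, a2⟩ := integral_Ioi_mul_exp_neg (by positivity : 0 < t ^ 2 + r ^ 2)
  obtain ⟨b1, b2⟩ := integral_Ioi_mul_exp_neg (by positivity : 0 < T ^ 2 + r ^ 2)
  have e : (fun s => gaussianMixture t T s * exp (-s ^ 2 * r ^ 2)) = fun s =>
      2 * s * exp (-((t ^ 2 + r ^ 2) * s ^ 2)) - 2 * s * exp (-((T ^ 2 + r ^ 2) * s ^ 2)) := by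
    ext s
    rw [gaussianMixture, mul_assoc, sub_mul, ← exp_add, ← exp_add, mul_sub]
    ring_nf
  rw [e]
  exact ⟨a1.sub b1, by rw [integral_sub a1 b1, a2, b2]⟩

lemma measurable_gaussianMixture (t T : ℝ) : Measurable (gaussianMixture t T) := by
  unfold gaussianMixture; fun_prop

lemma measurable_gaussianSecondDiffIntegral :
    Measurable (fun p : E3 × ℝ => gaussianSecondDiffIntegral p.2 p.1) := by
  have h : Measurable (fun q : (E3 × ℝ) × E3 =>
      secondDiff (fun x => exp (-q.1.2 ^ 2 * ‖x‖ ^ 2)) q.1.1 q.2 / ‖q.2‖ ^ 4) := by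
    unfold secondDiff; fun_prop
  exact (h.stronglyMeasurable.integral_prod_right' (ν := volume)).measurable

lemma integral_gaussianMixture_mul_secondDiffIntegral {t T : ℝ} (ht : 0 < t) (hT : t ≤ T) (x : E3) :
    ∫ s in Set.Ioi 0, gaussianMixture t T s * gaussianSecondDiffIntegral s x =
      4 * π ^ 2 * (t / (t ^ 2 + ‖x‖ ^ 2) ^ 2 - T / (T ^ 2 + ‖x‖ ^ 2) ^ 2) := by
  obtain ⟨C, hC, hb⟩ := integrable_secondDiff_gaussian
  obtain ⟨a1, a2⟩ := integral_secondDiff_inv_div ht x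
  obtain ⟨b1, b2⟩ := integral_secondDiff_inv_div (ht.trans_le hT) x
  have hF : Integrable (Function.uncurry fun (h : E3) (s : ℝ) => gaussianMixture t T s *
      (secondDiff (fun x => exp (-s ^ 2 * ‖x‖ ^ 2)) x h / ‖h‖ ^ 4))
      (volume.prod (volume.restrict (Set.Ioi 0))) := by
    refine integrable_uncurry_of_le (G := fun s => C * (2 * T ^ 2 * ((1 + s ^ 4) *
      exp (-t ^ 2 * s ^ 2)))) ?_ ((integrable_gaussianMixture_bound ht T).integrableOn.const_mul C) ?_
    · have := measurable_gaussianMixture t T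
      unfold Function.uncurry secondDiff
      fun_prop
    · filter_upwards [ae_restrict_mem measurableSet_Ioi] with s hs
      have hs0 : (0 : ℝ) < s := hs
      obtain ⟨c1, c2⟩ := hb s hs0 x
      refine ⟨fun h => |gaussianMixture t T s| *
        |secondDiff (fun x => exp (-s ^ 2 * ‖x‖ ^ 2)) x h / ‖h‖ ^ 4|, c1.abs.const_mul _,
        .of_forall fun h => (abs_mul _ _).le, ?_⟩
      rw [integral_const_mul]
      have hm := abs_gaussianMixture_le ht hT hs0
      have h1 : C * s / (1 + s ^ 4 * ‖x‖ ^ 4) ≤ C * s :=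
        div_le_self (by positivity) (by have : 0 ≤ s ^ 4 * ‖x‖ ^ 4 := by positivity
                                        linarith)
      calc _ ≤ 2 * T ^ 2 * s ^ 3 * exp (-t ^ 2 * s ^ 2) * (C * s) := by
            gcongr; exact c2.trans h1
        _ = C * (2 * T ^ 2 * (s ^ 4 * exp (-t ^ 2 * s ^ 2))) := by ring
        _ ≤ _ := by gcongr; linarith
  have hsw := integral_integral_swap hF
  simp only [integral_const_mul] at hsw
  unfold gaussianSecondDiffIntegral
  rw [← hsw, mul_sub, ← a2, ← b2, ← integral_sub a1 b1]
  congr 1 with h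
  obtain ⟨i0, e0⟩ := integral_gaussianMixture ht hT ‖x‖
  obtain ⟨i1, e1⟩ := integral_gaussianMixture ht hT ‖x + h‖
  obtain ⟨i2, e2⟩ := integral_gaussianMixture ht hT ‖x - h‖
  have i3 : IntegrableOn (fun s => 2 * (gaussianMixture t T s * exp (-s ^ 2 * ‖x‖ ^ 2)) -
      gaussianMixture t T s * exp (-s ^ 2 * ‖x + h‖ ^ 2)) (Set.Ioi 0) := (i0.const_mul 2).sub i1
  have e : ∀ s : ℝ, gaussianMixture t T s *
      (secondDiff (fun x => exp (-s ^ 2 * ‖x‖ ^ 2)) x h / ‖h‖ ^ 4) =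
      (2 * (gaussianMixture t T s * exp (-s ^ 2 * ‖x‖ ^ 2)) -
      gaussianMixture t T s * exp (-s ^ 2 * ‖x + h‖ ^ 2) -
      gaussianMixture t T s * exp (-s ^ 2 * ‖x - h‖ ^ 2)) / ‖h‖ ^ 4 := by
    intro s; simp only [secondDiff]; ring
  simp only [e]
  rw [integral_div, integral_sub i3 i2, integral_sub (i0.const_mul 2) i1, integral_const_mul,
    e0, e1, e2]
  simp only [secondDiff]
  ring

/-- Mixing the identities tested against Gaussians yields one tested against Poisson kernels. -/
lemma integral_mul_poisson_sub {W f : E3 → ℝ} (hW : Continuous W)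
    (hWi : Integrable fun x => |W x| / (1 + ‖x‖ ^ 4)) (hf : Continuous f) (hfi : Integrable f)
    (h : ∀ s : ℝ, 0 < s → ∫ x, W x * gaussianSecondDiffIntegral s x =
      4 * π ^ 2 * ∫ x, f x * exp (-s ^ 2 * ‖x‖ ^ 2)) {t T : ℝ} (ht : 0 < t) (hT : t ≤ T) :
    ∫ x, W x * (t / (t ^ 2 + ‖x‖ ^ 2) ^ 2 - T / (T ^ 2 + ‖x‖ ^ 2) ^ 2) =
      ∫ x, f x * (1 / (t ^ 2 + ‖x‖ ^ 2) - 1 / (T ^ 2 + ‖x‖ ^ 2)) := by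
  obtain ⟨C, hC, hb⟩ := integrable_secondDiff_gaussian
  have hV := (integrable_gaussianMixture_bound ht T).integrableOn (s := Set.Ioi 0)
  have hmm := measurable_gaussianMixture t T
  have hae : ∀ᵐ p : E3 × ℝ ∂(volume.prod (volume.restrict (Set.Ioi 0))), 0 < p.2 :=
    Measure.quasiMeasurePreserving_snd.ae (ae_restrict_mem measurableSet_Ioi)
  have hF : Integrable (Function.uncurry fun (x : E3) (s : ℝ) => W x * (gaussianMixture t T s *
      gaussianSecondDiffIntegral s x)) (volume.prod (volume.restrict (Set.Ioi 0))) := by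
    refine ((hWi.const_mul C).mul_prod hV).mono' ?_ ?_
    · have := measurable_gaussianSecondDiffIntegral
      have := hW.measurable
      unfold Function.uncurry
      exact Measurable.aestronglyMeasurable (by fun_prop)
    · filter_upwards [hae] with p hp
      obtain ⟨x, s⟩ := p
      have hs : 0 < s := hp
      have h1 : |gaussianSecondDiffIntegral s x| ≤ C * s / (1 + s ^ 4 * ‖x‖ ^ 4) :=
        (abs_integral_le_integral_abs).trans (hb s hs x).2
      have h2 := abs_gaussianMixture_le ht hT hs
      have h3 : s ^ 4 / (1 + s ^ 4 * ‖x‖ ^ 4) ≤ (1 + s ^ 4) / (1 + ‖x‖ ^ 4) := by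
        rw [div_le_div_iff₀ (by positivity) (by positivity)]
        have : 0 ≤ s ^ 8 * ‖x‖ ^ 4 := by positivity
        nlinarith
      simp only [Function.uncurry, norm_mul, norm_eq_abs]
      calc |W x| * (|gaussianMixture t T s| * |gaussianSecondDiffIntegral s x|)
          ≤ |W x| * ((2 * T ^ 2 * s ^ 3 * exp (-t ^ 2 * s ^ 2)) *
            (C * s / (1 + s ^ 4 * ‖x‖ ^ 4))) := by gcongr
        _ = C * |W x| * (2 * T ^ 2 * (s ^ 4 / (1 + s ^ 4 * ‖x‖ ^ 4) *
            exp (-t ^ 2 * s ^ 2))) := by ring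
        _ ≤ C * |W x| * (2 * T ^ 2 * ((1 + s ^ 4) / (1 + ‖x‖ ^ 4) *
            exp (-t ^ 2 * s ^ 2))) := by gcongr
        _ = _ := by ring
  have hG : Integrable (Function.uncurry fun (x : E3) (s : ℝ) => f x * (gaussianMixture t T s *
      exp (-s ^ 2 * ‖x‖ ^ 2))) (volume.prod (volume.restrict (Set.Ioi 0))) := by
    refine (hfi.abs.mul_prod hV).mono' ?_ ?_
    · have := hf.measurable
      unfold Function.uncurry
      exact Measurable.aestronglyMeasurable (by fun_prop)
    · filter_upwards [hae] with p hp
      obtain ⟨x, s⟩ := p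
      have hs : 0 < s := hp
      have h2 := abs_gaussianMixture_le ht hT hs
      have h3 : exp (-s ^ 2 * ‖x‖ ^ 2) ≤ 1 := by
        rw [exp_le_one_iff]; nlinarith [mul_nonneg (sq_nonneg s) (sq_nonneg ‖x‖)]
      have h4 : s ^ 3 ≤ 1 + s ^ 4 := by
        rcases le_total s 1 with h | h
        · have : s ^ 3 ≤ 1 := pow_le_one₀ hs.le h
          have : 0 ≤ s ^ 4 := by positivity
          linarith
        · have : s ^ 3 ≤ s ^ 4 := pow_le_pow_right₀ h (by norm_num)
          linarith
      simp only [Function.uncurry, norm_mul, norm_eq_abs, abs_exp]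
      calc |f x| * (|gaussianMixture t T s| * exp (-s ^ 2 * ‖x‖ ^ 2))
          ≤ |f x| * ((2 * T ^ 2 * s ^ 3 * exp (-t ^ 2 * s ^ 2)) * 1) := by gcongr
        _ ≤ |f x| * ((2 * T ^ 2 * (1 + s ^ 4) * exp (-t ^ 2 * s ^ 2)) * 1) := by gcongr
        _ = _ := by ring
  have e1 := integral_integral_swap hF
  have e2 := integral_integral_swap hG
  simp only [integral_const_mul, integral_gaussianMixture_mul_secondDiffIntegral ht hT] at e1
  simp only [integral_const_mul, (integral_gaussianMixture ht hT _).2] at e2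
  have e3 : ∫ s in Set.Ioi (0 : ℝ), ∫ x, W x * (gaussianMixture t T s *
      gaussianSecondDiffIntegral s x) = 4 * π ^ 2 * ∫ s in Set.Ioi (0 : ℝ), ∫ x, f x *
        (gaussianMixture t T s * exp (-s ^ 2 * ‖x‖ ^ 2)) := by
    rw [← integral_const_mul]
    refine setIntegral_congr_fun measurableSet_Ioi fun s hs => ?_
    simp only [mul_left_comm _ (gaussianMixture t T s), integral_const_mul]
    rw [h s hs]
  rw [e3, ← e2] at e1
  have e4 : ∀ x, W x * (4 * π ^ 2 * (t / (t ^ 2 + ‖x‖ ^ 2) ^ 2 - T / (T ^ 2 + ‖x‖ ^ 2) ^ 2)) =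
      4 * π ^ 2 * (W x * (t / (t ^ 2 + ‖x‖ ^ 2) ^ 2 - T / (T ^ 2 + ‖x‖ ^ 2) ^ 2)) := fun x => by ring
  simp only [e4, integral_const_mul] at e1
  exact mul_left_cancel₀ (by positivity) e1

lemma integral_mul_poisson_eq (W : E3 → ℝ) {t : ℝ} (ht : 0 < t) :
    ∫ x, W x * (t / (t ^ 2 + ‖x‖ ^ 2) ^ 2) = ∫ y, W (t • y) * (1 / (1 ^ 2 + ‖y‖ ^ 2) ^ 2) := by
  have h := Measure.integral_comp_smul volume (fun x => W x * (t / (t ^ 2 + ‖x‖ ^ 2) ^ 2)) t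
  rw [E3.finrank_eq, abs_of_pos (by positivity : 0 < (t ^ 3)⁻¹), smul_eq_mul] at h
  have e : ∀ y : E3, W (t • y) * (t / (t ^ 2 + ‖t • y‖ ^ 2) ^ 2) =
      (t ^ 3)⁻¹ * (W (t • y) * (1 / (1 ^ 2 + ‖y‖ ^ 2) ^ 2)) := by
    intro y
    rw [norm_smul, norm_eq_abs, abs_of_pos ht, mul_pow,
      show t ^ 2 + t ^ 2 * ‖y‖ ^ 2 = t ^ 2 * (1 ^ 2 + ‖y‖ ^ 2) by ring]
    field_simp
  simp only [e] at h
  rw [integral_const_mul] at h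
  exact (mul_left_cancel₀ (by positivity) h).symm

lemma integrable_mul_poisson {W : E3 → ℝ} (hW : Continuous W)
    (hWi : Integrable fun x => |W x| / (1 + ‖x‖ ^ 4)) {t : ℝ} (ht : 0 < t) :
    Integrable fun x => W x * (t / (t ^ 2 + ‖x‖ ^ 2) ^ 2) := by
  refine (hWi.const_mul (t * (1 + 1 / t ^ 4))).mono' ?_ (.of_forall fun x => ?_)
  · have : Continuous fun x => W x * (t / (t ^ 2 + ‖x‖ ^ 2) ^ 2) := by
      fun_prop (disch := intros; positivity)
    exact this.aestronglyMeasurable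
  · rw [norm_mul, norm_eq_abs, norm_eq_abs,
      abs_of_pos (by positivity : 0 < t / (t ^ 2 + ‖x‖ ^ 2) ^ 2)]
    have : 1 / (t ^ 2 + ‖x‖ ^ 2) ^ 2 ≤ (1 + 1 / t ^ 4) / (1 + ‖x‖ ^ 4) := by
      rw [div_le_div_iff₀ (by positivity) (by positivity)]
      have h1 : (1 + 1 / t ^ 4) * (t ^ 2 + ‖x‖ ^ 2) ^ 2 =
        1 + ‖x‖ ^ 4 + (t ^ 4 + 2 * t ^ 2 * ‖x‖ ^ 2 + 2 * ‖x‖ ^ 2 / t ^ 2 + ‖x‖ ^ 4 / t ^ 4) := by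
        field_simp; ring
      rw [h1]
      have : 0 ≤ t ^ 4 + 2 * t ^ 2 * ‖x‖ ^ 2 + 2 * ‖x‖ ^ 2 / t ^ 2 + ‖x‖ ^ 4 / t ^ 4 := by
        positivity
      linarith
    calc _ = |W x| * t * (1 / (t ^ 2 + ‖x‖ ^ 2) ^ 2) := by ring
      _ ≤ |W x| * t * ((1 + 1 / t ^ 4) / (1 + ‖x‖ ^ 4)) := by gcongr
      _ = _ := by ring

lemma tendsto_integral_mul_poisson_zero {W : E3 → ℝ} (hW : Continuous W)
    (hWi : Integrable fun x => |W x| / (1 + ‖x‖ ^ 4)) :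
    Tendsto (fun t => ∫ x, W x * (t / (t ^ 2 + ‖x‖ ^ 2) ^ 2)) (𝓝[>] (0 : ℝ))
      (𝓝 (W 0 * π ^ 2)) := by
  have hB : MeasurableSet (Metric.closedBall (0 : E3) 1) := Metric.isClosed_closedBall.measurableSet
  set W₁ := (Metric.closedBall (0 : E3) 1).indicator W with hW₁
  obtain ⟨K, hK⟩ := (isCompact_closedBall (0 : E3) 1).exists_bound_of_continuousOn hW.continuousOn
  have hK0 : 0 ≤ K := (norm_nonneg _).trans (hK 0 (by simp))
  obtain ⟨k1, k2⟩ := radial_inv_sq one_pos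
  have hnear : Tendsto (fun t : ℝ => ∫ y, W₁ (t • y) * (1 / (1 ^ 2 + ‖y‖ ^ 2) ^ 2))
      (𝓝[>] (0 : ℝ)) (𝓝 (∫ y : E3, W 0 * (1 / (1 ^ 2 + ‖y‖ ^ 2) ^ 2))) := by
    refine tendsto_integral_filter_of_dominated_convergence
      (fun y => K * (1 / (1 ^ 2 + ‖y‖ ^ 2) ^ 2)) (.of_forall fun t => ?_)
      (.of_forall fun t => .of_forall fun y => ?_) (k1.const_mul K) (.of_forall fun y => ?_)
    · have : Measurable W₁ := hW.measurable.indicator hB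
      exact Measurable.aestronglyMeasurable (by fun_prop)
    · rw [norm_mul, norm_eq_abs (1 / _), abs_of_pos (by positivity : 0 < 1 / (1 ^ 2 + ‖y‖ ^ 2) ^ 2)]
      gcongr
      by_cases hy : t • y ∈ Metric.closedBall (0 : E3) 1
      · rw [hW₁, Set.indicator_of_mem hy]; exact hK _ hy
      · rw [hW₁, Set.indicator_of_notMem hy, norm_zero]; exact hK0
    · refine Tendsto.mul_const _ ?_
      have h0 : Tendsto (fun t : ℝ => t • y) (𝓝[>] 0) (𝓝 0) := by
        have : Tendsto (fun t : ℝ => t • y) (𝓝 0) (𝓝 ((0 : ℝ) • y)) := by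
          exact (continuous_id.smul continuous_const).tendsto 0
        rw [zero_smul] at this
        exact this.mono_left nhdsWithin_le_nhds
      refine ((hW.tendsto 0).comp h0).congr' ?_
      filter_upwards [h0 (Metric.closedBall_mem_nhds 0 one_pos)] with t ht
      exact (Set.indicator_of_mem (show t • y ∈ Metric.closedBall (0 : E3) 1 from ht) W).symm
  rw [integral_const_mul, k2, div_one] at hnear
  have hfar : Tendsto (fun t => ∫ x, (W x - W₁ x) * (t / (t ^ 2 + ‖x‖ ^ 2) ^ 2)) (𝓝[>] (0 : ℝ))
      (𝓝 0) := by
    have hl : Tendsto (fun t : ℝ => t * (2 * ∫ x, |W x| / (1 + ‖x‖ ^ 4))) (𝓝[>] 0) (𝓝 0) := by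
      have : Tendsto (fun t : ℝ => t * (2 * ∫ x, |W x| / (1 + ‖x‖ ^ 4))) (𝓝 0)
          (𝓝 (0 * (2 * ∫ x, |W x| / (1 + ‖x‖ ^ 4)))) := tendsto_id.mul_const _
      rw [zero_mul] at this
      exact this.mono_left nhdsWithin_le_nhds
    refine squeeze_zero_norm' ?_ hl
    filter_upwards [self_mem_nhdsWithin] with t ht
    have ht0 : 0 < t := ht
    rw [← integral_const_mul, ← integral_const_mul]
    refine norm_integral_le_of_norm_le ((hWi.const_mul 2).const_mul t) (.of_forall fun x => ?_)
    by_cases hx : x ∈ Metric.closedBall (0 : E3) 1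
    · rw [hW₁, Set.indicator_of_mem hx, sub_self, zero_mul, norm_zero]; positivity
    · have hx1 : 1 < ‖x‖ := by simpa using hx
      rw [hW₁, Set.indicator_of_notMem hx, sub_zero, norm_mul, norm_eq_abs, norm_eq_abs,
        abs_of_pos (by positivity : 0 < t / (t ^ 2 + ‖x‖ ^ 2) ^ 2)]
      have : 1 / (t ^ 2 + ‖x‖ ^ 2) ^ 2 ≤ 2 / (1 + ‖x‖ ^ 4) := by
        rw [div_le_div_iff₀ (by positivity) (by positivity)]
        have h1 : 1 ≤ ‖x‖ ^ 4 := one_le_pow₀ hx1.le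
        have : 0 ≤ t ^ 4 + 2 * t ^ 2 * ‖x‖ ^ 2 := by positivity
        nlinarith
      calc _ = |W x| * t * (1 / (t ^ 2 + ‖x‖ ^ 2) ^ 2) := by ring
        _ ≤ |W x| * t * (2 / (1 + ‖x‖ ^ 4)) := by gcongr
        _ = _ := by ring
  have := hnear.add hfar
  rw [add_zero] at this
  refine this.congr' ?_
  filter_upwards [self_mem_nhdsWithin] with t ht
  have ht0 : 0 < t := ht
  have hi := integrable_mul_poisson hW hWi ht0
  have hi1 : Integrable fun x => W₁ x * (t / (t ^ 2 + ‖x‖ ^ 2) ^ 2) := by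
    refine (hi.indicator hB).congr (.of_forall fun x => ?_)
    simp only [hW₁, Set.indicator]
    split_ifs <;> simp
  have hi2 : Integrable fun x => (W x - W₁ x) * (t / (t ^ 2 + ‖x‖ ^ 2) ^ 2) := by
    simp only [sub_mul]; exact hi.sub hi1
  rw [← integral_mul_poisson_eq W₁ ht0, ← integral_add hi1 hi2]
  congr 1 with x
  ring

lemma tendsto_integral_div_zero {f : E3 → ℝ} (hf : Continuous f) (hfi : Integrable f) :
    Tendsto (fun t => ∫ x, f x * (1 / (t ^ 2 + ‖x‖ ^ 2))) (𝓝[>] (0 : ℝ))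
      (𝓝 (∫ x, f x * (1 / ‖x‖ ^ 2))) := by
  have hr := integrable_riesz hf hfi 0
  simp only [zero_sub, norm_neg] at hr
  refine tendsto_integral_filter_of_dominated_convergence _ (.of_forall fun t => ?_)
    (.of_forall fun t => ?_) hr.norm ?_
  · have := hf.measurable
    exact Measurable.aestronglyMeasurable (by fun_prop)
  · filter_upwards [E3.ae_ne 0] with x hx
    have hx0 : 0 < ‖x‖ := norm_pos_iff.2 hx
    rw [norm_mul, norm_mul, mul_comm]
    gcongr
    rw [norm_eq_abs, norm_eq_abs, abs_of_pos (by positivity), abs_of_pos (by positivity)]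
    gcongr
    nlinarith [sq_nonneg t]
  · filter_upwards [E3.ae_ne 0] with x hx
    have hx0 : 0 < ‖x‖ := norm_pos_iff.2 hx
    have : ContinuousAt (fun t : ℝ => f x * (1 / (t ^ 2 + ‖x‖ ^ 2))) 0 := by
      have : (0 : ℝ) ^ 2 + ‖x‖ ^ 2 ≠ 0 := by positivity
      fun_prop (disch := assumption)
    have h := this.tendsto
    simp only [ne_eq, OfNat.ofNat_ne_zero, not_false_eq_true, zero_pow, zero_add] at h
    exact h.mono_left nhdsWithin_le_nhds

lemma integrable_mul_inv_sq_add {f : E3 → ℝ} (hf : Continuous f) (hfi : Integrable f) {t : ℝ}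
    (ht : 0 < t) : Integrable (fun x => f x * (1 / (t ^ 2 + ‖x‖ ^ 2))) ∧
      ‖∫ x, f x * (1 / (t ^ 2 + ‖x‖ ^ 2))‖ ≤ (∫ x, |f x|) / t ^ 2 := by
  have hle : ∀ x, ‖f x * (1 / (t ^ 2 + ‖x‖ ^ 2))‖ ≤ |f x| / t ^ 2 := by
    intro x
    rw [norm_mul, norm_eq_abs, norm_eq_abs, abs_of_pos (by positivity : 0 < 1 / (t ^ 2 + ‖x‖ ^ 2)),
      mul_one_div]
    gcongr
    nlinarith [sq_nonneg ‖x‖]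
  have hm := hf.measurable
  refine ⟨(hfi.abs.div_const (t ^ 2)).mono' (Measurable.aestronglyMeasurable (by fun_prop))
    (.of_forall hle), ?_⟩
  rw [← integral_div]
  exact norm_integral_le_of_norm_le (hfi.abs.div_const _) (.of_forall hle)

lemma tendsto_integral_mul_poisson_atTop {W f : E3 → ℝ} (hW : Continuous W)
    (hWi : Integrable fun x => |W x| / (1 + ‖x‖ ^ 4)) (hf : Continuous f) (hfi : Integrable f)
    (h : ∀ s : ℝ, 0 < s → ∫ x, W x * gaussianSecondDiffIntegral s x =
      4 * π ^ 2 * ∫ x, f x * exp (-s ^ 2 * ‖x‖ ^ 2)) :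
    Tendsto (fun T => ∫ x, W x * (T / (T ^ 2 + ‖x‖ ^ 2) ^ 2)) atTop
      (𝓝 (W 0 * π ^ 2 - ∫ x, f x * (1 / ‖x‖ ^ 2))) := by
  have key : ∀ T : ℝ, 0 < T → ∫ x, W x * (T / (T ^ 2 + ‖x‖ ^ 2) ^ 2) =
      W 0 * π ^ 2 - (∫ x, f x * (1 / ‖x‖ ^ 2)) + ∫ x, f x * (1 / (T ^ 2 + ‖x‖ ^ 2)) := by
    intro T hT
    have h1 := (tendsto_integral_mul_poisson_zero hW hWi).sub_const
      (∫ x, W x * (T / (T ^ 2 + ‖x‖ ^ 2) ^ 2))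
    have h2 := (tendsto_integral_div_zero hf hfi).sub_const
      (∫ x, f x * (1 / (T ^ 2 + ‖x‖ ^ 2)))
    have := tendsto_nhds_unique (h1.congr' ?_) h2
    · linarith
    filter_upwards [Ioo_mem_nhdsGT hT] with t ht
    rw [← integral_sub (integrable_mul_poisson hW hWi ht.1) (integrable_mul_poisson hW hWi hT),
      ← integral_sub (integrable_mul_inv_sq_add hf hfi ht.1).1
        (integrable_mul_inv_sq_add hf hfi hT).1]
    simp only [← mul_sub]
    exact integral_mul_poisson_sub hW hWi hf hfi h ht.1 ht.2.le
  have hJ : Tendsto (fun T : ℝ => ∫ x, f x * (1 / (T ^ 2 + ‖x‖ ^ 2))) atTop (𝓝 0) := by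
    refine squeeze_zero_norm' ?_ (tendsto_const_nhds.div_atTop (tendsto_pow_atTop two_ne_zero) :
      Tendsto (fun T : ℝ => (∫ x, |f x|) / T ^ 2) atTop (𝓝 0))
    filter_upwards [eventually_gt_atTop 0] with T hT
    exact (integrable_mul_inv_sq_add hf hfi hT).2
  have := hJ.const_add (W 0 * π ^ 2 - ∫ x, f x * (1 / ‖x‖ ^ 2))
  rw [add_zero] at this
  refine this.congr' ?_
  filter_upwards [eventually_gt_atTop 0] with T hT
  exact (key T hT).symm

lemma tendsto_integral_mul_poisson_of_vanish {W : E3 → ℝ} (hW : Continuous W)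
    (h0 : Tendsto W (comap (fun x => ‖x‖) atTop) (𝓝 0)) :
    Tendsto (fun T => ∫ x, W x * (T / (T ^ 2 + ‖x‖ ^ 2) ^ 2)) atTop (𝓝 0) := by
  obtain ⟨K, hK⟩ : ∃ K, ∀ x, ‖W x‖ ≤ K := by
    have h1 : ∀ᶠ x in comap (fun x : E3 => ‖x‖) atTop, ‖W x‖ ≤ 1 :=
      (h0.norm.eventually (ge_mem_nhds (by simp)))
    obtain ⟨R, hR⟩ := eventually_atTop.1 (eventually_comap.1 h1)
    obtain ⟨K, hK⟩ := (isCompact_closedBall (0 : E3) R).exists_bound_of_continuousOn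
      hW.continuousOn
    refine ⟨max K 1, fun x => ?_⟩
    rcases le_total ‖x‖ R with hx | hx
    · exact (hK x (by simpa using hx)).trans (le_max_left _ _)
    · exact (hR _ hx x rfl).trans (le_max_right _ _)
  obtain ⟨k1, -⟩ := radial_inv_sq one_pos
  have : Tendsto (fun T : ℝ => ∫ y, W (T • y) * (1 / (1 ^ 2 + ‖y‖ ^ 2) ^ 2)) atTop
      (𝓝 (∫ _ : E3, (0 : ℝ))) := by
    refine tendsto_integral_filter_of_dominated_convergence
      (fun y => K * (1 / (1 ^ 2 + ‖y‖ ^ 2) ^ 2)) (.of_forall fun T => ?_)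
      (.of_forall fun T => .of_forall fun y => ?_) (k1.const_mul K) ?_
    · have := hW.measurable
      exact Measurable.aestronglyMeasurable (by fun_prop)
    · rw [norm_mul, norm_eq_abs (1 / _), abs_of_pos (by positivity : 0 < 1 / (1 ^ 2 + ‖y‖ ^ 2) ^ 2)]
      gcongr
      exact hK _
    · filter_upwards [E3.ae_ne 0] with y hy
      rw [← zero_mul (1 / (1 ^ 2 + ‖y‖ ^ 2) ^ 2)]
      refine Tendsto.mul_const _ (h0.comp (tendsto_comap_iff.2 ?_))
      have : Tendsto (fun T : ℝ => |T| * ‖y‖) atTop atTop :=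
        tendsto_abs_atTop_atTop.atTop_mul_const (norm_pos_iff.2 hy)
      refine this.congr fun T => ?_
      rw [Function.comp_apply, norm_smul, norm_eq_abs]
  rw [integral_zero] at this
  refine this.congr' ?_
  filter_upwards [eventually_gt_atTop 0] with T hT
  rw [integral_mul_poisson_eq W hT]

lemma one_add_norm_add_pow_four_le (a x : E3) :
    1 + ‖a + x‖ ^ 4 ≤ 8 * (1 + ‖a‖ ^ 4) * (1 + ‖x‖ ^ 4) := by
  have h1 : ‖a + x‖ ^ 4 ≤ (‖a‖ + ‖x‖) ^ 4 := by gcongr; exact norm_add_le a x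
  have h2 : (‖a‖ + ‖x‖) ^ 2 ≤ 2 * (‖a‖ ^ 2 + ‖x‖ ^ 2) := by nlinarith [sq_nonneg (‖a‖ - ‖x‖)]
  have h3 : (‖a‖ + ‖x‖) ^ 4 ≤ 8 * (‖a‖ ^ 4 + ‖x‖ ^ 4) := by
    calc (‖a‖ + ‖x‖) ^ 4 = ((‖a‖ + ‖x‖) ^ 2) ^ 2 := by ring
      _ ≤ (2 * (‖a‖ ^ 2 + ‖x‖ ^ 2)) ^ 2 := by gcongr
      _ ≤ _ := by nlinarith [sq_nonneg (‖a‖ ^ 2 - ‖x‖ ^ 2)]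
  have : 0 ≤ ‖a‖ ^ 4 * ‖x‖ ^ 4 := by positivity
  nlinarith

lemma integrable_translate_div {w : E3 → ℝ} (hw : Continuous w)
    (hwi : Integrable fun x => |w x| / (1 + ‖x‖ ^ 4)) (a : E3) :
    Integrable fun x => |w (a + x)| / (1 + ‖x‖ ^ 4) := by
  refine ((hwi.comp_add_left a).const_mul (8 * (1 + ‖a‖ ^ 4))).mono' ?_ (.of_forall fun x => ?_)
  · have := hw.measurable
    exact Measurable.aestronglyMeasurable (by fun_prop)
  · rw [norm_eq_abs, abs_of_nonneg (by positivity), ← mul_div_assoc,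
      div_le_div_iff₀ (by positivity) (by positivity)]
    calc _ ≤ |w (a + x)| * (8 * (1 + ‖a‖ ^ 4) * (1 + ‖x‖ ^ 4)) := by
          gcongr; exact one_add_norm_add_pow_four_le a x
      _ = _ := by ring

lemma abs_poisson_sub_le {T a b : ℝ} (hT : 1 ≤ T) (ha : 0 ≤ a) (hb : 0 ≤ b) :
    |T / (T ^ 2 + a ^ 2) ^ 2 - T / (T ^ 2 + b ^ 2) ^ 2| ≤
      |a - b| * (1 / (1 + a ^ 4) + 1 / (1 + b ^ 4)) := by
  have hA : 0 < T ^ 2 + a ^ 2 := by positivity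
  have hB : 0 < T ^ 2 + b ^ 2 := by positivity
  have h1 : ∀ c : ℝ, 1 / (T ^ 2 + c ^ 2) ^ 2 ≤ 1 / (1 + c ^ 4) := by
    intro c
    gcongr
    have : 1 ≤ T ^ 4 := one_le_pow₀ hT
    have : 0 ≤ T ^ 2 * c ^ 2 := by positivity
    nlinarith
  have h2 : T / (T ^ 2 + a ^ 2) ^ 2 - T / (T ^ 2 + b ^ 2) ^ 2 =
      (b - a) * (T * (a + b) * ((T ^ 2 + a ^ 2) + (T ^ 2 + b ^ 2)) /
        ((T ^ 2 + a ^ 2) ^ 2 * (T ^ 2 + b ^ 2) ^ 2)) := by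
    field_simp; ring
  have h3 : T * (a + b) ≤ ((T ^ 2 + a ^ 2) + (T ^ 2 + b ^ 2)) / 2 := by
    nlinarith [sq_nonneg (T - a), sq_nonneg (T - b)]
  rw [h2, abs_mul, abs_sub_comm b a, abs_of_nonneg (by positivity :
    0 ≤ T * (a + b) * ((T ^ 2 + a ^ 2) + (T ^ 2 + b ^ 2)) /
        ((T ^ 2 + a ^ 2) ^ 2 * (T ^ 2 + b ^ 2) ^ 2))]
  gcongr
  refine le_trans ?_ (add_le_add (h1 a) (h1 b))
  set A := T ^ 2 + a ^ 2
  set B := T ^ 2 + b ^ 2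
  clear_value A B
  rw [div_add_div _ _ (by positivity) (by positivity), one_mul, mul_one]
  gcongr
  nlinarith [sq_nonneg (A - B), mul_le_mul_of_nonneg_right h3 (add_pos hA hB).le]

lemma tendsto_poisson_atTop (r : ℝ) : Tendsto (fun T : ℝ => T / (T ^ 2 + r ^ 2) ^ 2) atTop (𝓝 0) := by
  refine squeeze_zero' ?_ ?_ tendsto_inv_atTop_zero
  · filter_upwards [eventually_ge_atTop 0] with T hT
    positivity
  · filter_upwards [eventually_ge_atTop 1] with T hT
    have hT0 : 0 < T := by linarith
    rw [inv_eq_one_div, div_le_div_iff₀ (by positivity) hT0]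
    have h1 : T ^ 2 ≤ T ^ 4 := pow_le_pow_right₀ hT (by norm_num)
    have : 0 ≤ 2 * T ^ 2 * r ^ 2 + r ^ 4 := by positivity
    nlinarith

/-- Poisson averages of the same function around two centres agree asymptotically. -/
lemma tendsto_integral_mul_poisson_translate_sub {w : E3 → ℝ} (hw : Continuous w)
    (hwi : Integrable fun x => |w x| / (1 + ‖x‖ ^ 4)) (a : E3) :
    Tendsto (fun T => (∫ x, w (a + x) * (T / (T ^ 2 + ‖x‖ ^ 2) ^ 2)) -
      ∫ x, w x * (T / (T ^ 2 + ‖x‖ ^ 2) ^ 2)) atTop (𝓝 0) := by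
  have hwa := integrable_translate_div hw hwi a
  have hwa' : Integrable fun x => |w x| / (1 + ‖x - a‖ ^ 4) := by
    have := hwa.comp_sub_right a
    simpa only [add_sub_cancel] using this
  have hm := hw.measurable
  have h : Tendsto (fun T : ℝ => ∫ x, w x * (T / (T ^ 2 + ‖x - a‖ ^ 2) ^ 2 -
      T / (T ^ 2 + ‖x‖ ^ 2) ^ 2)) atTop (𝓝 (∫ _ : E3, (0 : ℝ))) := by
    refine tendsto_integral_filter_of_dominated_convergence
      (fun x => ‖a‖ * (|w x| / (1 + ‖x - a‖ ^ 4) + |w x| / (1 + ‖x‖ ^ 4)))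
      (.of_forall fun T => Measurable.aestronglyMeasurable (by fun_prop)) ?_
      ((hwa'.add hwi).const_mul _) (.of_forall fun x => ?_)
    · filter_upwards [eventually_ge_atTop 1] with T hT
      refine .of_forall fun x => ?_
      rw [norm_mul, norm_eq_abs, norm_eq_abs]
      have h1 := abs_poisson_sub_le hT (norm_nonneg (x - a)) (norm_nonneg x)
      have h2 : |‖x - a‖ - ‖x‖| ≤ ‖a‖ := by
        simpa using abs_norm_sub_norm_le (x - a) x
      calc _ ≤ |w x| * (‖a‖ * (1 / (1 + ‖x - a‖ ^ 4) + 1 / (1 + ‖x‖ ^ 4))) := by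
            gcongr
            exact h1.trans (by gcongr)
        _ = _ := by ring
    · have := ((tendsto_poisson_atTop ‖x - a‖).sub (tendsto_poisson_atTop ‖x‖)).const_mul (w x)
      simpa using this
  rw [integral_zero] at h
  refine h.congr' ?_
  filter_upwards [eventually_gt_atTop 0] with T hT
  have e1 : ∫ x, w (a + x) * (T / (T ^ 2 + ‖x‖ ^ 2) ^ 2) =
      ∫ x, w x * (T / (T ^ 2 + ‖x - a‖ ^ 2) ^ 2) := by
    rw [← integral_sub_right_eq_self (fun x => w (a + x) * (T / (T ^ 2 + ‖x‖ ^ 2) ^ 2)) a]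
    simp only [add_sub_cancel]
  have i1 : Integrable fun x => w x * (T / (T ^ 2 + ‖x - a‖ ^ 2) ^ 2) := by
    have := (integrable_mul_poisson (W := fun x => w (a + x)) (by fun_prop) hwa hT).comp_sub_right a
    simpa only [add_sub_cancel] using this
  rw [e1, ← integral_sub i1 (integrable_mul_poisson hw hwi hT)]
  simp only [mul_sub]

section Solution

variable {u : E3 → ℝ}

lemma IsSolution.integral_lap_mul_gaussian (hu : IsSolution u) (a : E3) {s : ℝ} (hs : 0 < s) :
    ∫ x, -lap u (a + x) * gaussianSecondDiffIntegral s x =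
      4 * π ^ 2 * ∫ x, exp (3 * u (a + x)) * exp (-s ^ 2 * ‖x‖ ^ 2) := by
  obtain ⟨-, -, -, h⟩ := hu
  have h1 := h ((gaussianSchwartz (s ^ 2) (by positivity)).compSubConstCLM ℝ a)
  rw [← integral_add_left_eq_self _ a] at h1
  rw [← integral_add_left_eq_self (fun x => exp (3 * u x) * _) a] at h1
  have hv : ∀ x, (gaussianSchwartz (s ^ 2) (by positivity)).compSubConstCLM ℝ a (a + x) =
      exp (-s ^ 2 * ‖x‖ ^ 2) := fun x => by
    rw [SchwartzMap.compSubConstCLM_apply, add_sub_cancel_left]; rfl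
  simp only [halfLap_gaussian hs, hv, mul_left_comm _ (1 / (2 * π ^ 2)), integral_const_mul] at h1
  have hp : π ≠ 0 := pi_ne_zero
  have h2 {X Y : ℝ} (hXY : 1 / (2 * π ^ 2) * X = 2 * Y) : X = 4 * π ^ 2 * Y := by
    field_simp at hXY
    linarith
  exact h2 h1

lemma IsSolution.tendsto_poisson (hu : IsSolution u) (a : E3) :
    Tendsto (fun T => ∫ x, -lap u (a + x) * (T / (T ^ 2 + ‖x‖ ^ 2) ^ 2)) atTop
      (𝓝 (-lap u a * π ^ 2 - ∫ y, 1 / ‖a - y‖ ^ 2 * exp (3 * u y))) := by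
  have hc := continuous_lap hu.1
  have hwi : Integrable fun x => |(-lap u x)| / (1 + ‖x‖ ^ 4) := by
    simpa only [abs_neg] using hu.2.1.2
  have hf := continuous_exp_three_mul hu.1
  have h := tendsto_integral_mul_poisson_atTop (W := fun x => -lap u (a + x))
    (f := fun x => exp (3 * u (a + x))) (by fun_prop)
    (integrable_translate_div hc.neg hwi a) (hf.comp (continuous_const.add continuous_id))
    (hu.2.2.1.comp_add_left a) (fun s hs => hu.integral_lap_mul_gaussian a hs)
  rw [add_zero] at h
  have e : ∫ y, 1 / ‖a - y‖ ^ 2 * exp (3 * u y) =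
      ∫ x, exp (3 * u (a + x)) * (1 / ‖x‖ ^ 2) := by
    rw [← integral_add_left_eq_self _ a]
    simp only [sub_add_cancel_left, norm_neg, mul_comm]
  rwa [e]

/-- The Laplacian of a solution is a Riesz potential up to an additive constant. -/
lemma IsSolution.exists_neg_lap_eq (hu : IsSolution u) :
    ∃ C₀, (∀ x, -lap u x = 1 / π ^ 2 * (∫ y, 1 / ‖x - y‖ ^ 2 * exp (3 * u y)) + C₀) ∧
      (Tendsto (fun x => lap u x) (comap (fun x : E3 => ‖x‖) atTop) (𝓝 0) → C₀ = 0) := by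
  have hc := continuous_lap hu.1
  have hwi : Integrable fun x => |(-lap u x)| / (1 + ‖x‖ ^ 4) := by
    simpa only [abs_neg] using hu.2.1.2
  have h0 := hu.tendsto_poisson 0
  simp only [zero_add] at h0
  set l := -lap u 0 * π ^ 2 - ∫ y, 1 / ‖0 - y‖ ^ 2 * exp (3 * u y)
  have hp : π ≠ 0 := pi_ne_zero
  refine ⟨l / π ^ 2, fun x => ?_, fun ht => ?_⟩
  · have h1 := tendsto_nhds_unique ((hu.tendsto_poisson x).sub h0)
      (tendsto_integral_mul_poisson_translate_sub hc.neg hwi x)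
    rw [← sub_eq_zero.1 h1]
    field_simp
    ring
  · have h1 : Tendsto (fun x => -lap u x) (comap (fun x : E3 => ‖x‖) atTop) (𝓝 0) := by
      simpa using ht.neg
    rw [tendsto_nhds_unique h0 (tendsto_integral_mul_poisson_of_vanish hc.neg h1), zero_div]

lemma IsSolution.isSpherical_of_neg_lap_eq (hu : IsSolution u)
    (h : ∀ x, -lap u x = 1 / π ^ 2 * ∫ y, 1 / ‖x - y‖ ^ 2 * exp (3 * u y)) : IsSpherical u :=
  have ⟨_, hc⟩ := exists_sub_solV_const hu.1 hu.2.2.1 h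
  (intEq_of_sub_solV_const hu.1 hu.2.2.1 hc).isSpherical

end Solution

/-- Theorem 3: for a smooth finite-volume solution `u` of `(−Δ)^{3/2}u = 2e^{3u}`, the
following are equivalent: (i) `u` is spherical; (ii) `p = u − v` is constant;
(iii) `Δu(x) → 0` as `|x| → ∞`; (iv) `u(x)/|x|² → 0` as `|x| → ∞`. -/
theorem spherical_characterization (u : E3 → ℝ) (hu : IsSolution u) :
    (IsSpherical u ↔ ∃ c : ℝ, ∀ x : E3, u x - solV u x = c) ∧
    (IsSpherical u ↔ Filter.Tendsto (fun x : E3 => lap u x)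
      (Filter.comap (fun x : E3 => ‖x‖) Filter.atTop) (𝓝 0)) ∧
    (IsSpherical u ↔ Filter.Tendsto (fun x : E3 => u x / ‖x‖ ^ 2)
      (Filter.comap (fun x : E3 => ‖x‖) Filter.atTop) (𝓝 0)) := by
  obtain ⟨C₀, h, h0⟩ := hu.exists_neg_lap_eq
  have key (hC : C₀ = 0) : IsSpherical u :=
    hu.isSpherical_of_neg_lap_eq fun x => by rw [h x, hC, add_zero]
  refine ⟨⟨fun hs => ?_, fun ⟨c, hc⟩ => (intEq_of_sub_solV_const hu.1 hu.2.2.1 hc).isSpherical⟩,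
    ⟨fun hs => hs.tendsto_lap, fun ht => key (h0 ht)⟩,
    ⟨fun hs => hs.tendsto_div_norm_sq,
      fun ht => key (const_eq_zero_of_tendsto_div_norm_sq hu.1 hu.2.2.1 h ht)⟩⟩
  have hC := h0 hs.tendsto_lap
  exact exists_sub_solV_const hu.1 hu.2.2.1 fun x => by rw [h x, hC, add_zero]
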